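/- Let r and s be integers with 0 ≤ s ≤ r, let F be either ℝ or ℂ, and let n ≥ 2 be an integer. Then (n−1)(r+s−1) + 1 ≤ TC_n(FH_{r,s}) ≤ n(r+s−1) + 1. Moreover, if both r and s are odd, then TC_n(ℝH_{r,s}) ≤ n(r+s−1). -/

import Mathlib

open scoped unitInterval

noncomputable section

/-- Topology on the projectivization, as a quotient of the nonzero vectors. -/
instance projTop (K V : Type*) [DivisionRing K] [AddCommGroup V] [Module K V]
    [TopologicalSpace V] : TopologicalSpace (Projectivization K V) :=
  inferInstanceAs (TopologicalSpace (Quotient (projectivizationSetoid K V)))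

/-- The real Milnor manifold `ℝH_{r,s}`, as the subspace of `ℝPʳ × ℝPˢ` of pairs
`([x], [y])` with `x₀y₀ + ⋯ + x_sy_s = 0` (for `s ≤ r`). -/
def RealMilnor (r s : ℕ) :
    Set (Projectivization ℝ (Fin (r + 1) → ℝ) × Projectivization ℝ (Fin (s + 1) → ℝ)) :=
  {p | ∑ i : Fin (min (s + 1) (r + 1)),
      p.1.rep (Fin.castLE (min_le_right _ _) i) * p.2.rep (Fin.castLE (min_le_left _ _) i) = 0}

/-- The complex Milnor manifold `ℂH_{r,s}`, as the subspace of `ℂPʳ × ℂPˢ` of pairs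
`([z], [w])` with `z₀w̄₀ + ⋯ + z_sw̄_s = 0` (for `s ≤ r`). -/
def ComplexMilnor (r s : ℕ) :
    Set (Projectivization ℂ (Fin (r + 1) → ℂ) × Projectivization ℂ (Fin (s + 1) → ℂ)) :=
  {p | ∑ i : Fin (min (s + 1) (r + 1)),
      p.1.rep (Fin.castLE (min_le_right _ _) i) *
        (starRingEnd ℂ) (p.2.rep (Fin.castLE (min_le_left _ _) i)) = 0}

/-- The Lusternik–Schnirelmann category of `X`: the least number of open sets covering `X`,
each of whose inclusion into `X` is null-homotopic. -/
def lsCat (X : Type*) [TopologicalSpace X] : ℕ :=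
  sInf {k | 0 < k ∧ ∃ U : Fin k → Set X,
    (∀ i, IsOpen (U i)) ∧ (⋃ i, U i) = Set.univ ∧
    ∀ i, ∃ x₀ : X, ∃ H : C(U i × I, X),
      (∀ u : U i, H (u, 0) = (u : X)) ∧ (∀ u : U i, H (u, 1) = x₀)}

/-- The fibration `π_n : X^I → X^n`, evaluating a path at the times `i/(n-1)`,
`i = 0, …, n-1`. -/
def tcPi (X : Type*) [TopologicalSpace X] (n : ℕ) (γ : C(I, X)) : Fin n → X :=
  fun i => γ (Set.projIcc (0 : ℝ) 1 zero_le_one ((i : ℝ) / ((n : ℝ) - 1)))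

/-- The `n`-th higher (sequential) topological complexity of `X`: the least number of open
sets covering `X^n`, each admitting a continuous local section of `π_n : X^I → X^n`. -/
def higherTC (X : Type*) [TopologicalSpace X] (n : ℕ) : ℕ :=
  sInf {k | 0 < k ∧ ∃ U : Fin k → Set (Fin n → X),
    (∀ i, IsOpen (U i)) ∧ (⋃ i, U i) = Set.univ ∧
    ∀ i, ∃ sec : C(U i, C(I, X)), ∀ u : U i, tcPi X n (sec u) = (u : Fin n → X)}

/-- The `n`-th higher equivariant topological complexity of a `G`-space `X`:
the least number of `G`-invariant open sets covering `X^n` (with the diagonal action),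
each admitting a `G`-equivariant map to `X^I` whose composite with `π_n` is
`G`-homotopic to the inclusion. -/
def eqHigherTC (G : Type*) [Group G] (X : Type*) [TopologicalSpace X] [MulAction G X]
    (n : ℕ) : ℕ :=
  sInf {k | 0 < k ∧ ∃ U : Fin k → Set (Fin n → X),
    (∀ i, IsOpen (U i)) ∧ (⋃ i, U i) = Set.univ ∧
    (∀ i (g : G), ∀ v ∈ U i, g • v ∈ U i) ∧
    ∀ i, ∃ sec : C(U i, C(I, X)),
      (∀ (g : G) (v : U i) (hgv : g • (v : Fin n → X) ∈ U i) (t : I),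
        (sec ⟨g • (v : Fin n → X), hgv⟩) t = g • (sec v) t) ∧
      ∃ H : C(U i × I, Fin n → X),
        (∀ v : U i, H (v, 0) = tcPi X n (sec v)) ∧
        (∀ v : U i, H (v, 1) = (v : Fin n → X)) ∧
        (∀ (g : G) (v : U i) (hgv : g • (v : Fin n → X) ∈ U i) (t : I),
          H (⟨g • (v : Fin n → X), hgv⟩, t) = g • H (v, t))}

/-- `X` has covering dimension at most `m`: every finite open cover admits an open
refinement which still covers `X` and in which every point lies in at most `m + 1` sets. -/
def HasCovDimLE (X : Type*) [TopologicalSpace X] (m : ℕ) : Prop :=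
  ∀ 𝒰 : Set (Set X), 𝒰.Finite → (∀ U ∈ 𝒰, IsOpen U) → ⋃₀ 𝒰 = Set.univ →
    ∃ 𝒱 : Set (Set X), (∀ V ∈ 𝒱, IsOpen V) ∧ ⋃₀ 𝒱 = Set.univ ∧
      (∀ V ∈ 𝒱, ∃ U ∈ 𝒰, V ⊆ U) ∧
      ∀ x : X, {V ∈ 𝒱 | x ∈ V}.encard ≤ (m + 1 : ℕ)

/-- The covering dimension of `X`. -/
def covDim (X : Type*) [TopologicalSpace X] : ℕ :=
  sInf {m | HasCovDimLE X m}

end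


namespace MilnorTC

/-! ### Chains of tuples with mod 2 coefficients -/

section Chains
variable {V : Type*}

/-- Mod 2 chains on tuples of points. -/
abbrev Ch (V : Type*) := List V →₀ ZMod 2

noncomputable def sg (l : List V) : Ch V := Finsupp.single l 1

noncomputable def cone (v : V) : Ch V →ₗ[ZMod 2] Ch V := Finsupp.lmapDomain _ _ (List.cons v)

noncomputable def mp (f : V → V) : Ch V →ₗ[ZMod 2] Ch V := Finsupp.lmapDomain _ _ (List.map f)

noncomputable def bdL : List V → Ch V
  | [] => 0
  | v :: l => sg l + cone v (bdL l)

noncomputable def bd : Ch V →ₗ[ZMod 2] Ch V := Finsupp.linearCombination (ZMod 2) bdL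

noncomputable def prL (f g : V → V) : List V → Ch V
  | [] => 0
  | v :: l => sg (f v :: g v :: l.map g) + cone (f v) (prL f g l)

noncomputable def pr (f g : V → V) : Ch V →ₗ[ZMod 2] Ch V :=
  Finsupp.linearCombination (ZMod 2) (prL f g)

lemma cone_sg (v : V) (l : List V) : cone v (sg l) = sg (v :: l) := by
  simp [cone, sg, Finsupp.mapDomain_single]
lemma mp_sg (f : V → V) (l : List V) : mp f (sg l) = sg (l.map f) := by
  simp [mp, sg, Finsupp.mapDomain_single]
lemma bd_sg (l : List V) : bd (sg l) = bdL l := by simp [bd, sg]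
lemma pr_sg (f g : V → V) (l : List V) : pr f g (sg l) = prL f g l := by simp [pr, sg]

/-- linear maps agree if they agree on tuples -/
lemma ch_ext {M : Type*} [AddCommGroup M] [Module (ZMod 2) M] {S T : Ch V →ₗ[ZMod 2] M}
    (h : ∀ l, S (sg l) = T (sg l)) : S = T :=
  Finsupp.lhom_ext' fun l => LinearMap.ext_ring (by simpa [sg] using h l)

lemma bd_cone (v : V) (c : Ch V) : bd (cone v c) = c + cone v (bd c) := by
  have : bd ∘ₗ cone v = LinearMap.id + cone v ∘ₗ bd := by
    apply ch_ext; intro l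
    simp [cone_sg, bd_sg, bdL]
  exact LinearMap.congr_fun this c

lemma mp_cone (f : V → V) (v : V) (c : Ch V) : mp f (cone v c) = cone (f v) (mp f c) := by
  have : mp f ∘ₗ cone v = cone (f v) ∘ₗ mp f := by
    apply ch_ext; intro l
    simp [cone_sg, mp_sg]
  exact LinearMap.congr_fun this c

lemma bd_mp (f : V → V) (c : Ch V) : bd (mp f c) = mp f (bd c) := by
  have : bd ∘ₗ mp f = mp f ∘ₗ bd := by
    apply ch_ext; intro l
    simp only [LinearMap.comp_apply, mp_sg, bd_sg]
    induction l with
    | nil => simp [bdL]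
    | cons v l ih => simp [bdL, ih, mp_sg, mp_cone]
  exact LinearMap.congr_fun this c

lemma pr_cone (f g : V → V) (v : V) (c : Ch V) :
    pr f g (cone v c) = cone (f v) (cone (g v) (mp g c)) + cone (f v) (pr f g c) := by
  have : pr f g ∘ₗ cone v = cone (f v) ∘ₗ cone (g v) ∘ₗ mp g + cone (f v) ∘ₗ pr f g := by
    apply ch_ext; intro l
    simp [cone_sg, pr_sg, prL, mp_sg]
  exact LinearMap.congr_fun this c

lemma dbl (c : Ch V) : c + c = 0 := ZModModule.add_self c

lemma prism (f g : V → V) (c : Ch V) :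
    bd (pr f g c) + pr f g (bd c) = mp g c + mp f c := by
  have : bd ∘ₗ pr f g + pr f g ∘ₗ bd = mp g + mp f := by
    apply ch_ext; intro l
    simp only [LinearMap.comp_apply, LinearMap.add_apply, mp_sg, bd_sg, pr_sg]
    induction l with
    | nil => simp [bdL, prL, dbl]
    | cons v l ih =>
      have e1 : bd (sg (f v :: g v :: l.map g)) =
          sg (g v :: l.map g) + (sg (f v :: l.map g) + cone (f v) (cone (g v) (mp g (bdL l)))) := by
        rw [bd_sg, bdL, bdL, map_add, cone_sg, ← bd_sg, ← mp_sg, bd_mp, bd_sg]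
      simp only [prL, bdL, map_add, e1, bd_cone, pr_sg, pr_cone]
      have e2 : cone (f v) (bd (prL f g l)) + cone (f v) (pr f g (bdL l)) =
          sg (f v :: l.map g) + sg (f v :: l.map f) := by
        rw [← map_add, ih, map_add, cone_sg, cone_sg]
      have a1 := dbl (prL f g l)
      have a2 := dbl (cone (f v) (cone (g v) (mp g (bdL l))))
      have a3 := dbl (sg (f v :: l.map g))
      simp only [List.map_cons]
      generalize cone (f v) (cone (g v) (mp g (bdL l))) = A at *
      generalize prL f g l = B at *
      generalize cone (f v) (bd B) = C at *
      generalize cone (f v) (pr f g (bdL l)) = E at *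
      generalize sg (f v :: l.map g) = G at *
      calc _ = sg (g v :: List.map g l) + G + (A + A) + (B + B) + (C + E) := by abel
        _ = sg (g v :: List.map g l) + (G + G) + sg (f v :: l.map f) := by rw [a1, a2, e2]; abel
        _ = _ := by rw [a3]; abel
  exact LinearMap.congr_fun this c

lemma supp_le {M : Type*} [AddCommGroup M] [Module (ZMod 2) M] (T : Ch V →ₗ[ZMod 2] M)
    (A : Set (List V)) (N : Submodule (ZMod 2) M) (h : ∀ l ∈ A, T (sg l) ∈ N)
    (c : Ch V) (hc : c ∈ Finsupp.supported (ZMod 2) (ZMod 2) A) : T c ∈ N := by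
  rw [Finsupp.supported_eq_span_single] at hc
  have : Submodule.span (ZMod 2) ((fun i => (Finsupp.single i 1 : Ch V)) '' A) ≤ N.comap T := by
    rw [Submodule.span_le]
    rintro _ ⟨l, hl, rfl⟩
    exact h l hl
  exact this hc

lemma sg_mem {A : Set (List V)} {l : List V} (h : l ∈ A) :
    sg l ∈ Finsupp.supported (ZMod 2) (ZMod 2) A :=
  Finsupp.single_mem_supported _ _ h

variable [PseudoMetricSpace V]

/-- tuples in `E` of diameter `< ε` -/
def smL (E : Set V) (ε : ℝ) : Set (List V) := {l | (∀ v ∈ l, v ∈ E) ∧ ∀ v ∈ l, ∀ w ∈ l, dist v w < ε}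

noncomputable def Sm (E : Set V) (ε : ℝ) : Submodule (ZMod 2) (Ch V) :=
  Finsupp.supported (ZMod 2) (ZMod 2) (smL E ε)

lemma Sm_mono {E F : Set V} {ε η : ℝ} (h : E ⊆ F) (h' : ε ≤ η) : Sm E ε ≤ Sm F η :=
  Finsupp.supported_mono fun _ hl =>
    ⟨fun v hv => h (hl.1 v hv), fun v hv w hw => (hl.2 v hv w hw).trans_le h'⟩

lemma mp_Sm {E F : Set V} {ε : ℝ} {f : V → V} (hf : ∀ v ∈ E, f v ∈ F)
    (hd : ∀ v ∈ E, ∀ w ∈ E, dist (f v) (f w) ≤ dist v w) (c : Ch V) (hc : c ∈ Sm E ε) :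
    mp f c ∈ Sm F ε := by
  refine supp_le (mp f) _ _ ?_ c hc
  intro l hl
  rw [mp_sg]
  refine sg_mem ⟨?_, ?_⟩
  · intro v hv
    obtain ⟨w, hw, rfl⟩ := List.mem_map.1 hv
    exact hf w (hl.1 w hw)
  · intro v hv w hw
    obtain ⟨v', hv', rfl⟩ := List.mem_map.1 hv
    obtain ⟨w', hw', rfl⟩ := List.mem_map.1 hw
    exact (hd v' (hl.1 v' hv') w' (hl.1 w' hw')).trans_lt (hl.2 v' hv' w' hw')

lemma prL_mem {E : Set V} {ε η : ℝ} {f g : V → V} (hη : 0 ≤ η) (hf : ∀ v ∈ E, f v ∈ E)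
    (hg : ∀ v ∈ E, g v ∈ E)
    (hdf : ∀ v ∈ E, ∀ w ∈ E, dist (f v) (f w) ≤ dist v w)
    (hdg : ∀ v ∈ E, ∀ w ∈ E, dist (g v) (g w) ≤ dist v w)
    (hfg : ∀ v ∈ E, dist (f v) (g v) ≤ η) (l : List V) (hl : l ∈ smL E ε) :
    prL f g l ∈ Sm E (ε + η) := by
  have key : ∀ v ∈ l, ∀ w ∈ l, dist (f v) (f w) < ε + η ∧ dist (g v) (g w) < ε + η ∧
      dist (f v) (g w) < ε + η := by
    intro v hv w hw
    have h0 := hl.2 v hv w hw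
    have h1 := hdf v (hl.1 v hv) w (hl.1 w hw)
    have h2 := hdg v (hl.1 v hv) w (hl.1 w hw)
    have h3 := hfg w (hl.1 w hw)
    have h4 := dist_triangle (f v) (f w) (g w)
    refine ⟨by linarith, by linarith, by linarith⟩
  have main : ∀ m : List V, (∀ v ∈ m, v ∈ l) → prL f g m ∈ Finsupp.supported (ZMod 2) (ZMod 2)
      {k : List V | ∀ x ∈ k, ∃ v ∈ l, x = f v ∨ x = g v} := by
    intro m
    induction m with
    | nil => intro _; simp only [prL]; exact Submodule.zero_mem _
    | cons v m ih =>
      intro hm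
      simp only [prL]
      refine Submodule.add_mem _ (sg_mem ?_) ?_
      · intro x hx
        simp only [List.mem_cons, List.mem_map] at hx
        rcases hx with rfl | rfl | ⟨w, hw, rfl⟩
        · exact ⟨v, hm v (by simp), Or.inl rfl⟩
        · exact ⟨v, hm v (by simp), Or.inr rfl⟩
        · exact ⟨w, hm w (by simp [hw]), Or.inr rfl⟩
      · refine supp_le (cone (f v)) _ _ ?_ _ (ih fun w hw => hm w (by simp [hw]))
        intro k hk
        rw [cone_sg]
        refine sg_mem ?_
        intro x hx
        rcases List.mem_cons.1 hx with rfl | hx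
        · exact ⟨v, hm v (by simp), Or.inl rfl⟩
        · exact hk x hx
  refine Finsupp.supported_mono ?_ (main l fun _ h => h)
  intro k hk
  refine ⟨fun x hx => ?_, fun x hx y hy => ?_⟩
  · obtain ⟨v, hv, rfl | rfl⟩ := hk x hx
    exacts [hf v (hl.1 v hv), hg v (hl.1 v hv)]
  · obtain ⟨v, hv, rfl | rfl⟩ := hk x hx <;> obtain ⟨w, hw, rfl | rfl⟩ := hk y hy
    · exact (key v hv w hw).1
    · exact (key v hv w hw).2.2
    · rw [dist_comm]; exact (key w hw v hv).2.2
    · exact (key v hv w hw).2.1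

/-- Filling of small cycles along a contraction. -/
lemma fill {E : Set V} {ε η : ℝ} (hε : 0 < ε) (hη : 0 < η) {p : V} (hp : p ∈ E) (L : ℕ)
    (f : ℕ → V → V) (h0 : ∀ v ∈ E, f 0 v = v) (hL : ∀ v ∈ E, f L v = p)
    (hE : ∀ l ≤ L, ∀ v ∈ E, f l v ∈ E)
    (hd : ∀ l ≤ L, ∀ v ∈ E, ∀ w ∈ E, dist (f l v) (f l w) ≤ dist v w)
    (hs : ∀ l < L, ∀ v ∈ E, dist (f l v) (f (l + 1) v) ≤ η)
    (z : Ch V) (hz : z ∈ Sm E ε) (hbz : bd z = 0) : ∃ h ∈ Sm E (ε + η), bd h = z := by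
  have step : ∀ l ≤ L, ∃ h ∈ Sm E (ε + η), bd h = z + mp (f l) z := by
    intro l
    induction l with
    | zero =>
      intro _
      refine ⟨0, Submodule.zero_mem _, ?_⟩
      have : mp (f 0) z = z := by
        have : mp (f 0) z - z ∈ (⊥ : Submodule (ZMod 2) (Ch V)) := by
          refine supp_le (mp (f 0) - LinearMap.id) (smL E ε) ⊥ ?_ z hz
          intro l hl
          have : l.map (f 0) = l := by
            conv_rhs => rw [← List.map_id l]
            exact List.map_congr_left fun v hv => h0 v (hl.1 v hv)
          simp [mp_sg, this]
        exact sub_eq_zero.1 (by simpa using this)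
      rw [this, dbl, map_zero]
    | succ l ih =>
      intro hl
      obtain ⟨h, hh, hb⟩ := ih (by omega)
      refine ⟨h + pr (f l) (f (l + 1)) z, Submodule.add_mem _ hh ?_, ?_⟩
      · refine supp_le _ (smL E ε) _ ?_ z hz
        intro k hk
        rw [pr_sg]
        exact prL_mem hη.le (hE l (by omega)) (hE (l + 1) hl) (hd l (by omega)) (hd (l + 1) hl)
          (hs l (by omega)) k hk
      · have := prism (f l) (f (l + 1)) z
        rw [hbz, map_zero, add_zero] at this
        rw [map_add, hb, this]
        have a := dbl (mp (f l) z)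
        calc _ = z + mp (f (l + 1)) z + (mp (f l) z + mp (f l) z) := by abel
          _ = _ := by rw [a, add_zero]
  obtain ⟨h, hh, hb⟩ := step L le_rfl
  refine ⟨h + cone p (mp (f L) z), Submodule.add_mem _ hh ?_, ?_⟩
  · refine supp_le (cone p ∘ₗ mp (f L)) (smL E ε) _ ?_ z hz
    intro k hk
    simp only [LinearMap.comp_apply, mp_sg, cone_sg]
    have hall : ∀ x ∈ p :: k.map (f L), x = p := by
      intro x hx
      rcases List.mem_cons.1 hx with rfl | hx
      · rfl
      · obtain ⟨v, hv, rfl⟩ := List.mem_map.1 hx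
        exact hL v (hk.1 v hv)
    refine sg_mem ⟨fun x hx => by rw [hall x hx]; exact hp, fun x hx y hy => ?_⟩
    rw [hall x hx, hall y hy, dist_self]; linarith
  · rw [map_add, hb, bd_cone, bd_mp, hbz, map_zero, map_zero, add_zero, add_assoc, dbl, add_zero]

end Chains

/-! ### Cup product cochains -/
section Cochains
variable {V : Type*}

def W : List (V → ZMod 2) → List V → ZMod 2
  | [], [_] => 1
  | s :: ss, v :: w :: l => (s v + s w) * W ss (w :: l)
  | _, _ => 0

def X0 (s : V → ZMod 2) (ss : List (V → ZMod 2)) : List V → ZMod 2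
  | [] => 0
  | v :: l => s v * W ss (v :: l)

noncomputable def Wc (ss : List (V → ZMod 2)) : Ch V →ₗ[ZMod 2] ZMod 2 :=
  Finsupp.linearCombination (ZMod 2) (W ss)
noncomputable def Xc (s : V → ZMod 2) (ss : List (V → ZMod 2)) : Ch V →ₗ[ZMod 2] ZMod 2 :=
  Finsupp.linearCombination (ZMod 2) (X0 s ss)

lemma Wc_sg (ss : List (V → ZMod 2)) (l : List V) : Wc ss (sg l) = W ss l := by simp [Wc, sg]
lemma Xc_sg (s) (ss : List (V → ZMod 2)) (l : List V) : Xc s ss (sg l) = X0 s ss l := by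
  simp [Xc, sg]

lemma W_nil (ss : List (V → ZMod 2)) : W ss [] = 0 := by cases ss <;> rfl
lemma W_cons_single (s) (ss : List (V → ZMod 2)) (v : V) : W (s :: ss) [v] = 0 := rfl
lemma W_cons_cons (s) (ss : List (V → ZMod 2)) (v w : V) (l) :
    W (s :: ss) (v :: w :: l) = (s v + s w) * W ss (w :: l) := rfl
lemma W_nil_cons_cons (v w : V) (l) : W [] (v :: w :: l) = 0 := rfl

lemma W_cons2_c (s) (ss : List (V → ZMod 2)) (v w : V) (c : Ch V) :
    Wc (s :: ss) (cone v (cone w c)) = (s v + s w) * Wc ss (cone w c) := by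
  have : Wc (s :: ss) ∘ₗ cone v ∘ₗ cone w = (s v + s w) • (Wc ss ∘ₗ cone w) := by
    apply ch_ext; intro l
    simp [cone_sg, Wc_sg, W_cons_cons]
  exact LinearMap.congr_fun this c

lemma W_nil2_c (v w : V) (c : Ch V) : Wc [] (cone v (cone w c)) = 0 := by
  have : Wc [] ∘ₗ cone v ∘ₗ cone w = 0 := by
    apply ch_ext; intro l
    simp [cone_sg, Wc_sg, W_nil_cons_cons]
  exact LinearMap.congr_fun this c

lemma W_cocycle (ss : List (V → ZMod 2)) (l : List V) : Wc ss (bdL l) = 0 := by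
  induction ss generalizing l with
  | nil =>
    match l with
    | [] => simp [bdL]
    | [v] => simp [bdL, Wc_sg, W_nil]
    | [v, w] =>
      simp only [bdL, map_add, cone_sg, Wc_sg, map_zero, add_zero]
      exact CharTwo.add_self_eq_zero (1 : ZMod 2)
    | v :: w :: x :: l =>
      simp [bdL, cone_sg, Wc_sg, W_nil2_c, W_nil_cons_cons]
  | cons s ss ih =>
    match l with
    | [] => simp [bdL]
    | [v] => simp [bdL, Wc_sg, W_nil]
    | [v, w] => simp [bdL, cone_sg, Wc_sg, W_cons_single]
    | v :: w :: x :: l =>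
      have h := ih (w :: x :: l)
      rw [bdL, map_add, Wc_sg] at h
      rw [bdL, map_add, Wc_sg, bdL, map_add, map_add, cone_sg, Wc_sg, W_cons2_c, W_cons_cons,
        W_cons_cons]
      have h' : Wc ss (cone w (bdL (x :: l))) = W ss (x :: l) := by
        have h2 : Wc ss (cone w (bdL (x :: l))) = -W ss (x :: l) := by linear_combination h
        rw [h2, ZMod.neg_eq_self_mod_two]
      rw [h']
      have e := CharTwo.add_self_eq_zero (R := ZMod 2)
      linear_combination e (s w * W ss (x :: l)) + e (s x * W ss (x :: l)) + e (s v * W ss (x :: l))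

lemma X0_c (s) (ss : List (V → ZMod 2)) (v : V) (c : Ch V) :
    Xc s ss (cone v c) = s v * Wc ss (cone v c) := by
  have : Xc s ss ∘ₗ cone v = s v • (Wc ss ∘ₗ cone v) := by
    apply ch_ext; intro l
    simp [cone_sg, Wc_sg, Xc_sg, X0]
  exact LinearMap.congr_fun this c

lemma W_stokes (s) (ss : List (V → ZMod 2)) (c : Ch V) : Wc (s :: ss) c = Xc s ss (bd c) := by
  have : Wc (s :: ss) = Xc s ss ∘ₗ bd := by
    apply ch_ext; intro l
    simp only [LinearMap.comp_apply, Wc_sg, bd_sg]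
    match l with
    | [] => simp [bdL, W]
    | [v] => simp [bdL, Xc_sg, X0, W]
    | v :: w :: l =>
      have h := W_cocycle ss (v :: w :: l)
      rw [bdL, map_add, Wc_sg] at h
      rw [bdL, map_add, Xc_sg, X0_c, W_cons_cons, X0]
      have h2 : Wc ss (cone v (bdL (w :: l))) = W ss (w :: l) := by
        have h2 : Wc ss (cone v (bdL (w :: l))) = -W ss (w :: l) := by linear_combination h
        rw [h2, ZMod.neg_eq_self_mod_two]
      rw [h2]; ring
  exact LinearMap.congr_fun this c

lemma W_ne_zero (ss : List (V → ZMod 2)) (l : List V) (h : W ss l ≠ 0) :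
    l ≠ [] ∧ ∀ s ∈ ss, ∃ v ∈ l, ∃ w ∈ l, s v ≠ s w := by
  induction ss generalizing l with
  | nil => exact ⟨fun e => h (by rw [e, W_nil]), by simp⟩
  | cons s ss ih =>
    match l with
    | [] => exact absurd (W_nil _) h
    | [v] => exact absurd (W_cons_single _ _ _) h
    | v :: w :: l =>
      rw [W_cons_cons] at h
      refine ⟨by simp, ?_⟩
      intro t ht
      rcases List.mem_cons.1 ht with rfl | ht
      · refine ⟨v, by simp, w, by simp, fun e => left_ne_zero_of_mul h ?_⟩
        rw [e, CharTwo.add_self_eq_zero]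
      · obtain ⟨a, ha, b, hb, hab⟩ := (ih _ (right_ne_zero_of_mul h)).2 t ht
        exact ⟨a, List.mem_cons_of_mem _ ha, b, List.mem_cons_of_mem _ hb, hab⟩

/-- effect of a transformation `f` for which all labels are equivariant -/
lemma W_map (E : Set V) (f : V → V) (ss : List (V → ZMod 2))
    (h : ∀ s ∈ ss, ∃ a : ZMod 2, ∀ v ∈ E, s (f v) = s v + a) (l : List V) (hl : ∀ v ∈ l, v ∈ E) :
    W ss (l.map f) = W ss l := by
  induction ss generalizing l with
  | nil =>
    match l with
    | [] => rfl
    | [v] => rfl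
    | v :: w :: l => rfl
  | cons s ss ih =>
    match l with
    | [] => rfl
    | [v] => rfl
    | v :: w :: l =>
      obtain ⟨a, ha⟩ := h s (by simp)
      simp only [List.map_cons, W_cons_cons]
      have := ih (fun t ht => h t (by simp [ht])) (w :: l) (fun x hx => hl x (by simp [hx]))
      rw [List.map_cons] at this
      rw [this, ha v (hl v (by simp)), ha w (hl w (by simp))]
      linear_combination W ss (w :: l) * CharTwo.add_self_eq_zero a

lemma X_map (E : Set V) (f : V → V) (s) (ss : List (V → ZMod 2)) (a : ZMod 2)
    (hs : ∀ v ∈ E, s (f v) = s v + a)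
    (h : ∀ s ∈ ss, ∃ a : ZMod 2, ∀ v ∈ E, s (f v) = s v + a) (c : Ch V)
    (hc : c ∈ Finsupp.supported (ZMod 2) (ZMod 2) {l : List V | ∀ v ∈ l, v ∈ E}) :
    Xc s ss (c + mp f c) = a * Wc ss c := by
  have : (Xc s ss ∘ₗ (LinearMap.id + mp f) - a • Wc ss : Ch V →ₗ[ZMod 2] ZMod 2) c ∈ (⊥ : Submodule (ZMod 2) (ZMod 2)) := by
    refine supp_le _ _ _ ?_ c hc
    intro l hl
    simp only [LinearMap.sub_apply, LinearMap.comp_apply, LinearMap.add_apply, LinearMap.id_apply,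
      LinearMap.smul_apply, map_add, mp_sg, Xc_sg, Wc_sg, Submodule.mem_bot, smul_eq_mul]
    match l, hl with
    | [], _ => simp [X0, W_nil]
    | v :: l, hl =>
      have := W_map E f ss h (v :: l) hl
      simp only [List.map_cons, X0] at this ⊢
      rw [this, hs v (hl v (by simp))]
      linear_combination CharTwo.add_self_eq_zero (s v * W ss (v :: l))
  have := (Submodule.mem_bot _).1 this
  simpa [sub_eq_zero] using this

end Cochains

end MilnorTC

namespace MilnorTC

set_option linter.all false

section BorsukUlam

variable {J : Type} [Fintype J] [DecidableEq J] {N : ℕ}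

/-- ambient space of a product of spheres -/
abbrev VV (J : Type) (N : ℕ) := J → Fin (N + 1) → ℝ

def flip (j : J) (v : VV J N) : VV J N := Function.update v j (-(v j))

def Ek (k : J → ℕ) : Set (VV J N) :=
  {v | ∀ j, ∑ i, |v j i| = 1 ∧ (∀ i : Fin (N + 1), k j < i.val → v j i = 0) ∧
    ∀ i : Fin (N + 1), i.val = k j → 0 ≤ v j i}

def Sk (k : J → ℕ) : Set (VV J N) :=
  {v | ∀ j, ∑ i, |v j i| = 1 ∧ (∀ i : Fin (N + 1), k j < i.val → v j i = 0)}

def pk (k : J → ℕ) : VV J N := fun j i => if i.val = k j then 1 else 0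

lemma pk_mem (k : J → ℕ) (hk : ∀ j, k j ≤ N) : (pk k : VV J N) ∈ Ek k := by
  intro j
  refine ⟨?_, ?_, ?_⟩
  · rw [Finset.sum_eq_single (⟨k j, by have := hk j; omega⟩ : Fin (N + 1))]
    · simp [pk]
    · intro b _ hb
      have : b.val ≠ k j := fun h => hb (Fin.ext h)
      simp [pk, this]
    · simp
  · intro i hi
    simp [pk, hi.ne']
  · intro i hi
    simp [pk, hi]

lemma Ek_contr (k : J → ℕ) (hk : ∀ j, k j ≤ N) (v : VV J N) (hv : v ∈ Ek k) (t : ℝ) (h0 : 0 ≤ t)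
    (h1 : t ≤ 1) : (1 - t) • v + t • (pk k) ∈ Ek k := by
  have hp := pk_mem (N := N) k hk
  intro j
  obtain ⟨a1, a2, a3⟩ := hv j
  obtain ⟨b1, b2, b3⟩ := hp j
  refine ⟨?_, ?_, ?_⟩
  · have : ∀ i, |((1 - t) • v + t • (pk k : VV J N)) j i| = (1 - t) * |v j i| + t * |pk k j i| := by
      intro i
      simp only [Pi.add_apply, Pi.smul_apply, smul_eq_mul]
      by_cases hi : i.val = k j
      · have := a3 i hi
        have := b3 i hi
        rw [abs_of_nonneg (a3 i hi), abs_of_nonneg (b3 i hi), abs_of_nonneg]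
        have : 0 ≤ 1 - t := by linarith
        positivity
      · have : pk k j i = 0 := by simp [pk, hi]
        rw [this, abs_zero, mul_zero, add_zero, add_zero, abs_mul, abs_of_nonneg (by linarith : 0 ≤ 1 - t)]
    simp only [this]
    rw [Finset.sum_add_distrib, ← Finset.mul_sum, ← Finset.mul_sum, a1, b1]
    ring
  · intro i hi
    simp [a2 i hi, b2 i hi]
  · intro i hi
    have := a3 i hi
    have := b3 i hi
    simp only [Pi.add_apply, Pi.smul_apply, smul_eq_mul]
    have : 0 ≤ 1 - t := by linarith
    positivity

lemma Ek_sub_Sk (k : J → ℕ) : (Ek k : Set (VV J N)) ⊆ Sk k := fun _ hv j => ⟨(hv j).1, (hv j).2.1⟩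

lemma Sk_norm (k : J → ℕ) (v : VV J N) (hv : v ∈ Sk k) : ‖v‖ ≤ 1 := by
  rw [pi_norm_le_iff_of_nonneg zero_le_one]
  intro j
  rw [pi_norm_le_iff_of_nonneg zero_le_one]
  intro i
  rw [← (hv j).1, Real.norm_eq_abs]
  exact Finset.single_le_sum (f := fun i => |v j i|) (fun i _ => abs_nonneg _) (Finset.mem_univ i)

lemma Sk_compact (k : J → ℕ) : IsCompact (Sk k : Set (VV J N)) := by
  refine Metric.isCompact_of_isClosed_isBounded ?_ ?_
  · have : (Sk k : Set (VV J N)) = ⋂ j, ({v | ∑ i, |v j i| = 1} ∩ ⋂ i : Fin (N + 1),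
        ⋂ _ : k j < i.val, {v | v j i = 0}) := by
      ext v; simp [Sk]
    rw [this]
    refine isClosed_iInter fun j => IsClosed.inter ?_ (isClosed_iInter fun i => isClosed_iInter fun _ => ?_)
    · exact isClosed_eq (by fun_prop) continuous_const
    · exact isClosed_eq (by fun_prop) continuous_const
  · rw [isBounded_iff_forall_norm_le]
    exact ⟨1, fun v hv => Sk_norm k v hv⟩

lemma flip_flip (j : J) (v : VV J N) : flip j (flip j v) = v := by
  simp [flip]

lemma flip_comm (j j' : J) (v : VV J N) : flip j (flip j' v) = flip j' (flip j v) := by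
  by_cases h : j = j'
  · rw [h]
  · simp only [flip]
    rw [Function.update_comm (fun e => h e), Function.update_of_ne h, Function.update_of_ne (Ne.symm h)]

lemma flip_Sk (k : J → ℕ) (j : J) (v : VV J N) (hv : v ∈ Sk k) : flip j v ∈ Sk k := by
  intro j'
  by_cases h : j' = j
  · subst h
    simpa [flip] using hv j'
  · simpa [flip, h] using hv j'

lemma flip_dist (j : J) (v w : VV J N) : dist (flip j v) (flip j w) = dist v w := by
  have : ∀ v w : VV J N, dist (flip j v) (flip j w) ≤ dist v w := by
    intro v w
    rw [dist_pi_le_iff dist_nonneg]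
    intro j'
    by_cases h : j' = j
    · subst h
      simpa [flip] using dist_le_pi_dist v w j'
    · simpa [flip, h] using dist_le_pi_dist v w j'
  refine le_antisymm (this v w) ?_
  simpa [flip_flip] using this (flip j v) (flip j w)

def dec (k : J → ℕ) (j : J) : J → ℕ := Function.update k j (k j - 1)

lemma Ek_dec (k : J → ℕ) (j : J) (hj : 0 < k j) : (Ek (dec k j) : Set (VV J N)) ⊆ Ek k := by
  intro v hv j'
  obtain ⟨a, b, c⟩ := hv j'
  by_cases h : j' = j
  · subst h
    simp only [dec, Function.update_self] at b c
    exact ⟨a, fun i hi => b i (by omega), fun i hi => (b i (by omega)).ge⟩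
  · simp only [dec, ne_eq, h, not_false_eq_true, Function.update_of_ne] at b c
    exact ⟨a, b, c⟩

lemma flip_Ek_dec (k : J → ℕ) (j : J) (hj : 0 < k j) (v : VV J N) (hv : v ∈ Ek (dec k j)) :
    flip j v ∈ Ek k := by
  intro j'
  obtain ⟨a, b, c⟩ := hv j'
  by_cases h : j' = j
  · subst h
    simp only [dec, Function.update_self] at b c
    simp only [flip, Function.update_self, Pi.neg_apply, abs_neg]
    exact ⟨a, fun i hi => by simp [b i (by omega)], fun i hi => by simp [b i (by omega)]⟩
  · simp only [dec, ne_eq, h, not_false_eq_true, Function.update_of_ne] at b c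
    simp only [flip, ne_eq, h, not_false_eq_true, Function.update_of_ne]
    exact ⟨a, b, c⟩

lemma mp_mp (f g : VV J N → VV J N) (c : Ch (VV J N)) : mp f (mp g c) = mp (f ∘ g) c := by
  have : mp f ∘ₗ mp g = mp (f ∘ g) := by
    apply ch_ext; intro l
    simp [mp_sg]
  exact LinearMap.congr_fun this c

lemma mp_id (c : Ch (VV J N)) : mp id c = c := by
  have : mp id = (LinearMap.id : Ch (VV J N) →ₗ[ZMod 2] _) := by
    apply ch_ext; intro l
    simp [mp_sg]
  exact LinearMap.congr_fun this c

/-- the boundary formula -/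
noncomputable def bf (h : (J → ℕ) → Ch (VV J N)) (k : J → ℕ) : Ch (VV J N) :=
  ∑ j with 0 < k j, (h (dec k j) + mp (flip j) (h (dec k j)))

lemma sum_dec (k : J → ℕ) (j : J) (hj : 0 < k j) : ∑ i, dec k j i + 1 = ∑ i, k i := by
  rw [← Finset.add_sum_erase _ _ (Finset.mem_univ j), ← Finset.add_sum_erase _ _ (Finset.mem_univ j)]
  have : ∑ x ∈ Finset.univ.erase j, dec k j x = ∑ x ∈ Finset.univ.erase j, k x :=
    Finset.sum_congr rfl fun x hx => by simp [dec, Finset.ne_of_mem_erase hx]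
  rw [this]
  simp only [dec, Function.update_self]
  omega

lemma dec_le (k : J → ℕ) (j i : J) : dec k j i ≤ k i := by
  by_cases h : i = j
  · subst h; simp [dec]
  · simp [dec, h]

lemma dec_comm (k : J → ℕ) (i j : J) : dec (dec k i) j = dec (dec k j) i := by
  by_cases h : i = j
  · rw [h]
  · simp only [dec]
    rw [Function.update_comm h, Function.update_of_ne h, Function.update_of_ne (Ne.symm h)]

lemma bf_cycle (h : (J → ℕ) → Ch (VV J N)) (k : J → ℕ) (h0 : h 0 = sg [pk 0])
    (hb : ∀ j, 0 < k j → dec k j ≠ 0 → bd (h (dec k j)) = bf h (dec k j)) : bd (bf h k) = 0 := by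
  by_cases hk : ∃ j, 0 < k j ∧ dec k j = 0
  · obtain ⟨j, hj, hd⟩ := hk
    have : (Finset.univ.filter fun j => 0 < k j) = {j} := by
      ext i
      simp only [Finset.mem_filter, Finset.mem_univ, true_and, Finset.mem_singleton]
      constructor
      · intro hi
        by_contra hne
        have := congrFun hd i
        simp [dec, hne] at this
        omega
      · rintro rfl; exact hj
    rw [bf, this, Finset.sum_singleton, hd, h0, map_add, bd_mp, bd_sg]
    simp only [bdL, map_add, map_zero, mp_sg, add_zero, List.map_nil]
    exact dbl _
  · push Not at hk
    have : bd (bf h k) = ∑ p ∈ (Finset.univ.filter fun j => 0 < k j).sigma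
        (fun j => Finset.univ.filter fun i => 0 < dec k j i),
        ((h (dec (dec k p.1) p.2) + mp (flip p.2) (h (dec (dec k p.1) p.2))) +
          mp (flip p.1) (h (dec (dec k p.1) p.2) + mp (flip p.2) (h (dec (dec k p.1) p.2)))) := by
      rw [Finset.sum_sigma, bf, map_sum]
      refine Finset.sum_congr rfl fun j hj => ?_
      have hj := (Finset.mem_filter.1 hj).2
      rw [map_add, bd_mp, hb j hj (hk j hj), bf, map_sum, ← Finset.sum_add_distrib]
    rw [this]
    refine Finset.sum_involution (fun p _ => ⟨p.2, p.1⟩) ?_ ?_ ?_ ?_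
    · intro p hp
      rw [dec_comm k p.2 p.1]
      set c := h (dec (dec k p.1) p.2)
      simp only [map_add, mp_mp]
      have : flip p.2 ∘ flip p.1 = (flip p.1 ∘ flip p.2 : VV J N → _) := by
        funext v; exact flip_comm _ _ _
      rw [this]
      have e : ∀ a b c d : Ch (VV J N), a + b + (c + d) + (a + c + (b + d)) = (a+a)+(b+b)+(c+c)+(d+d) := by
        intros; abel
      rw [e]; simp [dbl]
    · rintro ⟨i, j⟩ hp hne heq
      have e : i = j := by
        have := congrArg Sigma.fst heq
        exact this.symm
      subst e
      apply hne
      simp only [map_add, mp_mp]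
      have : flip i ∘ flip i = (id : VV J N → _) := by
        funext v; exact flip_flip _ _
      rw [this, mp_id]
      have e : ∀ a b : Ch (VV J N), a + b + (b + a) = (a+a)+(b+b) := by
        intros; abel
      rw [e]; simp [dbl]
    · rintro ⟨i, j⟩ hp
      simp only [Finset.mem_sigma, Finset.mem_filter, Finset.mem_univ, true_and] at hp ⊢
      by_cases h : i = j
      · subst h; exact hp
      · simp only [dec] at hp ⊢
        rw [Function.update_of_ne (Ne.symm h)] at hp
        rw [Function.update_of_ne h]
        exact ⟨hp.2, hp.1⟩
    · intro p hp; rfl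

lemma Sm_fill (k : J → ℕ) (hk : ∀ j, k j ≤ N) (ε : ℝ) (hε : 0 < ε) (z : Ch (VV J N))
    (hz : z ∈ Sm (Ek k) ε) (hbz : bd z = 0) : ∃ h ∈ Sm (Ek k) (ε + ε), bd h = z := by
  obtain ⟨L, hL⟩ := exists_nat_gt (2 / ε)
  have hLpos : (0 : ℝ) < L := lt_trans (by positivity) hL
  refine fill hε hε (pk_mem k hk) L (fun l v => (1 - l / L : ℝ) • v + (l / L : ℝ) • pk k) ?_ ?_ ?_ ?_ ?_ z hz hbz
  · intro v _; simp
  · intro v _; simp [hLpos.ne']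
  · intro l hl v hv
    exact Ek_contr k hk v hv _ (by positivity) (div_le_one_of_le₀ (by exact_mod_cast hl) hLpos.le)
  · intro l hl v _ w _
    have h1 : (l / L : ℝ) ≤ 1 := div_le_one_of_le₀ (by exact_mod_cast hl) hLpos.le
    have h0 : 0 ≤ (l / L : ℝ) := by positivity
    rw [dist_add_right, dist_smul₀, Real.norm_eq_abs, abs_of_nonneg (by linarith)]
    nlinarith [dist_nonneg (x := v) (y := w)]
  · intro l hl v hv
    rw [dist_eq_norm]
    have : (1 - l / L : ℝ) • v + (l / L : ℝ) • pk k - ((1 - ((l + 1 : ℕ) : ℝ) / L : ℝ) • v +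
        (((l + 1 : ℕ) : ℝ) / L : ℝ) • pk k) = (1 / L : ℝ) • (v - pk k) := by
      funext j i
      simp only [Pi.sub_apply, Pi.add_apply, Pi.smul_apply, smul_eq_mul]
      push_cast; field_simp; ring
    rw [this, norm_smul, Real.norm_eq_abs, abs_of_nonneg (by positivity)]
    have h2 : ‖v - pk k‖ ≤ 2 := by
      have := norm_sub_le v (pk k)
      have := Sk_norm k v (Ek_sub_Sk k hv)
      have := Sk_norm k (pk k) (Ek_sub_Sk k (pk_mem (N := N) k hk))
      linarith
    rw [div_lt_iff₀ hε] at hL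
    rw [div_mul_eq_mul_div, one_mul, div_le_iff₀ hLpos]
    linarith

lemma exists_h (m : ℕ) : ∀ ε > 0, ∃ h : (J → ℕ) → Ch (VV J N), h 0 = sg [pk 0] ∧
    ∀ k : J → ℕ, (∀ j, k j ≤ N) → ∑ j, k j ≤ m → h k ∈ Sm (Ek k) ε ∧ (k ≠ 0 → bd (h k) = bf h k) := by
  induction m with
  | zero =>
    intro ε hε
    refine ⟨fun _ => sg [pk 0], rfl, ?_⟩
    intro k _ hk
    have : k = 0 := by
      funext j
      have := Finset.single_le_sum (f := k) (fun i _ => Nat.zero_le _) (Finset.mem_univ j)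
      simp only [Pi.zero_apply]; omega
    subst this
    refine ⟨sg_mem ⟨?_, ?_⟩, fun h => absurd rfl h⟩
    · intro v hv
      rw [List.mem_singleton.1 hv]
      exact pk_mem 0 (by simp)
    · intro v hv w hw
      rw [List.mem_singleton.1 hv, List.mem_singleton.1 hw, dist_self]
      exact hε
  | succ m ih =>
    intro ε hε
    obtain ⟨h, h0, hh⟩ := ih (ε / 2) (by positivity)
    have ex : ∀ k : J → ℕ, ∃ c, (∀ j, k j ≤ N) → ∑ j, k j = m + 1 → c ∈ Sm (Ek k) (ε / 2 + ε / 2) ∧ bd c = bf h k := by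
      intro k
      by_cases hk : (∀ j, k j ≤ N) ∧ ∑ j, k j = m + 1
      · obtain ⟨c, hc, hbc⟩ := Sm_fill k hk.1 (ε / 2) (by positivity) (bf h k) (by
          refine Submodule.sum_mem _ fun j hj => ?_
          have hj := (Finset.mem_filter.1 hj).2
          have hd := (hh (dec k j) (fun i => (dec_le k j i).trans (hk.1 i)) (by
            have := sum_dec k j hj; omega)).1
          refine Submodule.add_mem _ (Sm_mono (Ek_dec k j hj) le_rfl hd) ?_
          exact mp_Sm (fun v hv => flip_Ek_dec k j hj v hv) (fun v _ w _ => (flip_dist j v w).le) _ hd)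
          (by
            refine bf_cycle h k h0 ?_
            intro j hj hne
            exact (hh (dec k j) (fun i => (dec_le k j i).trans (hk.1 i)) (by
              have := sum_dec k j hj; omega)).2 hne)
        exact ⟨c, fun _ _ => ⟨hc, hbc⟩⟩
      · exact ⟨0, fun a b => absurd ⟨a, b⟩ hk⟩
    choose c hc using ex
    have hbf : ∀ k : J → ℕ, ∑ j, k j ≤ m + 1 → bf (fun k => if ∑ j, k j = m + 1 then c k else h k) k = bf h k := by
      intro k hk
      refine Finset.sum_congr rfl fun j hj => ?_
      have hj := (Finset.mem_filter.1 hj).2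
      have := sum_dec k j hj
      have : ¬ (∑ i, dec k j i = m + 1) := by omega
      simp only [this, if_false]
    refine ⟨fun k => if ∑ j, k j = m + 1 then c k else h k, by simpa using h0, ?_⟩
    intro k hkN hk
    rw [hbf k hk]
    by_cases e : ∑ j, k j = m + 1
    · simp only [e, if_true]
      have := hc k hkN e
      rw [add_halves] at this
      exact ⟨this.1, fun _ => this.2⟩
    · simp only [e, if_false]
      have := hh k hkN (by omega)
      exact ⟨Sm_mono le_rfl (by linarith) this.1, this.2⟩

/-- admissible sequence of characters -/
inductive Adm : List (J → ZMod 2) → (J → ℕ) → Prop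
  | nil : Adm [] 0
  | cons (χ : J → ZMod 2) (χs : List (J → ZMod 2)) (k : J → ℕ) (j : J) : χ j = 1 → 0 < k j →
      (∀ j', j' ≠ j → 0 < k j' → χ j' = 0) → Adm χs (dec k j) → Adm (χ :: χs) k

lemma Adm_Wc (K : J → ℕ) (ε : ℝ) (h : (J → ℕ) → Ch (VV J N))
    (h0 : h 0 = sg [pk 0])
    (hh : ∀ k ≤ K, h k ∈ Sm (Ek k) ε ∧ (k ≠ 0 → bd (h k) = bf h k))
    (χs : List (J → ZMod 2)) (k : J → ℕ) (hA : Adm χs k) : k ≤ K → ∀ (ss : List (VV J N → ZMod 2)),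
    List.Forall₂ (fun χ s => ∀ j, ∀ v ∈ Sk K, s (flip j v) = s v + χ j) χs ss →
    Wc ss (h k) = 1 := by
  induction hA with
  | nil =>
    intro _ ss hs
    cases hs
    rw [h0, Wc_sg]; rfl
  | cons χ χs k j hj hkj hz hA ih =>
    intro hk ss hs
    cases hs with
    | @cons _ s _ ss hs hss =>
    have hk0 : k ≠ 0 := fun e => by simp [e] at hkj
    rw [W_stokes, (hh k hk).2 hk0, bf, map_sum]
    have hdk : ∀ j, dec k j ≤ K := fun j i => (dec_le k j i).trans (hk i)
    have : ∀ j' ∈ Finset.univ.filter (fun j => 0 < k j), Xc s ss (h (dec k j') + mp (flip j') (h (dec k j'))) =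
        χ j' * Wc ss (h (dec k j')) := by
      intro j' hj'
      refine X_map (Sk K) (flip j') s ss (χ j') (hs j') ?_ _ ?_
      · intro s hs
        obtain ⟨i, hi, rfl⟩ := List.mem_iff_getElem.1 hs
        have hl := hss.length_eq
        exact ⟨χs[i] j', fun v hv => (List.forall₂_iff_get.1 hss).2 i (by omega) hi j' v hv⟩
      · refine Finsupp.supported_mono ?_ (hh _ (hdk j')).1
        intro l hl v hv i
        have := hl.1 v hv i
        exact ⟨this.1, fun i' hi' => this.2.1 i' (lt_of_le_of_lt (hdk j' i) hi')⟩
    rw [Finset.sum_congr rfl this, Finset.sum_eq_single_of_mem j (by simp [hkj]), hj, one_mul, ih (hdk j) ss hss]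
    intro j' hj' hne
    rw [hz j' hne (Finset.mem_filter.1 hj').2, zero_mul]

/-- lexicographic sign -/
noncomputable def lsg (w : Fin (N + 1) → ℝ) : ZMod 2 :=
  open Classical in if ∃ i, 0 < w i ∧ ∀ i' < i, w i' = 0 then 1 else 0

lemma lsg_neg (w : Fin (N + 1) → ℝ) (hw : w ≠ 0) : lsg (-w) = lsg w + 1 := by
  classical
  have : ∃ i, w i ≠ 0 := by
    by_contra h; push Not at h; exact hw (funext h)
  obtain ⟨i, hi, hmin⟩ : ∃ i, w i ≠ 0 ∧ ∀ i' < i, w i' = 0 := by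
    have hne : (Finset.univ.filter fun i => w i ≠ 0).Nonempty := by
      obtain ⟨i, hi⟩ := this
      exact ⟨i, by simp [hi]⟩
    refine ⟨(Finset.univ.filter fun i => w i ≠ 0).min' hne, ?_, ?_⟩
    · have := Finset.min'_mem _ hne
      exact (Finset.mem_filter.1 this).2
    · intro i' hi'
      by_contra h
      have := Finset.min'_le (Finset.univ.filter fun i => w i ≠ 0) i' (by simp [h])
      exact absurd hi' (not_lt.2 this)
  have key : ∀ u : Fin (N + 1) → ℝ, u i ≠ 0 → (∀ i' < i, u i' = 0) →
      ((∃ i, 0 < u i ∧ ∀ i' < i, u i' = 0) ↔ 0 < u i) := by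
    intro u hu hu'
    constructor
    · rintro ⟨l, hl, hl'⟩
      rcases lt_trichotomy l i with h | h | h
      · rw [hu' l h] at hl; exact absurd hl (lt_irrefl _)
      · rwa [← h]
      · exact absurd (hl' i h) hu
    · intro h; exact ⟨i, h, hu'⟩
  unfold lsg
  simp only [key w hi hmin, key (-w) (by simpa using hi) (by simpa using hmin)]
  rcases lt_or_gt_of_ne hi with h | h
  · have h1 : 0 < (-w) i := by simpa using h
    have h2 : ¬ 0 < w i := by linarith
    rw [if_pos h1, if_neg h2]; rfl
  · have h1 : ¬ 0 < (-w) i := by simpa using h.le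
    rw [if_neg h1, if_pos h]; rfl

noncomputable def lab (χ : J → ZMod 2) (g : VV J N → ℝ) (v : VV J N) : ZMod 2 :=
  open Classical in if 0 < g v then 0 else if g v < 0 then 1 else ∑ j, χ j * lsg (v j)

def pm (a : ZMod 2) : ℝ := if a = 0 then 1 else -1

lemma lab_flip (K : J → ℕ) (χ : J → ZMod 2) (g : VV J N → ℝ) 
    (hg : ∀ j, ∀ v ∈ Sk K, g (flip j v) = pm (χ j) * g v) (j : J) (v : VV J N) (hv : v ∈ Sk K) :
    lab χ g (flip j v) = lab χ g v + χ j := by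
  have hsum : ∑ i, χ i * lsg (flip j v i) = ∑ i, χ i * lsg (v i) + χ j := by
    rw [← Finset.add_sum_erase _ _ (Finset.mem_univ j), ← Finset.add_sum_erase _ _ (Finset.mem_univ j)]
    have : ∑ x ∈ Finset.univ.erase j, χ x * lsg (flip j v x) = ∑ x ∈ Finset.univ.erase j, χ x * lsg (v x) :=
      Finset.sum_congr rfl fun x hx => by simp [flip, Finset.ne_of_mem_erase hx]
    rw [this]
    have hne : v j ≠ 0 := by
      intro e
      have := (hv j).1
      simp [e] at this
    have : flip j v j = -(v j) := by simp [flip]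
    rw [this, lsg_neg _ hne]
    ring
  unfold lab
  rw [hsum, hg j v hv]
  have hz : ∀ a : ZMod 2, a = 0 ∨ a = 1 := by decide
  rcases hz (χ j) with e | e
  · simp [e, pm]
  · rw [e]
    have : pm 1 = -1 := by simp [pm]
    rw [this]
    rcases lt_trichotomy (g v) 0 with h | h | h
    · simp [h, h.le, not_lt.2 h.le]; rfl
    · simp [h]
    · simp [h, not_lt.2 h.le]

theorem borsuk_ulam (K : J → ℕ) (hK : ∀ j, K j ≤ N) (gs : List ((J → ZMod 2) × (VV J N → ℝ)))
    (hA : Adm (gs.map Prod.fst) K) (hc : ∀ g ∈ gs, ContinuousOn g.2 (Sk K))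
    (hg : ∀ g ∈ gs, ∀ j, ∀ v ∈ Sk K, g.2 (flip j v) = pm (g.1 j) * g.2 v) :
    ∃ v ∈ Sk K, ∀ g ∈ gs, g.2 v = 0 := by
  have step : ∀ n : ℕ, ∃ l : List (VV J N), l ∈ smL (Sk K) (1 / (n + 1) : ℝ) ∧ l ≠ [] ∧
      ∀ g ∈ gs, ∃ v ∈ l, ∃ w ∈ l, lab g.1 g.2 v ≠ lab g.1 g.2 w := by
    intro n
    obtain ⟨h, h0, hh⟩ := exists_h (J := J) (N := N) (∑ j, K j) (1 / (n + 1) : ℝ) (by positivity)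
    have hh' : ∀ k ≤ K, h k ∈ Sm (Ek k) (1 / (n + 1) : ℝ) ∧ (k ≠ 0 → bd (h k) = bf h k) :=
      fun k hk => hh k (fun j => (hk j).trans (hK j)) (Finset.sum_le_sum fun j _ => hk j)
    have := Adm_Wc K _ h h0 hh' _ K hA le_rfl (gs.map fun g => lab g.1 g.2) (by
      rw [List.forall₂_map_left_iff, List.forall₂_map_right_iff, List.forall₂_same]
      intro g hgm j v hv
      exact lab_flip K g.1 g.2 (hg g hgm) j v hv)
    by_contra hcon
    push Not at hcon
    have hz : Wc (gs.map fun g => lab g.1 g.2) (h K) ∈ (⊥ : Submodule (ZMod 2) (ZMod 2)) := by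
      refine supp_le _ _ _ ?_ _ (hh' K le_rfl).1
      intro l hl
      rw [Submodule.mem_bot, Wc_sg]
      by_contra hne
      have := W_ne_zero _ _ hne
      obtain ⟨g, hgm, hgl⟩ := hcon l ⟨fun v hv => Ek_sub_Sk K (hl.1 v hv), hl.2⟩ this.1
      obtain ⟨v, hv, w, hw, hvw⟩ := this.2 _ (List.mem_map_of_mem (f := fun g => lab g.1 g.2) hgm)
      exact hvw (hgl v hv w hw)
    rw [this, Submodule.mem_bot] at hz
    exact one_ne_zero hz
  choose l hl hne hlab using step
  choose v hv using fun n => List.exists_mem_of_ne_nil _ (hne n)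
  obtain ⟨a, ha, φ, hφ, hlim⟩ := (Sk_compact K).tendsto_subseq (fun n => (hl n).1 (v n) (hv n))
  refine ⟨a, ha, ?_⟩
  intro g hgm
  choose x hx y hy hxy using fun n => hlab n g hgm
  have conv : ∀ x : ℕ → VV J N, (∀ n, x n ∈ l n) → Filter.Tendsto (fun n => g.2 (x (φ n))) Filter.atTop (nhds (g.2 a)) := by
    intro x hx
    have h1 : Filter.Tendsto (fun n => x (φ n)) Filter.atTop (nhds a) := by
      refine hlim.congr_dist ?_
      refine squeeze_zero (fun _ => dist_nonneg) (fun n => ((hl (φ n)).2 _ (hv _) _ (hx _)).le) ?_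
      exact (tendsto_one_div_add_atTop_nhds_zero_nat (𝕜 := ℝ)).comp hφ.tendsto_atTop
    exact (hc g hgm a ha).tendsto.comp (tendsto_nhdsWithin_iff.2 ⟨h1, Filter.Eventually.of_forall fun n => (hl _).1 _ (hx _)⟩)
  have hprod := (conv x hx).mul (conv y hy)
  have : g.2 a * g.2 a ≤ 0 := by
    refine le_of_tendsto hprod (Filter.Eventually.of_forall fun n => ?_)
    by_contra hpos
    push Not at hpos
    apply hxy (φ n)
    rcases pos_and_pos_or_neg_and_neg_of_mul_pos hpos with ⟨h1, h2⟩ | ⟨h1, h2⟩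
    · simp [lab, h1, h2]
    · simp [lab, h1, h2, not_lt.2 h1.le, not_lt.2 h2.le]
  nlinarith [mul_self_nonneg (g.2 a)]

end BorsukUlam

end MilnorTC

namespace MilnorTC

set_option linter.all false

open Topology Filter

section Proj

variable {𝕜 : Type} [RCLike 𝕜] {m : ℕ}

abbrev PP (𝕜 : Type) [RCLike 𝕜] (m : ℕ) := Projectivization 𝕜 (Fin (m + 1) → 𝕜)

open Classical in
noncomputable def pj (v : Fin (m + 1) → 𝕜) : PP 𝕜 m :=
  if h : v ≠ 0 then Projectivization.mk 𝕜 v h else Projectivization.mk 𝕜 (fun _ => 1) (fun e => one_ne_zero (congrFun e 0))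

lemma pj_of_ne (v : Fin (m + 1) → 𝕜) (h : v ≠ 0) : pj v = Projectivization.mk 𝕜 v h := by
  simp [pj, h]

lemma pj_rep (p : PP 𝕜 m) : pj p.rep = p := by
  rw [pj_of_ne _ p.rep_nonzero, Projectivization.mk_rep]

lemma pj_eq_iff (v w : Fin (m + 1) → 𝕜) (hv : v ≠ 0) (hw : w ≠ 0) :
    pj v = pj w ↔ ∃ c : 𝕜, c • w = v := by
  rw [pj_of_ne _ hv, pj_of_ne _ hw, Projectivization.mk_eq_mk_iff']

lemma pj_smul (c : 𝕜) (hc : c ≠ 0) (v : Fin (m + 1) → 𝕜) : pj (c • v) = pj v := by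
  by_cases hv : v = 0
  · simp [hv]
  · exact (pj_eq_iff _ _ (smul_ne_zero hc hv) hv).2 ⟨c, rfl⟩

lemma rep_pj (v : Fin (m + 1) → 𝕜) (hv : v ≠ 0) : ∃ c : 𝕜, c ≠ 0 ∧ (pj v).rep = c • v := by
  have := (pj_eq_iff (pj v).rep v (Projectivization.rep_nonzero _) hv).1 (pj_rep _)
  obtain ⟨c, hc⟩ := this
  refine ⟨c, ?_, hc.symm⟩
  rintro rfl
  exact Projectivization.rep_nonzero (pj v) (by rw [← hc, zero_smul])

lemma continuous_mk : Continuous (fun v : {v : Fin (m + 1) → 𝕜 // v ≠ 0} => Projectivization.mk 𝕜 v.1 v.2) :=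
  continuous_quotient_mk'

lemma quot_mk : IsQuotientMap (fun v : {v : Fin (m + 1) → 𝕜 // v ≠ 0} => Projectivization.mk 𝕜 v.1 v.2) :=
  isQuotientMap_quotient_mk'

lemma continuousOn_pj : ContinuousOn (pj : (Fin (m + 1) → 𝕜) → PP 𝕜 m) {v | v ≠ 0} := by
  rw [continuousOn_iff_continuous_restrict]
  have : Set.domRestrict {v : Fin (m + 1) → 𝕜 | v ≠ 0} pj =
      (fun v : {v : Fin (m + 1) → 𝕜 // v ≠ 0} => Projectivization.mk 𝕜 v.1 v.2) := by
    funext v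
    exact pj_of_ne v.1 v.2
  rw [this]
  exact continuous_mk

lemma continuousAt_pj (v : Fin (m + 1) → 𝕜) (hv : v ≠ 0) : ContinuousAt pj v :=
  continuousOn_pj.continuousAt (isOpen_ne.mem_nhds hv)

lemma isOpen_rep (i : Fin (m + 1)) : IsOpen {p : PP 𝕜 m | p.rep i ≠ 0} := by
  rw [← quot_mk.isOpen_preimage]
  have : (fun v : {v : Fin (m + 1) → 𝕜 // v ≠ 0} => Projectivization.mk 𝕜 v.1 v.2) ⁻¹' {p : PP 𝕜 m | p.rep i ≠ 0}
      = {v | v.1 i ≠ 0} := by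
    ext v
    simp only [Set.mem_preimage, Set.mem_setOf_eq]
    rw [← pj_of_ne]
    obtain ⟨c, hc, e⟩ := rep_pj v.1 v.2
    rw [e]; simp [hc]
  rw [this]
  exact isOpen_ne_fun ((continuous_apply i).comp continuous_subtype_val) continuous_const

lemma continuousOn_nrm (i : Fin (m + 1)) :
    ContinuousOn (fun p : PP 𝕜 m => (p.rep i)⁻¹ • p.rep) {p : PP 𝕜 m | p.rep i ≠ 0} := by
  rw [quot_mk.continuousOn_isOpen_iff (isOpen_rep i)]
  have key : ∀ v : {v : Fin (m + 1) → 𝕜 // v ≠ 0}, ∃ c : 𝕜, c ≠ 0 ∧ (Projectivization.mk 𝕜 v.1 v.2).rep = c • v.1 := by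
    intro v
    obtain ⟨c, hc, e⟩ := rep_pj v.1 v.2
    exact ⟨c, hc, by rw [← e, pj_of_ne]⟩
  have : ((fun p : PP 𝕜 m => (p.rep i)⁻¹ • p.rep) ∘ fun v : {v : Fin (m + 1) → 𝕜 // v ≠ 0} => Projectivization.mk 𝕜 v.1 v.2)
      = fun v => (v.1 i)⁻¹ • v.1 := by
    funext v
    obtain ⟨c, hc, e⟩ := key v
    simp only [Function.comp_apply]
    rw [e, smul_smul]
    congr 1
    simp only [Pi.smul_apply, smul_eq_mul]
    field_simp
  rw [this]
  intro v hv
  have hv' : v.1 i ≠ 0 := by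
    obtain ⟨c, hc, e⟩ := key v
    simp only [Set.mem_preimage, Set.mem_setOf_eq] at hv
    rw [e] at hv
    intro h; apply hv; simp [h]
  refine ContinuousAt.continuousWithinAt ?_
  have h1 : ContinuousAt (fun v : {v : Fin (m + 1) → 𝕜 // v ≠ 0} => v.1 i) v :=
    ((continuous_apply i).comp continuous_subtype_val).continuousAt
  exact ContinuousAt.smul (ContinuousAt.inv₀ h1 hv') continuous_subtype_val.continuousAt

lemma rep_lift (p0 : PP 𝕜 m) : ∃ L : PP 𝕜 m → (Fin (m + 1) → 𝕜), ContinuousAt L p0 ∧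
    (∀ᶠ p in 𝓝 p0, ∃ c : 𝕜, c ≠ 0 ∧ L p = c • p.rep) := by
  obtain ⟨i, hi⟩ : ∃ i, p0.rep i ≠ 0 := by
    by_contra h; push Not at h
    exact p0.rep_nonzero (funext h)
  refine ⟨fun p => (p.rep i)⁻¹ • p.rep, (continuousOn_nrm i).continuousAt ((isOpen_rep i).mem_nhds hi), ?_⟩
  filter_upwards [(isOpen_rep i).mem_nhds hi] with p hp
  exact ⟨_, inv_ne_zero hp, rfl⟩

lemma continuousAt_rep {T : Type*} [TopologicalSpace T] (F : (Fin (m + 1) → 𝕜) → T)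
    (hF : ∀ c : 𝕜, c ≠ 0 → ∀ v, F (c • v) = F v) (hc : ∀ v, v ≠ 0 → ContinuousAt F v) :
    Continuous (fun p : PP 𝕜 m => F p.rep) := by
  rw [continuous_iff_continuousAt]
  intro p0
  obtain ⟨L, hL, hL'⟩ := rep_lift p0
  have h0 := hL'.self_of_nhds
  obtain ⟨c, hc0, e0⟩ := h0
  have : ContinuousAt (fun p => F (L p)) p0 := by
    refine ContinuousAt.comp (f := L) (g := F) (hc _ ?_) hL
    rw [e0]; exact smul_ne_zero hc0 p0.rep_nonzero
  refine this.congr ?_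
  filter_upwards [hL'] with p hp
  obtain ⟨c, hc, e⟩ := hp
  rw [e, hF c hc]

/-- the projector -/
noncomputable def prj (v : Fin (m + 1) → 𝕜) (i j : Fin (m + 1)) : 𝕜 :=
  v i * (starRingEnd 𝕜) (v j) / (∑ l, v l * (starRingEnd 𝕜) (v l))

lemma nsq_eq (v : Fin (m + 1) → 𝕜) : (∑ l, v l * (starRingEnd 𝕜) (v l)) = ((∑ l, ‖v l‖ ^ 2 : ℝ) : 𝕜) := by
  push_cast
  exact Finset.sum_congr rfl fun l _ => RCLike.mul_conj _

lemma nsq_pos (v : Fin (m + 1) → 𝕜) (hv : v ≠ 0) : 0 < ∑ l, ‖v l‖ ^ 2 := by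
  obtain ⟨i, hi⟩ : ∃ i, v i ≠ 0 := by
    by_contra h; push Not at h
    exact hv (funext h)
  refine Finset.sum_pos' (fun _ _ => by positivity) ⟨i, Finset.mem_univ _, by positivity⟩

lemma nsq_ne (v : Fin (m + 1) → 𝕜) (hv : v ≠ 0) : (∑ l, v l * (starRingEnd 𝕜) (v l)) ≠ 0 := by
  rw [nsq_eq]
  exact_mod_cast (nsq_pos v hv).ne'

lemma prj_smul (c : 𝕜) (hc : c ≠ 0) (v : Fin (m + 1) → 𝕜) : prj (c • v) = prj v := by
  funext i j
  simp only [prj, Pi.smul_apply, smul_eq_mul, map_mul]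
  have h1 : (starRingEnd 𝕜) c ≠ 0 := by simpa using hc
  have : ∀ l, c * v l * ((starRingEnd 𝕜) c * (starRingEnd 𝕜) (v l)) = (c * (starRingEnd 𝕜) c) * (v l * (starRingEnd 𝕜) (v l)) := by
    intro l; ring
  simp only [this]
  rw [← Finset.mul_sum, ← mul_div_mul_left (v i * _) _ (mul_ne_zero hc h1)]
  congr 1
  ring

lemma prj_cont (v : Fin (m + 1) → 𝕜) (hv : v ≠ 0) : ContinuousAt (prj : (Fin (m + 1) → 𝕜) → _) v := by
  rw [continuousAt_pi]
  intro i
  rw [continuousAt_pi]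
  intro j
  refine ContinuousAt.div ?_ ?_ (nsq_ne v hv)
  · exact (Continuous.mul (by fun_prop) (RCLike.continuous_conj.comp (by fun_prop))).continuousAt
  · refine Continuous.continuousAt (continuous_finsetSum _ fun i _ => ?_)
    exact (Continuous.mul (by fun_prop) (RCLike.continuous_conj.comp (by fun_prop)))

noncomputable def prP (p : PP 𝕜 m) : Fin (m + 1) → Fin (m + 1) → 𝕜 := prj p.rep

lemma prP_cont : Continuous (prP : PP 𝕜 m → _) := continuousAt_rep prj prj_smul prj_cont

/-- `P w = ⟨v,w⟩/|v|² v` -/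
lemma prj_apply (v w : Fin (m + 1) → 𝕜) (i) : ∑ j, prj v i j * w j =
    ((∑ j, (starRingEnd 𝕜) (v j) * w j) / (∑ l, v l * (starRingEnd 𝕜) (v l))) * v i := by
  rw [Finset.sum_div, Finset.sum_mul]
  refine Finset.sum_congr rfl fun j _ => ?_
  simp only [prj]; ring

lemma prj_self (v : Fin (m + 1) → 𝕜) (hv : v ≠ 0) (i) : ∑ j, prj v i j * v j = v i := by
  rw [prj_apply]
  have : (∑ j, (starRingEnd 𝕜) (v j) * v j) = (∑ l, v l * (starRingEnd 𝕜) (v l)) :=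
    Finset.sum_congr rfl fun j _ => mul_comm _ _
  rw [this, div_self (nsq_ne v hv), one_mul]

lemma prP_inj : Function.Injective (prP : PP 𝕜 m → _) := by
  intro p q h
  rw [← pj_rep p, ← pj_rep q]
  rw [pj_eq_iff _ _ p.rep_nonzero q.rep_nonzero]
  refine ⟨((∑ j, (starRingEnd 𝕜) (q.rep j) * p.rep j) / (∑ l, q.rep l * (starRingEnd 𝕜) (q.rep l))), funext fun i => ?_⟩
  have := prj_self p.rep p.rep_nonzero i
  have h' : prj p.rep = prj q.rep := h
  rw [h', prj_apply] at this
  exact this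

instance : CompactSpace (PP 𝕜 m) := by
  have h1 : IsCompact (pj '' (Metric.sphere (0 : Fin (m + 1) → 𝕜) 1) : Set (PP 𝕜 m)) := by
    haveI : ProperSpace (Fin (m + 1) → 𝕜) := inferInstance
    refine (isCompact_sphere _ _).image_of_continuousOn (continuousOn_pj.mono ?_)
    intro v hv
    simp only [mem_sphere_iff_norm, sub_zero] at hv
    intro e; simp [e] at hv
  have h2 : (pj '' (Metric.sphere (0 : Fin (m + 1) → 𝕜) 1) : Set (PP 𝕜 m)) = Set.univ := by
    rw [Set.eq_univ_iff_forall]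
    intro p
    have hp : ‖p.rep‖ ≠ 0 := norm_ne_zero_iff.2 p.rep_nonzero
    have hp' : ((‖p.rep‖ : 𝕜)⁻¹) ≠ 0 := by simpa using p.rep_nonzero
    refine ⟨((‖p.rep‖ : 𝕜)⁻¹) • p.rep, ?_, ?_⟩
    · simp [norm_smul, hp]
    · rw [pj_smul _ hp', pj_rep]
  exact ⟨h2 ▸ h1⟩

lemma prP_emb : IsClosedEmbedding (prP : PP 𝕜 m → _) := prP_cont.isClosedEmbedding prP_inj

instance : TopologicalSpace.MetrizableSpace (PP 𝕜 m) := prP_emb.isEmbedding.metrizableSpace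

end Proj

section Mil

variable {𝕜 : Type} [RCLike 𝕜] {r s : ℕ}

noncomputable def Bf (r s : ℕ) (x : Fin (r + 1) → 𝕜) (y : Fin (s + 1) → 𝕜) : 𝕜 :=
  ∑ i : Fin (min (s + 1) (r + 1)), x (Fin.castLE (min_le_right _ _) i) *
        (starRingEnd 𝕜) (y (Fin.castLE (min_le_left _ _) i))

def Mil (𝕜 : Type) [RCLike 𝕜] (r s : ℕ) : Set (PP 𝕜 r × PP 𝕜 s) := {p | Bf r s p.1.rep p.2.rep = 0}

lemma realMilnor_eq : RealMilnor r s = Mil ℝ r s := by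
  ext p; simp [RealMilnor, Mil, Bf]

lemma complexMilnor_eq : ComplexMilnor r s = Mil ℂ r s := rfl

lemma Bf_smul (c d : 𝕜) (x : Fin (r + 1) → 𝕜) (y : Fin (s + 1) → 𝕜) :
    Bf r s (c • x) (d • y) = c * (starRingEnd 𝕜) d * Bf r s x y := by
  simp only [Bf, Finset.mul_sum, Pi.smul_apply, smul_eq_mul, map_mul]
  exact Finset.sum_congr rfl fun i _ => by ring

lemma Bf_add_left (x x' : Fin (r + 1) → 𝕜) (y : Fin (s + 1) → 𝕜) :
    Bf r s (x + x') y = Bf r s x y + Bf r s x' y := by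
  simp only [Bf, Pi.add_apply, add_mul, Finset.sum_add_distrib]

lemma Bf_smul_left (c : 𝕜) (x : Fin (r + 1) → 𝕜) (y : Fin (s + 1) → 𝕜) :
    Bf r s (c • x) y = c * Bf r s x y := by
  have := Bf_smul c 1 x y
  simpa using this

lemma Bf_add_right (x : Fin (r + 1) → 𝕜) (y y' : Fin (s + 1) → 𝕜) :
    Bf r s x (y + y') = Bf r s x y + Bf r s x y' := by
  simp only [Bf, Pi.add_apply, map_add, mul_add, Finset.sum_add_distrib]

lemma Bf_smul_right (c : 𝕜) (x : Fin (r + 1) → 𝕜) (y : Fin (s + 1) → 𝕜) :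
    Bf r s x (c • y) = (starRingEnd 𝕜) c * Bf r s x y := by
  have := Bf_smul 1 c x y
  simpa using this

lemma Bf_cont : Continuous (fun p : (Fin (r + 1) → 𝕜) × (Fin (s + 1) → 𝕜) => Bf r s p.1 p.2) := by
  refine continuous_finsetSum _ fun i _ => ?_
  exact (Continuous.mul (by fun_prop) (RCLike.continuous_conj.comp (by fun_prop)))

lemma Bf_eq (h : s ≤ r) (x : Fin (r + 1) → 𝕜) (y : Fin (s + 1) → 𝕜) :
    Bf r s x y = ∑ i : Fin (s + 1), x (Fin.castLE (by omega) i) * (starRingEnd 𝕜) (y i) := by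
  have e : min (s + 1) (r + 1) = s + 1 := by omega
  unfold Bf
  exact Fintype.sum_equiv (finCongr e) _ _ (fun i => rfl)

lemma mem_Mil (x : Fin (r + 1) → 𝕜) (y : Fin (s + 1) → 𝕜) (hx : x ≠ 0) (hy : y ≠ 0) :
    (pj x, pj y) ∈ Mil 𝕜 r s ↔ Bf r s x y = 0 := by
  obtain ⟨c, hc, e⟩ := rep_pj x hx
  obtain ⟨d, hd, e'⟩ := rep_pj y hy
  simp only [Mil, Set.mem_setOf_eq, e, e', Bf_smul]
  simp [hc, hd]

lemma Mil_closed : IsClosed (Mil 𝕜 r s) := by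
  rw [← isOpen_compl_iff, isOpen_iff_mem_nhds]
  rintro ⟨p, q⟩ h
  obtain ⟨L, hL, hL'⟩ := rep_lift p
  obtain ⟨M, hM, hM'⟩ := rep_lift q
  have hc : ContinuousAt (fun z : PP 𝕜 r × PP 𝕜 s => Bf r s (L z.1) (M z.2)) (p, q) := by
    have h1 : ContinuousAt (fun z : PP 𝕜 r × PP 𝕜 s => (L z.1, M z.2)) (p, q) :=
      (ContinuousAt.comp (f := Prod.fst) (x := (p, q)) hL continuousAt_fst).prodMk (ContinuousAt.comp (f := Prod.snd) (x := (p, q)) hM continuousAt_snd)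
    exact Bf_cont.continuousAt.comp h1
  have h0 : Bf r s (L p) (M q) ≠ 0 := by
    obtain ⟨c, hc, e⟩ := hL'.self_of_nhds
    obtain ⟨d, hd, e'⟩ := hM'.self_of_nhds
    rw [e, e', Bf_smul]
    have : Bf r s p.rep q.rep ≠ 0 := h
    simp [hc, hd, this]
  have h1 := hc.eventually_ne h0
  have h2 := (hL'.prod_nhds hM')
  filter_upwards [h1, h2] with z hz hz2 hmem
  obtain ⟨⟨c, hc, e⟩, ⟨d, hd, e'⟩⟩ := hz2
  apply hz
  rw [e, e', Bf_smul]
  have : Bf r s z.1.rep z.2.rep = 0 := hmem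
  simp [this]

instance : CompactSpace (Mil 𝕜 r s) := isCompact_iff_compactSpace.1 Mil_closed.isCompact

end Mil

end MilnorTC

namespace MilnorTC

set_option linter.all false

open Topology Filter
open scoped unitInterval

section Sections

variable {X : Type*} [TopologicalSpace X] {n : ℕ}

def HasSec (U : Set (Fin n → X)) : Prop :=
  ∃ sc : (Fin n → X) → C(I, X), ContinuousOn sc U ∧ ∀ u ∈ U, tcPi X n (sc u) = u

lemma HasSec.mono {U V : Set (Fin n → X)} (h : HasSec V) (hUV : U ⊆ V) : HasSec U := by
  obtain ⟨sc, h1, h2⟩ := h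
  exact ⟨sc, h1.mono hUV, fun u hu => h2 u (hUV hu)⟩

lemma hasSec_of_homotopic (hn : 2 ≤ n) (U : Set (Fin n → X)) (c : C(U, X))
    (h : ∀ i, ContinuousMap.Homotopic (⟨fun u => u.1 i, (continuous_apply i).comp continuous_subtype_val⟩ : C(U, X)) c) : HasSec U := by
  classical
  let H := fun i => Classical.choice (h i)
  have hn1 : (0 : ℝ) < (n : ℝ) - 1 := by
    have : (2 : ℝ) ≤ n := by exact_mod_cast hn
    linarith
  have ex : ∀ t : I, ∃ i : Fin n, |(t : ℝ) * ((n : ℝ) - 1) - (i : ℝ)| ≤ 1 / 2 := by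
    intro t
    have h0 : 0 ≤ (t : ℝ) * ((n : ℝ) - 1) := mul_nonneg t.2.1 hn1.le
    have h1 : (t : ℝ) * ((n : ℝ) - 1) ≤ n - 1 := by
      have := t.2.2
      nlinarith
    have hf : ⌊(t : ℝ) * ((n : ℝ) - 1) + 1 / 2⌋₊ < n := by
      rw [Nat.floor_lt (by linarith)]
      linarith
    refine ⟨⟨_, hf⟩, ?_⟩
    have a := Nat.floor_le (a := (t : ℝ) * ((n : ℝ) - 1) + 1 / 2) (by linarith)
    have b := Nat.lt_floor_add_one ((t : ℝ) * ((n : ℝ) - 1) + 1 / 2)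
    rw [abs_le]
    constructor <;> simp only <;> linarith
  choose ix hix using ex
  let g : Fin n → U × I → X := fun i p => H i (Set.projIcc (0 : ℝ) 1 zero_le_one (2 * |(p.2 : ℝ) * ((n : ℝ) - 1) - (i : ℝ)|), p.1)
  have hg : ∀ i, Continuous (g i) := by
    intro i
    refine (H i).continuous.comp (Continuous.prodMk (continuous_projIcc.comp ?_) continuous_fst)
    fun_prop
  have hagree : ∀ (i : Fin n) (p : U × I), |(p.2 : ℝ) * ((n : ℝ) - 1) - (i : ℝ)| ≤ 1 / 2 → g (ix p.2) p = g i p := by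
    intro i p hp
    by_cases e : ix p.2 = i
    · rw [e]
    · have h2 := hix p.2
      have hne : (1 : ℝ) ≤ |((ix p.2 : ℕ) : ℝ) - ((i : ℕ) : ℝ)| := by
        have : ((ix p.2 : ℕ) : ℤ) - ((i : ℕ) : ℤ) ≠ 0 := by
          intro h; apply e; apply Fin.ext; omega
        have := Int.one_le_abs this
        exact_mod_cast this
      have tri : |((ix p.2 : ℕ) : ℝ) - ((i : ℕ) : ℝ)| ≤ |(p.2 : ℝ) * ((n : ℝ) - 1) - (ix p.2 : ℝ)| + |(p.2 : ℝ) * ((n : ℝ) - 1) - (i : ℝ)| := by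
        have := abs_sub ((p.2 : ℝ) * ((n : ℝ) - 1) - (i : ℝ)) ((p.2 : ℝ) * ((n : ℝ) - 1) - (ix p.2 : ℝ))
        have e2 : (p.2 : ℝ) * ((n : ℝ) - 1) - (i : ℝ) - ((p.2 : ℝ) * ((n : ℝ) - 1) - (ix p.2 : ℝ)) = ((ix p.2 : ℕ) : ℝ) - ((i : ℕ) : ℝ) := by ring
        rw [e2] at this
        linarith
      simp only [g]
      rw [Set.projIcc_of_right_le _ (by linarith), Set.projIcc_of_right_le _ (by linarith)]
      exact ((H _).apply_one p.1).trans ((H i).apply_one p.1).symm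
  have hcont : Continuous (fun p : U × I => g (ix p.2) p) := by
    refine LocallyFinite.continuous (f := fun i : Fin n => {p : U × I | |(p.2 : ℝ) * ((n : ℝ) - 1) - (i : ℝ)| ≤ 1 / 2})
      (locallyFinite_of_finite _) ?_ ?_ ?_
    · rw [Set.eq_univ_iff_forall]
      intro p
      exact Set.mem_iUnion.2 ⟨ix p.2, hix p.2⟩
    · intro i
      exact isClosed_le (by fun_prop) continuous_const
    · intro i
      exact (hg i).continuousOn.congr fun p hp => hagree i p hp
  let sec : C(U, C(I, X)) := ContinuousMap.curry ⟨_, hcont⟩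
  have hsec : ∀ u : U, tcPi X n (sec u) = u.1 := by
    intro u
    funext i
    have hi : (i : ℝ) / ((n : ℝ) - 1) ∈ Set.Icc (0 : ℝ) 1 := by
      refine ⟨by positivity, ?_⟩
      rw [div_le_one hn1]
      have := i.2
      have : (i : ℕ) + 1 ≤ n := this
      have : ((i : ℕ) : ℝ) + 1 ≤ n := by exact_mod_cast this
      linarith
    show g (ix _) (u, _) = _
    rw [Set.projIcc_of_mem _ hi]
    have e : (i : ℝ) / ((n : ℝ) - 1) * ((n : ℝ) - 1) - (i : ℝ) = 0 := by
      field_simp; simp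
    have := hagree i (u, ⟨(i : ℝ) / ((n : ℝ) - 1), hi⟩) (by simp only [e]; norm_num)
    rw [this]
    simp only [g, e]
    rw [Set.projIcc_of_le_left _ (by norm_num)]
    exact (H i).apply_zero u
  by_cases hY : Nonempty (Fin n → X)
  · obtain ⟨y⟩ := hY
    refine ⟨fun u => if hu : u ∈ U then sec ⟨u, hu⟩ else ContinuousMap.const _ (y ⟨0, by omega⟩), ?_, ?_⟩
    · rw [continuousOn_iff_continuous_restrict]
      refine sec.continuous.congr ?_
      intro u; simp [u.2]
    · intro u hu
      simp only [hu, dif_pos]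
      exact hsec ⟨u, hu⟩
  · exact ⟨fun u => (hY ⟨u⟩).elim, fun u => (hY ⟨u⟩).elim, fun u => (hY ⟨u⟩).elim⟩

def TCset (X : Type*) [TopologicalSpace X] (n : ℕ) : Set ℕ :=
  {k | 0 < k ∧ ∃ U : Fin k → Set (Fin n → X),
    (∀ i, IsOpen (U i)) ∧ (⋃ i, U i) = Set.univ ∧
    ∀ i, ∃ sec : C(U i, C(I, X)), ∀ u : U i, tcPi X n (sec u) = (u : Fin n → X)}

lemma stratify [TopologicalSpace.MetrizableSpace X] {P : Type*} (N : ℕ) (hN : 0 < N)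
    (D : (Fin n → X) → ℕ) (hD : ∀ y, D y < N) (piece : (Fin n → X) → P)
    (hloc : ∀ y, ∀ᶠ u in 𝓝 y, D u = D y → piece u = piece y)
    (U : P → Set (Fin n → X)) (hU : ∀ y, IsOpen (U (piece y))) (hmem : ∀ y, y ∈ U (piece y))
    (hsec : ∀ y, HasSec (U (piece y))) : N ∈ TCset X n := by
  classical
  letI : MetricSpace X := TopologicalSpace.metrizableSpaceMetric X
  let Z : P → ℕ → Set (Fin n → X) := fun p m => {y | D y = m ∧ piece y = p}
  let Z' : P → ℕ → Set (Fin n → X) := fun p m => {y | D y = m ∧ piece y ≠ p}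
  let O : P → ℕ → Set (Fin n → X) := fun p m => {y | Metric.infEDist y (Z p m) < Metric.infEDist y (Z' p m)} 
  have hOopen : ∀ p m, IsOpen (O p m) := fun p m =>
    isOpen_lt Metric.continuous_infEDist Metric.continuous_infEDist
  have hOne : ∀ p m y, y ∈ O p m → ∃ z, piece z = p := by
    intro p m y hy
    by_contra hcon
    push Not at hcon
    have : Z p m = ∅ := by
      ext z; simp [Z, hcon z]
    simp [O, this] at hy
  have hdisj : ∀ p q m y, y ∈ O p m → y ∈ O q m → p = q := by
    intro p q m y hp hq
    by_contra hne
    have h1 : Metric.infEDist y (Z' p m) ≤ Metric.infEDist y (Z q m) :=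
      Metric.infEDist_anti fun z hz => ⟨hz.1, fun e => hne (e.symm.trans hz.2)⟩
    have h2 : Metric.infEDist y (Z' q m) ≤ Metric.infEDist y (Z p m) :=
      Metric.infEDist_anti fun z hz => ⟨hz.1, fun e => hne (hz.2.symm.trans e)⟩
    exact absurd ((lt_of_lt_of_le hp h1).trans (lt_of_lt_of_le hq h2)) (lt_irrefl _)
  have hin : ∀ y, y ∈ O (piece y) (D y) := by
    intro y
    have h1 : Metric.infEDist y (Z (piece y) (D y)) = 0 := Metric.infEDist_zero_of_mem ⟨rfl, rfl⟩
    show Metric.infEDist y (Z (piece y) (D y)) < Metric.infEDist y (Z' (piece y) (D y))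
    rw [h1, pos_iff_ne_zero]
    intro h0
    have := Metric.mem_closure_iff_infEDist_zero.2 h0
    rw [mem_closure_iff_frequently] at this
    obtain ⟨u, hu, hu'⟩ := (this.and_eventually (hloc y)).exists
    exact hu.2 (hu' hu.1)
  let Q : Fin N → Set (Fin n → X) := fun m => ⋃ p, (O p m ∩ (if (∃ y, piece y = p) then U p else ∅))
  refine ⟨hN, Q, ?_, ?_, ?_⟩
  · intro m
    refine isOpen_iUnion fun p => (hOopen p m).inter ?_
    split_ifs with h
    · obtain ⟨y, rfl⟩ := h
      exact hU y
    · exact isOpen_empty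
  · rw [Set.eq_univ_iff_forall]
    intro y
    refine Set.mem_iUnion.2 ⟨⟨D y, hD y⟩, Set.mem_iUnion.2 ⟨piece y, hin y, ?_⟩⟩
    rw [if_pos ⟨y, rfl⟩]
    exact hmem y
  · intro m
    have hs : ∀ p, ∃ sc : (Fin n → X) → C(I, X), (∃ y, piece y = p) → ContinuousOn sc (U p) ∧ ∀ u ∈ U p, tcPi X n (sc u) = u := by
      intro p
      by_cases h : ∃ y, piece y = p
      · obtain ⟨y, rfl⟩ := h
        obtain ⟨sc, h1, h2⟩ := hsec y
        exact ⟨sc, fun _ => ⟨h1, h2⟩⟩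
      · by_cases hY : Nonempty (Fin n → X)
        · obtain ⟨y⟩ := hY
          obtain ⟨sc, h1, h2⟩ := hsec y
          exact ⟨sc, fun h' => absurd h' h⟩
        · exact ⟨fun u => (hY ⟨u⟩).elim, fun h' => absurd h' h⟩
    choose sc hsc using hs
    have hp : ∀ u : Q m, ∃ p, u.1 ∈ O p m ∧ u.1 ∈ U p ∧ ∃ y, piece y = p := by
      intro u
      obtain ⟨p, h1, h2⟩ := Set.mem_iUnion.1 u.2
      split_ifs at h2 with h
      · exact ⟨p, h1, h2, h⟩
      · exact h2.elim
    choose pc hpc1 hpc2 hpc3 using hp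
    refine ⟨⟨fun u => sc (pc u) u.1, ?_⟩, fun u => (hsc _ (hpc3 u)).2 _ (hpc2 u)⟩
    rw [continuous_iff_continuousAt]
    intro u0
    have h1 : ContinuousAt (fun u : Q m => sc (pc u0) u.1) u0 := by
      have hopen : IsOpen (U (pc u0)) := by
        obtain ⟨y, hy⟩ := hpc3 u0
        rw [← hy]; exact hU y
      exact ((hsc _ (hpc3 u0)).1.continuousAt (hopen.mem_nhds (hpc2 u0))).comp continuous_subtype_val.continuousAt
    refine h1.congr ?_
    have : ∀ᶠ u : Q m in 𝓝 u0, u.1 ∈ O (pc u0) m :=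
      continuous_subtype_val.continuousAt.eventually ((hOopen _ _).mem_nhds (hpc1 u0))
    filter_upwards [this] with u hu
    rw [hdisj _ _ _ _ hu (hpc1 u)]

lemma higherTC_le {N : ℕ} (h : N ∈ TCset X n) : higherTC X n ≤ N := Nat.sInf_le h

end Sections

end MilnorTC

namespace MilnorTC

set_option linter.all false

open Topology Filter
open scoped unitInterval

section Upper

variable {𝕜 : Type} [RCLike 𝕜] {m r s n : ℕ}

/-- locally, up to scalars, continuous -/
def LC {T : Type*} [TopologicalSpace T] (x : T → Fin (m + 1) → 𝕜) : Prop :=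
  ∀ t0, ∃ x' : T → Fin (m + 1) → 𝕜, ContinuousAt x' t0 ∧ ∀ᶠ t in 𝓝 t0, ∃ c : 𝕜, c ≠ 0 ∧ x' t = c • x t

lemma LC_of_cont {T : Type*} [TopologicalSpace T] {x : T → Fin (m + 1) → 𝕜} (h : Continuous x) : LC x :=
  fun t0 => ⟨x, h.continuousAt, Eventually.of_forall fun t => ⟨1, one_ne_zero, by simp⟩⟩

lemma LC.cont_pj {T : Type*} [TopologicalSpace T] {x : T → Fin (m + 1) → 𝕜} (h : LC x) (h0 : ∀ t, x t ≠ 0) :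
    Continuous (fun t => pj (x t)) := by
  rw [continuous_iff_continuousAt]
  intro t0
  obtain ⟨x', hx, he⟩ := h t0
  obtain ⟨c, hc, e⟩ := he.self_of_nhds
  have : ContinuousAt (fun t => pj (x' t)) t0 := by
    refine ContinuousAt.comp (f := x') (continuousAt_pj _ ?_) hx
    rw [e]; exact smul_ne_zero hc (h0 t0)
  refine this.congr ?_
  filter_upwards [he] with t ht
  obtain ⟨c, hc, e⟩ := ht
  rw [e, pj_smul c hc]

noncomputable def mkM {T : Type*} [TopologicalSpace T] (x : T → Fin (r + 1) → 𝕜) (y : T → Fin (s + 1) → 𝕜)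
    (hx : LC x) (hy : LC y) (hx0 : ∀ t, x t ≠ 0) (hy0 : ∀ t, y t ≠ 0) (hB : ∀ t, Bf r s (x t) (y t) = 0) :
    C(T, Mil 𝕜 r s) where
  toFun t := ⟨(pj (x t), pj (y t)), (mem_Mil _ _ (hx0 t) (hy0 t)).2 (hB t)⟩
  continuous_toFun := Continuous.subtype_mk ((hx.cont_pj hx0).prodMk (hy.cont_pj hy0)) _

lemma mkM_val {T : Type*} [TopologicalSpace T] (x : T → Fin (r + 1) → 𝕜) (y : T → Fin (s + 1) → 𝕜)
    (hx : LC x) (hy : LC y) (hx0 : ∀ t, x t ≠ 0) (hy0 : ∀ t, y t ≠ 0) (hB : ∀ t, Bf r s (x t) (y t) = 0) (t) :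
    (mkM x y hx hy hx0 hy0 hB t).1 = (pj (x t), pj (y t)) := rfl

/-- basis vector -/
noncomputable def eb (a : Fin (m + 1)) : Fin (m + 1) → 𝕜 := Pi.single a 1

lemma eb_ne (a : Fin (m + 1)) : (eb a : Fin (m + 1) → 𝕜) ≠ 0 := by
  intro h
  have := congrFun h a
  simp [eb] at this

lemma Bf_eb_left (h : s ≤ r) (b : Fin (s + 1)) (y : Fin (s + 1) → 𝕜) :
    Bf r s (eb (Fin.castLE (by omega) b)) y = (starRingEnd 𝕜) (y b) := by
  rw [Bf_eq h, Finset.sum_eq_single b]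
  · simp [eb]
  · intro i _ hi
    have : Fin.castLE (by omega : s + 1 ≤ r + 1) i ≠ Fin.castLE (by omega) b := by
      intro e; apply hi; apply Fin.ext; simpa [Fin.ext_iff] using e
    simp [eb, this]
  · simp

lemma Bf_eb_right (h : s ≤ r) (b : Fin (s + 1)) (x : Fin (r + 1) → 𝕜) :
    Bf r s x (eb b) = x (Fin.castLE (by omega) b) := by
  rw [Bf_eq h, Finset.sum_eq_single b]
  · simp [eb]
  · intro i _ hi
    simp [eb, hi]
  · simp

lemma Bf_eb_eb (h : s ≤ r) (a : Fin (r + 1)) (b : Fin (s + 1)) (hab : a.val ≠ b.val) :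
    Bf r s (eb a) (eb b : Fin (s + 1) → 𝕜) = 0 := by
  rw [Bf_eb_right h]
  have : Fin.castLE (by omega : s + 1 ≤ r + 1) b ≠ a := by
    intro e; apply hab; rw [← e]; rfl
  simp [eb, this]

/-- centre points -/
noncomputable def ctr (h : s ≤ r) (a : Fin (r + 1)) (b : Fin (s + 1)) (hab : a.val ≠ b.val) : Mil 𝕜 r s :=
  ⟨(pj (eb a), pj (eb b)), (mem_Mil _ _ (eb_ne a) (eb_ne b)).2 (Bf_eb_eb h a b hab)⟩

lemma seg_ne (a a' : Fin (m + 1)) (c : 𝕜) (hc : c ≠ 0) (t : ℝ) :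
    ((1 - t : ℝ) : 𝕜) • (eb a : Fin (m + 1) → 𝕜) + ((t : ℝ) : 𝕜) • (if a = a' then eb a else c • eb a') ≠ 0 := by
  intro h
  by_cases e : a = a'
  · have := congrFun h a
    rw [if_pos e] at this
    simp only [Pi.add_apply, Pi.smul_apply, eb, Pi.single_eq_same, smul_eq_mul, mul_one, Pi.zero_apply] at this
    push_cast at this
    simp at this
  · have h1 := congrFun h a
    have h2 := congrFun h a'
    simp [e, eb] at h1
    simp [e, eb, Ne.symm e, hc] at h2
    rw [h2] at h1
    simp at h1

lemma joined_ctr (h : s ≤ r) (a a' : Fin (r + 1)) (b b' : Fin (s + 1)) (hab : a.val ≠ b.val)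
    (hab' : a'.val ≠ b'.val) (x : I → Fin (r + 1) → 𝕜) (y : I → Fin (s + 1) → 𝕜)
    (hx : Continuous x) (hy : Continuous y) (hx0 : ∀ t, x t ≠ 0) (hy0 : ∀ t, y t ≠ 0)
    (hB : ∀ t, Bf r s (x t) (y t) = 0) (x0 : x 0 = eb a) (x1 : ∃ c : 𝕜, c ≠ 0 ∧ x 1 = c • eb a') (y0 : y 0 = eb b)
    (y1 : ∃ c : 𝕜, c ≠ 0 ∧ y 1 = c • eb b') : Joined (ctr h a b hab : Mil 𝕜 r s) (ctr h a' b' hab') := by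
  obtain ⟨c, hc, x1⟩ := x1
  obtain ⟨d, hd, y1⟩ := y1
  refine ⟨⟨mkM x y (LC_of_cont hx) (LC_of_cont hy) hx0 hy0 hB, ?_, ?_⟩⟩
  · apply Subtype.ext
    simp [mkM, x0, y0, ctr]
  · apply Subtype.ext
    simp [mkM, x1, y1, ctr, pj_smul, hc, hd]

lemma joined_a (h : s ≤ r) (a a' : Fin (r + 1)) (b : Fin (s + 1)) (hab : a.val ≠ b.val)
    (hab' : a'.val ≠ b.val) : Joined (ctr h a b hab : Mil 𝕜 r s) (ctr h a' b hab') := by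
  refine joined_ctr h a a' b b hab hab' (fun t => ((1 - t : ℝ) : 𝕜) • (eb a : Fin (r + 1) → 𝕜) + ((t : ℝ) : 𝕜) •
    (if a = a' then eb a else (1 : 𝕜) • eb a')) (fun t => eb b) ?_ continuous_const ?_ ?_ ?_ ?_ ?_ rfl ⟨1, one_ne_zero, by simp⟩
  · fun_prop
  · intro t; exact seg_ne a a' 1 one_ne_zero t
  · intro t; exact eb_ne b
  · intro t
    rw [Bf_add_left, Bf_smul_left, Bf_smul_left]
    split_ifs with e
    · simp [Bf_eb_eb h _ _ hab]
    · simp [Bf_eb_eb h _ _ hab, Bf_eb_eb h _ _ hab']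
  · simp
  · refine ⟨1, one_ne_zero, ?_⟩
    split_ifs with e
    · simp [e]
    · simp

lemma joined_b (h : s ≤ r) (a : Fin (r + 1)) (b b' : Fin (s + 1)) (hab : a.val ≠ b.val)
    (hab' : a.val ≠ b'.val) : Joined (ctr h a b hab : Mil 𝕜 r s) (ctr h a b' hab') := by
  refine joined_ctr h a a b b' hab hab' (fun t => eb a) (fun t => ((1 - t : ℝ) : 𝕜) • (eb b : Fin (s + 1) → 𝕜) + ((t : ℝ) : 𝕜) •
    (if b = b' then eb b else (1 : 𝕜) • eb b')) continuous_const ?_ ?_ ?_ ?_ rfl ⟨1, one_ne_zero, by simp⟩ ?_ ?_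
  · fun_prop
  · intro t; exact eb_ne a
  · intro t; exact seg_ne b b' 1 one_ne_zero t
  · intro t
    rw [Bf_add_right, Bf_smul_right, Bf_smul_right]
    split_ifs with e
    · simp [Bf_eb_eb h _ _ hab]
    · simp [Bf_eb_eb h _ _ hab, Bf_eb_eb h _ _ hab']
  · simp
  · refine ⟨1, one_ne_zero, ?_⟩
    split_ifs with e
    · simp [e]
    · simp

lemma joined_swap (h : s ≤ r) (a b : Fin (s + 1)) (hab : a.val ≠ b.val) :
    Joined (ctr h (Fin.castLE (by omega) a) b hab : Mil 𝕜 r s) (ctr h (Fin.castLE (by omega) b) a hab.symm) := by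
  have hne : Fin.castLE (by omega : s + 1 ≤ r + 1) a ≠ Fin.castLE (by omega) b := by
    intro e; apply hab; simpa [Fin.ext_iff] using e
  have hne' : b ≠ a := fun e => hab (by rw [e])
  let κ : Fin (s + 1) → Fin (r + 1) := Fin.castLE (by omega)
  have hB : ∀ (b : Fin (s + 1)) (y : Fin (s + 1) → 𝕜), Bf r s (eb (κ b)) y = (starRingEnd 𝕜) (y b) := Bf_eb_left h
  refine joined_ctr h (κ a) (κ b) b a hab hab.symm
    (fun t => ((1 - (t : ℝ) : ℝ) : 𝕜) • (eb (κ a) : Fin (r + 1) → 𝕜) + ((t : ℝ) : 𝕜) •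
    (if κ a = κ b then eb (κ a) else (1 : 𝕜) • eb (κ b)))
    (fun t => ((1 - (t : ℝ) : ℝ) : 𝕜) • (eb b : Fin (s + 1) → 𝕜) + ((t : ℝ) : 𝕜) •
    (if b = a then eb b else (-1 : 𝕜) • eb a)) ?_ ?_ ?_ ?_ ?_ ?_ ?_ ?_ ?_
  · fun_prop
  · fun_prop
  · intro t; exact seg_ne _ _ 1 one_ne_zero t
  · intro t; exact seg_ne _ _ (-1) (by simp) t
  · intro t
    rw [if_neg hne, if_neg hne']
    simp only [Bf_add_left, Bf_smul_left, Bf_add_right, Bf_smul_right, hB]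
    simp [eb, hne', Ne.symm hne']
    ring
  · simp
  · refine ⟨1, one_ne_zero, ?_⟩
    rw [if_neg hne]; simp
  · simp
  · refine ⟨-1, by simp, ?_⟩
    rw [if_neg hne']; simp

noncomputable def ctr0 (h : s ≤ r) (hr : 0 < r) : Mil 𝕜 r s := ctr h (Fin.last r) 0 (by show r ≠ 0; omega)

lemma joined_ctr0 (h : s ≤ r) (hr : 0 < r) (a : Fin (r + 1)) (b : Fin (s + 1)) (hab : a.val ≠ b.val) :
    Joined (ctr h a b hab : Mil 𝕜 r s) (ctr0 h hr) := by
  by_cases hb : b.val = r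
  · have ha : a.val < s + 1 := by omega
    have := joined_swap (𝕜 := 𝕜) h ⟨a.val, ha⟩ b hab
    refine this.trans ?_
    have e : Fin.castLE (by omega) b = Fin.last r := by
      apply Fin.ext; simpa using hb
    have h2 := joined_b (𝕜 := 𝕜) h (Fin.castLE (by omega) b) ⟨a.val, ha⟩ 0 hab.symm (by show b.val ≠ 0; omega)
    refine h2.trans ?_
    have : (ctr h (Fin.castLE (by omega) b) 0 (by show b.val ≠ 0; omega) : Mil 𝕜 r s) = ctr0 h hr := by
      simp only [ctr0]; congr
    rw [this]
  · refine (joined_a h a (Fin.last r) b hab (fun e => hb e.symm)).trans ?_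
    exact joined_b h (Fin.last r) b 0 _ _

/-- open Schubert cell neighbourhoods -/
def Uab (a : Fin (r + 1)) (b : Fin (s + 1)) : Set (Mil 𝕜 r s) := {p | p.1.1.rep a ≠ 0 ∧ p.1.2.rep b ≠ 0}

lemma Uab_open (a : Fin (r + 1)) (b : Fin (s + 1)) : IsOpen (Uab a b : Set (Mil 𝕜 r s)) :=
  ((isOpen_rep a).preimage (continuous_fst.comp continuous_subtype_val)).inter
    ((isOpen_rep b).preimage (continuous_snd.comp continuous_subtype_val))

lemma Uab_contr (h : s ≤ r) (hr : 0 < r) (a : Fin (r + 1)) (b : Fin (s + 1)) (hab : a.val ≠ b.val) :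
    ContinuousMap.Homotopic (⟨Subtype.val, continuous_subtype_val⟩ : C(↥(Uab a b : Set (Mil 𝕜 r s)), Mil 𝕜 r s))
      (ContinuousMap.const _ (ctr0 h hr)) := by
  have hb' : Fin.castLE (by omega : s + 1 ≤ r + 1) b ≠ a := by
    intro e; apply hab; rw [← e]; rfl
  have main : ContinuousMap.Homotopic (⟨Subtype.val, continuous_subtype_val⟩ : C(↥(Uab a b : Set (Mil 𝕜 r s)), Mil 𝕜 r s))
      (ContinuousMap.const _ (ctr h a b hab)) := by
    let ξ : ↥(Uab a b : Set (Mil 𝕜 r s)) → Fin (r + 1) → 𝕜 := fun u => (u.1.1.1.rep a)⁻¹ • u.1.1.1.rep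
    let η : ↥(Uab a b : Set (Mil 𝕜 r s)) → Fin (s + 1) → 𝕜 := fun u => (u.1.1.2.rep b)⁻¹ • u.1.1.2.rep
    have hξ : Continuous ξ := by
      have := (continuousOn_nrm (𝕜 := 𝕜) a)
      exact this.comp_continuous (f := fun u : ↥(Uab a b : Set (Mil 𝕜 r s)) => u.1.1.1) (by fun_prop) (fun u => u.2.1)
    have hη : Continuous η := by
      have := (continuousOn_nrm (𝕜 := 𝕜) b)
      exact this.comp_continuous (f := fun u : ↥(Uab a b : Set (Mil 𝕜 r s)) => u.1.1.2) (by fun_prop) (fun u => u.2.2)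
    have hξa : ∀ u, ξ u a = 1 := fun u => by simp [ξ, u.2.1]
    have hηb : ∀ u, η u b = 1 := fun u => by simp [η, u.2.2]
    have hB : ∀ u, Bf r s (ξ u) (η u) = 0 := by
      intro u
      simp only [ξ, η]
      rw [Bf_smul]
      have : Bf r s u.1.1.1.rep u.1.1.2.rep = 0 := u.1.2
      rw [this, mul_zero]
    let x1 : I × ↥(Uab a b : Set (Mil 𝕜 r s)) → Fin (r + 1) → 𝕜 := fun p => ((1 - (p.1 : ℝ) : ℝ) : 𝕜) • ξ p.2 + (((p.1 : ℝ)) : 𝕜) • eb a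
    let y1 : I × ↥(Uab a b : Set (Mil 𝕜 r s)) → Fin (s + 1) → 𝕜 := fun p => ((1 - (p.1 : ℝ) : ℝ) : 𝕜) • η p.2 + (((p.1 : ℝ)) : 𝕜) • eb b
    let x2 : I × ↥(Uab a b : Set (Mil 𝕜 r s)) → Fin (r + 1) → 𝕜 := fun p => x1 p + (- Bf r s (x1 p) (y1 p)) • eb (Fin.castLE (by omega) b)
    have hx1 : Continuous x1 := by
      simp only [x1]; fun_prop
    have hy1 : Continuous y1 := by
      simp only [y1]; fun_prop
    have hx2 : Continuous x2 :=
      hx1.add ((Bf_cont.comp (hx1.prodMk hy1)).neg.smul continuous_const)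
    have hx1a : ∀ p, x1 p a = 1 := by intro p; simp [x1, hξa, eb, Algebra.algebraMap_eq_smul_one]; rw [← add_smul]; simp
    have hy1b : ∀ p, y1 p b = 1 := by intro p; simp [y1, hηb, eb, Algebra.algebraMap_eq_smul_one]; rw [← add_smul]; simp
    have hx2a : ∀ p, x2 p a = 1 := by
      intro p
      simp [x2, hx1a, eb, hb'.symm]
    refine ⟨⟨mkM (𝕜 := 𝕜) x2 y1 (LC_of_cont hx2) (LC_of_cont hy1)
      (fun p e => by have := hx2a p; rw [e] at this; simp at this)
      (fun p e => by have := hy1b p; rw [e] at this; simp at this)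
      (fun p => by
        simp only [x2]
        rw [Bf_add_left, Bf_smul_left, Bf_eb_left h, hy1b]; simp), ?_, ?_⟩⟩
    · intro u
      apply Subtype.ext
      have e1 : x1 (0, u) = ξ u := by simp [x1]
      have e2 : y1 (0, u) = η u := by simp [y1]
      show (pj (x2 (0, u)), pj (y1 (0, u))) = u.1.1
      simp only [x2, e1, e2, hB, neg_zero, zero_smul, add_zero]
      simp only [ξ, η]
      rw [pj_smul _ (inv_ne_zero u.2.1), pj_smul _ (inv_ne_zero u.2.2), pj_rep, pj_rep]
    · intro u
      apply Subtype.ext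
      have e1 : x1 (1, u) = eb a := by simp [x1]
      have e2 : y1 (1, u) = eb b := by simp [y1]
      show (pj (x2 (1, u)), pj (y1 (1, u))) = (pj (eb a), pj (eb b))
      simp only [x2, e1, e2, Bf_eb_eb h a b hab, neg_zero, zero_smul, add_zero]
  refine main.trans ?_
  obtain ⟨γ⟩ := joined_ctr0 (𝕜 := 𝕜) h hr a b hab
  exact ⟨⟨⟨fun p => γ p.1, by fun_prop⟩, fun u => by simp, fun u => by simp⟩⟩

open Classical in
noncomputable def lo (p : PP 𝕜 m) : Fin (m + 1) :=
  (Finset.univ.filter fun i => p.rep i ≠ 0).min' (by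
    by_contra h
    apply p.rep_nonzero
    funext i
    by_contra hi
    exact h ⟨i, by simpa using hi⟩)

open Classical in
noncomputable def hi (p : PP 𝕜 m) : Fin (m + 1) :=
  (Finset.univ.filter fun i => p.rep i ≠ 0).max' (by
    by_contra h
    apply p.rep_nonzero
    funext i
    by_contra hi
    exact h ⟨i, by simpa using hi⟩)

lemma lo_ne (p : PP 𝕜 m) : p.rep (lo p) ≠ 0 := by
  classical
  exact (Finset.mem_filter.1 (Finset.min'_mem (Finset.univ.filter fun i => p.rep i ≠ 0) _)).2
lemma hi_ne (p : PP 𝕜 m) : p.rep (hi p) ≠ 0 := by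
  classical
  exact (Finset.mem_filter.1 (Finset.max'_mem (Finset.univ.filter fun i => p.rep i ≠ 0) _)).2
lemma lo_le (p : PP 𝕜 m) (i) (h : p.rep i ≠ 0) : lo p ≤ i := by
  classical
  exact Finset.min'_le _ _ (by simpa using h)
lemma le_hi (p : PP 𝕜 m) (i) (h : p.rep i ≠ 0) : i ≤ hi p := by
  classical
  exact Finset.le_max' _ _ (by simpa using h)

lemma lo_ne_hi (h : s ≤ r) (p : Mil 𝕜 r s) : (lo p.1.1).val ≠ (hi p.1.2).val := by
  intro e
  have hB : Bf r s p.1.1.rep p.1.2.rep = 0 := p.2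
  rw [Bf_eq h, Finset.sum_eq_single (hi p.1.2)] at hB
  · have e2 : Fin.castLE (by omega : s + 1 ≤ r + 1) (hi p.1.2) = lo p.1.1 := by
      apply Fin.ext; exact e.symm
    rw [e2] at hB
    have h1 := lo_ne p.1.1
    have h2 := hi_ne p.1.2
    simp [h1, h2] at hB
  · intro i _ hne
    by_contra hcon
    have h1 : p.1.1.rep (Fin.castLE (by omega : s + 1 ≤ r + 1) i) ≠ 0 := fun e => hcon (by rw [e, zero_mul])
    have h2 : p.1.2.rep i ≠ 0 := fun e => hcon (by rw [e]; simp)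
    have h3 := lo_le _ _ h1
    have h4 := le_hi _ _ h2
    apply hne
    apply Fin.ext
    have h3' : (lo p.1.1).val ≤ i.val := h3
    have h4' : i.val ≤ (hi p.1.2).val := h4
    omega
  · simp

def eS (r a b : ℕ) : ℕ := (r - a) + b - (if a < b then 1 else 0)

theorem upper_mem (h : s ≤ r) (hr : 0 < r) (hn : 2 ≤ n) : n * (r + s - 1) + 1 ∈ TCset (Mil 𝕜 r s) n := by
  classical
  have heS : ∀ p : Mil 𝕜 r s, eS r (lo p.1.1) (hi p.1.2) ≤ r + s - 1 := by
    intro p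
    have h1 := lo_ne_hi h p
    have h2 := (lo p.1.1).2
    have h3 := (hi p.1.2).2
    unfold eS
    split_ifs <;> omega
  refine stratify (n * (r + s - 1) + 1) (by omega) (fun y => ∑ i, eS r (lo (y i).1.1) (hi (y i).1.2)) ?_
    (fun y i => (lo (y i).1.1, hi (y i).1.2)) ?_ (fun p => {y | ∀ i, y i ∈ Uab (p i).1 (p i).2}) ?_ ?_ ?_
  · intro y
    have : ∑ i, eS r (lo (y i).1.1) (hi (y i).1.2) ≤ ∑ i : Fin n, (r + s - 1) := Finset.sum_le_sum fun i _ => heS (y i)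
    simp at this
    omega
  · intro y
    have : ∀ᶠ u in 𝓝 y, ∀ i : Fin n, u i ∈ Uab (lo (y i).1.1) (hi (y i).1.2) := by
      rw [eventually_all]
      intro i
      have := (continuous_apply (A := fun _ => Mil 𝕜 r s) i).continuousAt (x := y)
      exact this.eventually ((Uab_open _ _).mem_nhds ⟨lo_ne _, hi_ne _⟩)
    filter_upwards [this] with u hu hD
    have hle : ∀ i, eS r (lo (y i).1.1) (hi (y i).1.2) ≤ eS r (lo (u i).1.1) (hi (u i).1.2) ∧
        (eS r (lo (y i).1.1) (hi (y i).1.2) = eS r (lo (u i).1.1) (hi (u i).1.2) →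
          (lo (u i).1.1).val = (lo (y i).1.1).val ∧ (hi (u i).1.2).val = (hi (y i).1.2).val) := by
      intro i
      have a1 : (lo (u i).1.1).val ≤ (lo (y i).1.1).val := lo_le _ _ (hu i).1
      have a2 : (hi (y i).1.2).val ≤ (hi (u i).1.2).val := le_hi _ _ (hu i).2
      have h1 := lo_ne_hi h (u i)
      have h2 := lo_ne_hi h (y i)
      have h3 := (lo (y i).1.1).2
      unfold eS
      split_ifs <;> constructor <;> omega
    have := (Finset.sum_eq_sum_iff_of_le (fun i _ => (hle i).1)).1 hD.symm
    funext i
    have := (hle i).2 (this i (Finset.mem_univ i))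
    exact Prod.ext (Fin.ext this.1) (Fin.ext this.2)
  · intro y
    have : {u : Fin n → Mil 𝕜 r s | ∀ i, u i ∈ Uab (lo (y i).1.1) (hi (y i).1.2)} =
      ⋂ i, (fun u => u i) ⁻¹' (Uab (lo (y i).1.1) (hi (y i).1.2)) := by ext; simp
    rw [this]
    exact isOpen_iInter_of_finite fun i => (Uab_open _ _).preimage (continuous_apply i)
  · intro y i
    exact ⟨lo_ne _, hi_ne _⟩
  · intro y
    refine hasSec_of_homotopic hn _ (ContinuousMap.const _ (ctr0 h hr)) ?_
    intro i
    have hc := Uab_contr (𝕜 := 𝕜) h hr (lo (y i).1.1) (hi (y i).1.2) (lo_ne_hi h (y i))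
    let f : C({u : Fin n → Mil 𝕜 r s | ∀ i, u i ∈ Uab (lo (y i).1.1) (hi (y i).1.2)}, (Uab (lo (y i).1.1) (hi (y i).1.2) : Set (Mil 𝕜 r s))) :=
      ⟨fun u => ⟨u.1 i, u.2 i⟩, Continuous.subtype_mk ((continuous_apply i).comp continuous_subtype_val) _⟩
    exact ContinuousMap.Homotopic.comp hc (ContinuousMap.Homotopic.refl f)

end Upper

end MilnorTC

namespace MilnorTC

set_option linter.all false

open Topology Filter
open scoped unitInterval

section Lower

variable {𝕜 : Type} [RCLike 𝕜] {m r s n : ℕ}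

/-- transition probability -/
noncomputable def tp (p q : PP 𝕜 m) : 𝕜 := ∑ i, ∑ j, prP p i j * prP q j i

lemma tp_cont : Continuous (fun z : PP 𝕜 m × PP 𝕜 m => tp z.1 z.2) := by
  unfold tp
  refine continuous_finsetSum _ fun i _ => continuous_finsetSum _ fun j _ => ?_
  have h1 : Continuous (fun z : PP 𝕜 m × PP 𝕜 m => prP z.1) := prP_cont.comp continuous_fst
  have h2 : Continuous (fun z : PP 𝕜 m × PP 𝕜 m => prP z.2) := prP_cont.comp continuous_snd
  exact (((continuous_apply j).comp ((continuous_apply i).comp h1))).mul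
    (((continuous_apply i).comp ((continuous_apply j).comp h2)))

lemma tp_symm (p q : PP 𝕜 m) : tp p q = tp q p := by
  unfold tp
  rw [Finset.sum_comm]
  exact Finset.sum_congr rfl fun i _ => Finset.sum_congr rfl fun j _ => mul_comm _ _

lemma tp_self (p : PP 𝕜 m) : tp p p ≠ 0 := by
  have : tp p p = 1 := by
    have h := nsq_ne p.rep p.rep_nonzero
    unfold tp prP
    have : ∀ i, ∑ j, prj p.rep i j * prj p.rep j i = (p.rep i * (starRingEnd 𝕜) (p.rep i)) / (∑ l, p.rep l * (starRingEnd 𝕜) (p.rep l)) := by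
      intro i
      have := prj_self p.rep p.rep_nonzero i
      have e : ∀ j, prj p.rep i j * prj p.rep j i = (prj p.rep i j * p.rep j) * ((starRingEnd 𝕜) (p.rep i) / (∑ l, p.rep l * (starRingEnd 𝕜) (p.rep l))) := by
        intro j
        have : prj p.rep j i = p.rep j * (starRingEnd 𝕜) (p.rep i) / (∑ l, p.rep l * (starRingEnd 𝕜) (p.rep l)) := rfl
        rw [this]; ring
      simp only [e]
      rw [← Finset.sum_mul, this]; ring
    simp only [this]
    rw [← Finset.sum_div, div_self h]
  rw [this]; exact one_ne_zero

lemma tp_step (p q : PP 𝕜 m) (h : tp p q ≠ 0) (w : Fin (m + 1) → 𝕜) (hw : w ≠ 0) (hq : pj w = q) :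
    (fun i => ∑ j, prP p i j * w j) ≠ 0 ∧ pj (fun i => ∑ j, prP p i j * w j) = p := by
  have h1 : (fun i => ∑ j, prP p i j * w j) ≠ 0 := by
    intro e
    apply h
    unfold tp
    obtain ⟨c, hc, e'⟩ := rep_pj w hw
    have hq' : prP q = prj w := by
      rw [← hq]; unfold prP; rw [e', prj_smul c hc]
    rw [hq']
    refine Finset.sum_eq_zero fun i _ => ?_
    have e1 : ∀ j, prP p i j * prj w j i = (prP p i j * w j) * ((starRingEnd 𝕜) (w i) / (∑ l, w l * (starRingEnd 𝕜) (w l))) := by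
      intro j
      have : prj w j i = w j * (starRingEnd 𝕜) (w i) / (∑ l, w l * (starRingEnd 𝕜) (w l)) := rfl
      rw [this]; ring
    simp only [e1]
    rw [← Finset.sum_mul]
    have := congrFun e i
    simp only [Pi.zero_apply] at this
    rw [this, zero_mul]
  refine ⟨h1, ?_⟩
  conv_rhs => rw [← pj_rep p]
  rw [pj_eq_iff _ _ h1 p.rep_nonzero]
  exact ⟨_, funext fun i => (prj_apply p.rep w i).symm⟩

/-- Lifting a null-homotopic family of lines to vectors. -/
lemma lift_line {K : Type*} [TopologicalSpace K] [CompactSpace K] (Γ : K → I → PP 𝕜 m)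
    (hΓ : Continuous (fun z : K × I => Γ z.1 z.2)) (p0 : PP 𝕜 m) (h0 : ∀ u, Γ u 0 = p0) (τ : I) :
    ∃ w : C(K, Fin (m + 1) → 𝕜), ∀ u, w u ≠ 0 ∧ pj (w u) = Γ u τ := by
  let Q : I → Prop := fun t => ∃ w : C(K, Fin (m + 1) → 𝕜), ∀ u, w u ≠ 0 ∧ pj (w u) = Γ u t
  have step : ∀ t t', (∀ u, tp (Γ u t') (Γ u t) ≠ 0) → Q t → Q t' := by
    rintro t t' h ⟨w, hw⟩
    refine ⟨⟨fun u i => ∑ j, prP (Γ u t') i j * w u j, ?_⟩, fun u => tp_step _ _ (h u) _ (hw u).1 (hw u).2⟩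
    have h1 : Continuous (fun u => prP (Γ u t')) :=
      prP_cont.comp (hΓ.comp (continuous_id.prodMk continuous_const))
    refine continuous_pi fun i => continuous_finsetSum _ fun j _ => ?_
    exact ((continuous_apply j).comp ((continuous_apply i).comp h1)).mul ((continuous_apply j).comp w.continuous)
  have hQ0 : Q 0 := ⟨ContinuousMap.const _ p0.rep, fun u => ⟨p0.rep_nonzero, by rw [h0 u]; exact pj_rep p0⟩⟩
  refine PreconnectedSpace.induction₂' (fun t t' : I => Q t → Q t') ?_ ⟨fun a b c h1 h2 h => h2 (h1 h)⟩ 0 τ hQ0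
  intro t
  have hev : ∀ᶠ t' in 𝓝 t, ∀ u : K, tp (Γ u t') (Γ u t) ≠ 0 := by
    have hc1 : Continuous (fun z : I × K => Γ z.2 z.1) :=
      Continuous.comp (g := fun z : K × I => Γ z.1 z.2) (f := fun z : I × K => (z.2, z.1)) hΓ (continuous_snd.prodMk continuous_fst)
    have hc2 : Continuous (fun z : I × K => Γ z.2 t) :=
      Continuous.comp (g := fun z : K × I => Γ z.1 z.2) (f := fun z : I × K => (z.2, t)) hΓ (continuous_snd.prodMk continuous_const)
    have hc : Continuous (fun z : I × K => tp (Γ z.2 z.1) (Γ z.2 t)) :=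
      Continuous.comp (g := fun z : PP 𝕜 m × PP 𝕜 m => tp z.1 z.2) (f := fun z : I × K => (Γ z.2 z.1, Γ z.2 t)) tp_cont (hc1.prodMk hc2)
    have := (isCompact_univ (X := K)).eventually_forall_of_forall_eventually (x₀ := t)
      (P := fun t' u => tp (Γ u t') (Γ u t) ≠ 0) (fun u _ => by
        exact hc.continuousAt.eventually_ne (tp_self (Γ u t)))
    filter_upwards [this] with t' h u
    exact h u trivial
  filter_upwards [hev] with t' h
  exact ⟨step t t' h, step t' t fun u => by rw [tp_symm]; exact h u⟩

/-- extended functionals -/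
lemma ext_fun {Y : Type*} [TopologicalSpace Y] [NormalSpace Y] {K : Type*} [TopologicalSpace K] [CompactSpace K]
    (e : K → Y) (he : IsClosedEmbedding e) (Γ : K → I → PP 𝕜 m)
    (hΓ : Continuous (fun z : K × I => Γ z.1 z.2)) (p0 : PP 𝕜 m) (h0 : ∀ u, Γ u 0 = p0) (τ : I) :
    ∃ φ : C(Y, Fin (m + 1) → 𝕜), ∀ u (x : Fin (m + 1) → 𝕜), x ≠ 0 → pj x = Γ u τ → ∑ l, φ (e u) l * x l ≠ 0 := by
  obtain ⟨w, hw⟩ := lift_line Γ hΓ p0 h0 τ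
  let w' : C(K, Fin (m + 1) → 𝕜) := ⟨fun u l => (starRingEnd 𝕜) (w u l), continuous_pi fun l =>
    RCLike.continuous_conj.comp ((continuous_apply l).comp w.continuous)⟩
  obtain ⟨g, hg⟩ := ContinuousMap.exists_extension he w'
  refine ⟨g, fun u x hx hp => ?_⟩
  have h1 : g (e u) = w' u := by rw [← hg]; rfl
  rw [h1]
  obtain ⟨hw0, hwp⟩ := hw u
  rw [← hwp, pj_eq_iff _ _ hx hw0] at hp
  obtain ⟨c, rfl⟩ := hp
  have hc : c ≠ 0 := by rintro rfl; simp at hx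
  have : ∑ l, w' u l * (c • w u) l = c * ∑ l, w u l * (starRingEnd 𝕜) (w u l) := by
    rw [Finset.mul_sum]
    refine Finset.sum_congr rfl fun l _ => ?_
    show (starRingEnd 𝕜) (w u l) * (c * w u l) = _
    ring
  rw [this]
  exact mul_ne_zero hc (nsq_ne _ hw0)

/-- From a short cover we get functionals. -/
lemma functionals (q k : ℕ) (hq : 0 < q) (p0 : Mil 𝕜 r s) (hk : k ∈ TCset (Mil 𝕜 r s) (q + 1)) :
    ∃ (Φ : Fin k → Fin q → C(Fin q → PP 𝕜 r × PP 𝕜 s, Fin (r + 1) → 𝕜))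
      (Ψ : Fin k → Fin q → C(Fin q → PP 𝕜 r × PP 𝕜 s, Fin (s + 1) → 𝕜)),
      ∀ u : Fin q → PP 𝕜 r × PP 𝕜 s, (∀ i, u i ∈ Mil 𝕜 r s) → ∃ j, ∀ i,
        (∀ x, x ≠ 0 → pj x = (u i).1 → ∑ l, Φ j i u l * x l ≠ 0) ∧
        (∀ y, y ≠ 0 → pj y = (u i).2 → ∑ l, Ψ j i u l * y l ≠ 0) := by
  obtain ⟨hk0, U, hU, hcov, hsec⟩ := hk
  choose sec hs using hsec
  let cn : (Fin q → Mil 𝕜 r s) → (Fin (q + 1) → Mil 𝕜 r s) := fun u => Fin.cons p0 u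
  have hcn : Continuous cn := by
    refine continuous_pi fun i => ?_
    refine Fin.cases ?_ (fun i => ?_) i
    · exact continuous_const
    · exact continuous_apply i
  obtain ⟨Kc, hKcov, hKcl, hKsub⟩ := exists_iUnion_eq_closed_subset (u := fun j => cn ⁻¹' (U j))
    (fun j => (hU j).preimage hcn) (fun x => Set.toFinite _) (by
      rw [← Set.preimage_iUnion, hcov, Set.preimage_univ])
  let e : ∀ j, Kc j → (Fin q → PP 𝕜 r × PP 𝕜 s) := fun j u i => (u.1 i).1
  haveI : ∀ j, CompactSpace (Kc j) := fun j => isCompact_iff_compactSpace.1 (hKcl j).isCompact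
  have he : ∀ j, IsClosedEmbedding (e j) := by
    intro j
    refine Continuous.isClosedEmbedding ?_ ?_
    · exact continuous_pi fun i => continuous_subtype_val.comp ((continuous_apply i).comp continuous_subtype_val)
    · intro u v h
      apply Subtype.ext
      funext i
      exact Subtype.ext (congrFun h i)
  let G : ∀ j, Kc j → I → Mil 𝕜 r s := fun j u t => sec j ⟨cn u.1, hKsub j u.2⟩ t
  have hG : ∀ j, Continuous (fun z : Kc j × I => G j z.1 z.2) := by
    intro j
    have h1 : Continuous (fun z : Kc j × I => (sec j ⟨cn z.1.1, hKsub j z.1.2⟩ : C(I, Mil 𝕜 r s))) :=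
      (sec j).continuous.comp (Continuous.subtype_mk (hcn.comp (continuous_subtype_val.comp continuous_fst)) _)
    exact h1.eval continuous_snd
  let τ : Fin q → I := fun i => Set.projIcc (0 : ℝ) 1 zero_le_one (((i.succ : Fin (q + 1)) : ℝ) / (((q + 1 : ℕ) : ℝ) - 1))
  have hG0 : ∀ j u, G j u 0 = p0 := by
    intro j u
    have := congrFun (hs j ⟨cn u.1, hKsub j u.2⟩) 0
    simp [tcPi, cn] at this
    exact this
  have hG1 : ∀ j u i, G j u (τ i) = u.1 i := by
    intro j u i
    exact congrFun (hs j ⟨cn u.1, hKsub j u.2⟩) i.succ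
  have hΦ := fun j i => ext_fun (e j) (he j) (fun u t => (G j u t).1.1)
    (continuous_fst.comp (continuous_subtype_val.comp (hG j))) p0.1.1 (fun u => by rw [hG0]) (τ i)
  have hΨ := fun j i => ext_fun (e j) (he j) (fun u t => (G j u t).1.2)
    (continuous_snd.comp (continuous_subtype_val.comp (hG j))) p0.1.2 (fun u => by rw [hG0]) (τ i)
  choose Φ hΦ using hΦ
  choose Ψ hΨ using hΨ
  refine ⟨Φ, Ψ, fun u hu => ?_⟩
  let u' : Fin q → Mil 𝕜 r s := fun i => ⟨u i, hu i⟩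
  have : u' ∈ ⋃ j, Kc j := by rw [hKcov]; trivial
  obtain ⟨j, hj⟩ := Set.mem_iUnion.1 this
  refine ⟨j, fun i => ⟨fun x hx hp => hΦ j i ⟨u', hj⟩ x hx ?_, fun x hx hp => hΨ j i ⟨u', hj⟩ x hx ?_⟩⟩
  · rw [hp, hG1]
  · rw [hp, hG1]

end Lower

end MilnorTC

namespace MilnorTC

set_option linter.all false

open Topology Filter
open scoped unitInterval

section AdmS

variable {J : Type} [Fintype J] [DecidableEq J]

lemma Adm_rep (c : ℕ) (χ : J → ZMod 2) (χs : List (J → ZMod 2)) (k : J → ℕ) (j : J) (h1 : χ j = 1)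
    (h0 : ∀ j' ≠ j, 0 < k j' → χ j' = 0) (hc : c ≤ k j) (hA : Adm χs (Function.update k j (k j - c))) :
    Adm (List.replicate c χ ++ χs) k := by
  induction c generalizing k with
  | zero => simpa using hA
  | succ c ih =>
    rw [List.replicate_succ, List.cons_append]
    refine Adm.cons χ _ k j h1 (by omega) h0 ?_
    refine ih (dec k j) ?_ ?_ ?_
    · intro j' hj' hp
      refine h0 j' hj' ?_
      simpa [dec, hj'] using hp
    · simp [dec]; omega
    · have : Function.update (dec k j) j (dec k j j - c) = Function.update k j (k j - (c + 1)) := by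
        simp [dec]; congr 1; omega
      rw [this]; exact hA

lemma flatMap_rep {α β : Type*} (l : List α) (κ : ℕ) (χ : β) :
    l.flatMap (fun _ => List.replicate κ χ) = List.replicate (l.length * κ) χ := by
  induction l with
  | nil => simp
  | cons a l ih =>
    rw [List.flatMap_cons, ih, List.replicate_append_replicate]
    congr 1
    simp; ring

variable {q : ℕ}

def χab (i : Fin q) (x y : ZMod 2) : Fin q × Bool → ZMod 2 := fun j => if j.1 = i then (if j.2 then y else x) else 0

lemma Adm_block (κ r s r' s' : ℕ) (hκ : 0 < κ) (hr : r' ≤ r) (hs : s' ≤ s) (hrs : r' + s' + 1 = r + s)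
    (l : List (Fin q)) (hl : l.Nodup) :
    Adm (l.flatMap fun i => List.replicate (r' * κ) (χab i 1 0) ++ (List.replicate (s' * κ) (χab i 0 1) ++
      List.replicate κ (χab i 1 1))) (fun j => if j.1 ∈ l then (if j.2 then κ * s else κ * r) else 0) := by
  induction l with
  | nil => 
    simp only [List.flatMap_nil, List.not_mem_nil, if_false]
    exact Adm.nil
  | cons i l ih =>
    have hi : i ∉ l := (List.nodup_cons.1 hl).1
    have ih := ih (List.nodup_cons.1 hl).2
    rw [List.flatMap_cons, List.append_assoc, List.append_assoc]
    have c1 : r' * κ ≤ κ * r := by rw [mul_comm]; exact Nat.mul_le_mul_left _ hr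
    have c2 : s' * κ ≤ κ * s := by rw [mul_comm]; exact Nat.mul_le_mul_left _ hs
    have c3 : r' * κ + s' * κ + κ = κ * r + κ * s := by
      have := congrArg (fun z => κ * z) hrs
      simp only [mul_add] at this
      rw [mul_comm r', mul_comm s']; omega
    refine Adm_rep _ _ _ _ (i, false) (by simp [χab]) ?_ (by simpa using c1) ?_
    · rintro ⟨i', b⟩ hne hp
      simp only [χab]
      by_cases h : i' = i
      · subst h
        cases b
        · simp at hne
        · simp
      · simp [h]
    refine Adm_rep _ _ _ _ (i, true) (by simp [χab]) ?_ (by simpa using c2) ?_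
    · rintro ⟨i', b⟩ hne hp
      simp only [χab]
      by_cases h : i' = i
      · subst h
        cases b
        · simp
        · simp at hne
      · simp [h]
    rcases (by omega : r' = r ∧ s = s' + 1 ∨ s' = s ∧ r = r' + 1) with ⟨e1, e2⟩ | ⟨e1, e2⟩
    · subst e1 e2
      refine Adm_rep _ _ _ _ (i, true) (by simp [χab]) ?_ ?_ ?_
      · rintro ⟨i', b⟩ hne hp
        simp only [χab]
        by_cases h : i' = i
        · subst h
          cases b
          · simp [mul_comm] at hp
          · simp at hne
        · simp [h]
      · simp; 
        rw [mul_add, mul_comm]; omega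
      · convert ih using 1
        funext ⟨i', b⟩
        by_cases h : i' = i
        · subst h
          cases b
          · simp [hi, mul_comm]
          · simp [hi, mul_comm, mul_add]
        · simp [h]
    · subst e1 e2
      refine Adm_rep _ _ _ _ (i, false) (by simp [χab]) ?_ ?_ ?_
      · rintro ⟨i', b⟩ hne hp
        simp only [χab]
        by_cases h : i' = i
        · subst h
          cases b
          · simp at hne
          · simp [mul_comm] at hp
        · simp [h]
      · simp; 
        rw [mul_add, mul_comm]; omega
      · convert ih using 1
        funext ⟨i', b⟩
        by_cases h : i' = i
        · subst h
          cases b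
          · simp [hi, mul_comm, mul_add]
          · simp [hi, mul_comm]
        · simp [h]

end AdmS

section Lower2

variable {𝕜 : Type} [RCLike 𝕜] {m r s n : ℕ}

theorem lower_gen (κ N : ℕ) (hκ : 0 < κ) (co : List (𝕜 → ℝ)) (hco : co.length = κ) (hcc : ∀ c ∈ co, Continuous c)
    (hcn : ∀ c ∈ co, ∀ z, c (-z) = - c z) (hc0 : ∀ z, (∀ c ∈ co, c z = 0) → z = 0)
    (lf : ∀ m : ℕ, (Fin (N + 1) → ℝ) → Fin (m + 1) → 𝕜) (lfc : ∀ m, Continuous (lf m))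
    (lfn : ∀ m v, lf m (-v) = - lf m v)
    (lf0 : ∀ m v, (∀ i : Fin (N + 1), κ * m < i.val → v i = 0) → lf m v = 0 → v = 0)
    (h : s ≤ r) (hr : 0 < r) (q k : ℕ) (hq : 0 < q) (hd : 0 < r + s - 1) (hN : κ * r ≤ N)
    (hk : k ∈ TCset (Mil 𝕜 r s) (q + 1)) (hkq : k ≤ q * (r + s - 1)) : False := by
  classical
  obtain ⟨Φ, Ψ, hΦΨ⟩ := functionals q k hq (ctr0 h hr) hk
  have hk0 : 0 < k := hk.1
  obtain ⟨r', s', hr', hs', hrs⟩ : ∃ r' s', r' ≤ r ∧ s' ≤ s ∧ r' + s' + 1 = r + s := by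
    rcases Nat.eq_zero_or_pos s with e | e
    · exact ⟨r - 1, 0, by omega, by omega, by omega⟩
    · exact ⟨r, s - 1, by omega, by omega, by omega⟩
  set d := r + s - 1 with hdd
  let jj : Fin q → ℕ → Fin k := fun i l => ⟨min (i.val * d + l) (k - 1), by omega⟩
  have hjj : ∀ j : Fin k, ∃ i : Fin q, ∃ l < d, jj i l = j := by
    intro j
    have hj := j.2
    refine ⟨⟨j.val / d, ?_⟩, j.val % d, Nat.mod_lt _ hd, ?_⟩
    · rw [Nat.div_lt_iff_lt_mul hd]; omega
    · apply Fin.ext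
      simp only [jj]
      rw [Nat.div_add_mod']
      omega
  let K : (Fin q × Bool) → ℕ := fun j => if j.2 then κ * s else κ * r
  have hK : ∀ j, K j ≤ N := by
    rintro ⟨i, b⟩
    have : κ * s ≤ κ * r := Nat.mul_le_mul_left _ h
    cases b <;> simp [K] <;> omega
  let Xv : Fin q → VV (Fin q × Bool) N → Fin (r + 1) → 𝕜 := fun i v => lf r (v (i, false))
  let Yv : Fin q → VV (Fin q × Bool) N → Fin (s + 1) → 𝕜 := fun i v => lf s (v (i, true))
  have hXc : ∀ i, Continuous (Xv i) := fun i => (lfc r).comp (continuous_apply _)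
  have hYc : ∀ i, Continuous (Yv i) := fun i => (lfc s).comp (continuous_apply _)
  have hX0 : ∀ i, ∀ v ∈ (Sk K : Set (VV (Fin q × Bool) N)), Xv i v ≠ 0 := by
    intro i v hv e
    have := lf0 r _ (fun l hl => (hv (i, false)).2 l (by simpa [K] using hl)) e
    have h1 := (hv (i, false)).1
    rw [this] at h1
    simp at h1
  have hY0 : ∀ i, ∀ v ∈ (Sk K : Set (VV (Fin q × Bool) N)), Yv i v ≠ 0 := by
    intro i v hv e
    have := lf0 s _ (fun l hl => (hv (i, true)).2 l (by simpa [K] using hl)) e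
    have h1 := (hv (i, true)).1
    rw [this] at h1
    simp at h1
  have hXf : ∀ i j v, Xv i (flip j v) = if j = (i, false) then - Xv i v else Xv i v := by
    intro i j v
    by_cases e : j = (i, false)
    · subst e; simp [Xv, flip, lfn]
    · simp [Xv, flip, e, Function.update_of_ne (Ne.symm e)]
  have hYf : ∀ i j v, Yv i (flip j v) = if j = (i, true) then - Yv i v else Yv i v := by
    intro i j v
    by_cases e : j = (i, true)
    · subst e; simp [Yv, flip, lfn]
    · simp [Yv, flip, e, Function.update_of_ne (Ne.symm e)]
  let yy : VV (Fin q × Bool) N → Fin q → PP 𝕜 r × PP 𝕜 s := fun v i => (pj (Xv i v), pj (Yv i v))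
  have hneg : ∀ {m : ℕ} (x : Fin (m + 1) → 𝕜), pj (-x) = pj x := by
    intro m x
    have := pj_smul (-1 : 𝕜) (by simp) x
    simpa using this
  have hyf : ∀ j v, yy (flip j v) = yy v := by
    intro j v
    funext i
    simp only [yy, hXf, hYf]
    split_ifs <;> simp [hneg]
  have hyc : ContinuousOn yy (Sk K) := by
    rw [continuousOn_pi]
    intro i
    refine ContinuousOn.prodMk ?_ ?_
    · exact continuousOn_pj.comp (hXc i).continuousOn (fun v hv => hX0 i v hv)
    · exact continuousOn_pj.comp (hYc i).continuousOn (fun v hv => hY0 i v hv)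
  let fa : Fin q → ℕ → VV (Fin q × Bool) N → 𝕜 := fun i l v => ∑ a, Φ (jj i l) i (yy v) a * Xv i v a
  let fb : Fin q → ℕ → VV (Fin q × Bool) N → 𝕜 := fun i l v => ∑ a, Ψ (jj i l) i (yy v) a * Yv i v a
  let fc : Fin q → VV (Fin q × Bool) N → 𝕜 := fun i v => Bf r s (Xv i v) (Yv i v)
  let Good : ((Fin q × Bool) → ZMod 2) → (VV (Fin q × Bool) N → 𝕜) → Prop := fun χ f =>
    ContinuousOn f (Sk K) ∧ ∀ j v, f (flip j v) = if χ j = 0 then f v else - f v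
  have ga : ∀ i l, Good (χab i 1 0) (fa i l) := by
    intro i l
    refine ⟨continuousOn_finset_sum _ fun a _ => ContinuousOn.mul ?_ ?_, ?_⟩
    · exact ((continuous_apply a).comp (Φ (jj i l) i).continuous).comp_continuousOn hyc
    · exact ((continuous_apply a).comp (hXc i)).continuousOn
    · rintro ⟨i', b⟩ v
      simp only [fa, hyf, hXf]
      by_cases e : i' = i
      · subst e
        cases b <;> simp [χab]
      · simp [χab, e]
  have gb : ∀ i l, Good (χab i 0 1) (fb i l) := by
    intro i l
    refine ⟨continuousOn_finset_sum _ fun a _ => ContinuousOn.mul ?_ ?_, ?_⟩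
    · exact ((continuous_apply a).comp (Ψ (jj i l) i).continuous).comp_continuousOn hyc
    · exact ((continuous_apply a).comp (hYc i)).continuousOn
    · rintro ⟨i', b⟩ v
      simp only [fb, hyf, hYf]
      by_cases e : i' = i
      · subst e
        cases b <;> simp [χab]
      · simp [χab, e]
  have gc : ∀ i, Good (χab i 1 1) (fc i) := by
    intro i
    refine ⟨(Bf_cont.comp ((hXc i).prodMk (hYc i))).continuousOn, ?_⟩
    rintro ⟨i', b⟩ v
    simp only [fc, hXf, hYf]
    have n1 : ∀ x y, Bf r s (-x) y = - Bf r s (x : Fin (r + 1) → 𝕜) y := by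
      intro x y
      have := Bf_smul_left (-1 : 𝕜) x y
      simpa using this
    have n2 : ∀ x y, Bf r s x (-y) = - Bf r s (x : Fin (r + 1) → 𝕜) y := by
      intro x y
      have := Bf_smul_right (-1 : 𝕜) x y
      simpa using this
    by_cases e : i' = i
    · subst e
      cases b <;> simp [χab, n1, n2]
    · simp [χab, e]
  let pack : ((Fin q × Bool) → ZMod 2) → (VV (Fin q × Bool) N → 𝕜) → List (((Fin q × Bool) → ZMod 2) × (VV (Fin q × Bool) N → ℝ)) :=
    fun χ f => co.map fun c => (χ, fun v => c (f v))
  have hpack1 : ∀ χ f, (pack χ f).map Prod.fst = List.replicate κ χ := by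
    intro χ f
    simp only [pack, List.map_map]
    rw [← hco, List.eq_replicate_iff]
    simp
  have hpack0 : ∀ χ f v, (∀ g ∈ pack χ f, g.2 v = 0) → f v = 0 := by
    intro χ f v hg
    refine hc0 _ fun c hc => ?_
    exact hg (χ, fun v => c (f v)) (List.mem_map.2 ⟨c, hc, rfl⟩)
  let block : Fin q → List (((Fin q × Bool) → ZMod 2) × (VV (Fin q × Bool) N → ℝ)) := fun i =>
    (List.range r').flatMap (fun l => pack (χab i 1 0) (fa i l)) ++
    ((List.range s').flatMap (fun l => pack (χab i 0 1) (fb i (r' + l))) ++ pack (χab i 1 1) (fc i))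
  let gs := (List.finRange q).flatMap block
  have hgood : ∀ g ∈ gs, ∃ χ f, ∃ c ∈ co, Good χ f ∧ g = (χ, fun v => c (f v)) := by
    intro g hg
    obtain ⟨i, -, hg⟩ := List.mem_flatMap.1 hg
    simp only [block, List.mem_append, List.mem_flatMap] at hg
    rcases hg with ⟨l, _, hg⟩ | ⟨l, _, hg⟩ | hg <;> obtain ⟨c, hc, rfl⟩ := List.mem_map.1 hg
    · exact ⟨_, _, c, hc, ga i l, rfl⟩
    · exact ⟨_, _, c, hc, gb i (r' + l), rfl⟩
    · exact ⟨_, _, c, hc, gc i, rfl⟩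
  have hA : Adm (gs.map Prod.fst) K := by
    have := Adm_block κ r s r' s' hκ hr' hs' hrs (List.finRange q) (List.nodup_finRange q)
    have e : gs.map Prod.fst = (List.finRange q).flatMap fun i => List.replicate (r' * κ) (χab i 1 0) ++ (List.replicate (s' * κ) (χab i 0 1) ++
      List.replicate κ (χab i 1 1)) := by
      simp only [gs, List.map_flatMap, block, List.map_append, hpack1, flatMap_rep, List.length_range]
    rw [e]
    simpa [K] using this
  obtain ⟨v, hv, hz⟩ := borsuk_ulam K hK gs hA (by
    intro g hg
    obtain ⟨χ, f, c, hc, hG, rfl⟩ := hgood g hg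
    exact (hcc c hc).comp_continuousOn hG.1) (by
    intro g hg j v hv
    obtain ⟨χ, f, c, hc, hG, rfl⟩ := hgood g hg
    simp only [hG.2 j v, pm]
    split_ifs
    · simp
    · simp [hcn c hc])
  have hz' : ∀ i, (∀ l < r', fa i l v = 0) ∧ (∀ l < s', fb i (r' + l) v = 0) ∧ fc i v = 0 := by
    intro i
    have hb : ∀ g ∈ block i, g.2 v = 0 := fun g hg => hz g (List.mem_flatMap.2 ⟨i, List.mem_finRange i, hg⟩)
    simp only [block, List.mem_append, List.mem_flatMap] at hb
    refine ⟨fun l hl => hpack0 (χab i 1 0) _ _ fun g hg => hb g (Or.inl ⟨l, List.mem_range.2 hl, hg⟩),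
      fun l hl => hpack0 (χab i 0 1) _ _ fun g hg => hb g (Or.inr (Or.inl ⟨l, List.mem_range.2 hl, hg⟩)),
      hpack0 (χab i 1 1) _ _ fun g hg => hb g (Or.inr (Or.inr hg))⟩
  obtain ⟨j, hj⟩ := hΦΨ (yy v) (fun i => (mem_Mil _ _ (hX0 i v hv) (hY0 i v hv)).2 (hz' i).2.2)
  obtain ⟨i, l, hl, rfl⟩ := hjj j
  by_cases hl' : l < r'
  · exact (hj i).1 (Xv i v) (hX0 i v hv) rfl ((hz' i).1 l hl')
  · have := (hz' i).2.1 (l - r') (by omega)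
    rw [Nat.add_sub_cancel' (by omega)] at this
    exact (hj i).2 (Yv i v) (hY0 i v hv) rfl this

def gt {N : ℕ} (v : Fin (N + 1) → ℝ) (i : ℕ) : ℝ := if h : i < N + 1 then v ⟨i, h⟩ else 0

lemma gt_cont {N : ℕ} (i : ℕ) : Continuous (fun v : Fin (N + 1) → ℝ => gt v i) := by
  unfold gt
  split_ifs <;> fun_prop

lemma gt_neg {N : ℕ} (v : Fin (N + 1) → ℝ) (i : ℕ) : gt (-v) i = - gt v i := by
  unfold gt
  split_ifs <;> simp

lemma gt_val {N : ℕ} (v : Fin (N + 1) → ℝ) (i : Fin (N + 1)) : gt v i.val = v i := by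
  have := i.2
  unfold gt
  rw [dif_pos i.2]

theorem lower_real (h : s ≤ r) (hr : 0 < r) (q k : ℕ) (hq : 0 < q) (hd : 0 < r + s - 1)
    (hk : k ∈ TCset (Mil ℝ r s) (q + 1)) : q * (r + s - 1) + 1 ≤ k := by
  by_contra hcon
  refine lower_gen (𝕜 := ℝ) 1 r one_pos [id] rfl (by simp; exact continuous_id) (by simp) (by simp)
    (fun m v l => gt v l.val) (fun m => continuous_pi fun l => gt_cont _)
    (fun m v => funext fun l => gt_neg v _) ?_ h hr q k hq hd (by omega) hk (by omega)
  intro m v hv e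
  funext i
  by_cases hi : m < i.val
  · exact hv i (by omega)
  · have := congrFun e ⟨i.val, by omega⟩
    simpa [gt_val] using this

theorem lower_complex (h : s ≤ r) (hr : 0 < r) (q k : ℕ) (hq : 0 < q) (hd : 0 < r + s - 1)
    (hk : k ∈ TCset (Mil ℂ r s) (q + 1)) : q * (r + s - 1) + 1 ≤ k := by
  by_contra hcon
  refine lower_gen (𝕜 := ℂ) 2 (2 * r) two_pos [Complex.re, Complex.im] rfl
    (by simp; exact ⟨Complex.continuous_re, Complex.continuous_im⟩) (by simp)
    (by intro z hz; simp at hz; exact Complex.ext hz.1 hz.2)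
    (fun m v l => (gt v (2 * l.val) : ℂ) + (gt v (2 * l.val + 1) : ℂ) * Complex.I) ?_ ?_ ?_ h hr q k hq hd (by omega) hk (by omega)
  · intro m
    refine continuous_pi fun l => ?_
    exact (Complex.continuous_ofReal.comp (gt_cont _)).add ((Complex.continuous_ofReal.comp (gt_cont _)).mul continuous_const)
  · intro m v
    funext l
    simp [gt_neg]; ring
  intro m v hv e
  funext i
  by_cases hi : 2 * m < i.val
  · exact hv i (by omega)
  · have := congrFun e ⟨i.val / 2, by omega⟩
    have h1 := congrArg Complex.re this
    have h2 := congrArg Complex.im this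
    simp at h1 h2
    rcases Nat.mod_two_eq_zero_or_one i.val with e | e
    · have e : 2 * (i.val / 2) = i.val := by omega
      rw [e, gt_val] at h1
      exact h1
    · have e : 2 * (i.val / 2) + 1 = i.val := by omega
      rw [e, gt_val] at h2
      exact h2

end Lower2

end MilnorTC

namespace MilnorTC

set_option linter.all false

open Topology Filter
open scoped unitInterval

section Cplx

variable {m R S n : ℕ}

/-- total extension of a vector -/
noncomputable def xt (X : Fin (m + 1) → ℂ) (i : ℕ) : ℂ := if h : i < m + 1 then X ⟨i, h⟩ else 0

lemma xt_val (X : Fin (m + 1) → ℂ) (i : Fin (m + 1)) : xt X i.val = X i := by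
  unfold xt; rw [dif_pos i.2]

lemma xt_smul (c : ℝ) (X : Fin (m + 1) → ℂ) (i : ℕ) : xt (c • X) i = (c : ℂ) * xt X i := by
  unfold xt; split_ifs <;> simp

lemma xt_cont (i : ℕ) : Continuous (fun X : Fin (m + 1) → ℂ => xt X i) := by
  unfold xt; split_ifs <;> fun_prop

noncomputable def rlN (X : Fin (m + 1) → ℂ) (i : ℕ) : ℝ := if i % 2 = 0 then (xt X (i / 2)).re else (xt X (i / 2)).im

noncomputable def rl (X : Fin (m + 1) → ℂ) : Fin (2 * m + 1 + 1) → ℝ := fun i => rlN X i.val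

def cx (x : Fin (2 * m + 1 + 1) → ℝ) : Fin (m + 1) → ℂ := fun a => ⟨x ⟨2 * a.val, by omega⟩, x ⟨2 * a.val + 1, by omega⟩⟩

lemma rl_cx (x : Fin (2 * m + 1 + 1) → ℝ) : rl (cx x) = x := by
  funext i
  have hi : i.val / 2 < m + 1 := by omega
  simp only [rl, rlN, xt, dif_pos hi, cx]
  split_ifs with h
  · congr 1; apply Fin.ext; simp; omega
  · congr 1; apply Fin.ext; simp; omega

lemma cx_rl (X : Fin (m + 1) → ℂ) : cx (rl X) = X := by
  funext a
  have h1 : (2 * a.val) / 2 = a.val := by omega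
  have h2 : (2 * a.val + 1) / 2 = a.val := by omega
  have h3 : (2 * a.val + 1) % 2 ≠ 0 := by omega
  apply Complex.ext <;> simp [cx, rl, rlN, h1, h2, xt_val]
  

lemma rl_smul (c : ℝ) (X : Fin (m + 1) → ℂ) : rl (c • X) = c • rl X := by
  funext i
  simp only [rl, rlN, xt_smul, Pi.smul_apply, smul_eq_mul]
  split_ifs <;> simp

lemma cx_smul (c : ℝ) (x : Fin (2 * m + 1 + 1) → ℝ) : cx (c • x) = c • cx x := by
  funext i
  apply Complex.ext <;> simp [cx]

lemma rl_cont : Continuous (rl : (Fin (m + 1) → ℂ) → _) := by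
  refine continuous_pi fun i => ?_
  simp only [rl, rlN]
  split_ifs
  · exact Complex.continuous_re.comp (xt_cont _)
  · exact Complex.continuous_im.comp (xt_cont _)

lemma cx_cont : Continuous (cx : _ → (Fin (m + 1) → ℂ)) := by
  refine continuous_pi fun i => ?_
  have : (fun x : Fin (2 * m + 1 + 1) → ℝ => cx x i) = fun x => (x ⟨2 * i.val, by omega⟩ : ℂ) + (x ⟨2 * i.val + 1, by omega⟩ : ℂ) * Complex.I := by
    funext x
    apply Complex.ext <;> simp [cx]
  rw [this]
  fun_prop

lemma rl_ne (X : Fin (m + 1) → ℂ) (h : X ≠ 0) : rl X ≠ 0 := by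
  intro e
  apply h
  rw [← cx_rl X, e]
  funext a
  apply Complex.ext <;> simp [cx]

noncomputable def Bc (X : Fin (R + 1) → ℂ) (Y : Fin (S + 1) → ℂ) : ℝ :=
  ∑ k : Fin (S + 1), (xt X k.val * (starRingEnd ℂ) (Y k)).re

lemma Bf_rl (h : S ≤ R) (X : Fin (R + 1) → ℂ) (Y : Fin (S + 1) → ℂ) : Bf (2 * R + 1) (2 * S + 1) (rl X) (rl Y) = Bc X Y := by
  rw [Bf_eq (by omega)]
  have e1 : ∀ i : Fin (2 * S + 1 + 1), rl X (Fin.castLE (by omega) i) * (starRingEnd ℝ) (rl Y i) = rlN X i.val * rlN Y i.val := by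
    intro i; simp [rl]
  simp only [e1]
  rw [Fin.sum_univ_eq_sum_range (fun i => rlN X i * rlN Y i)]
  have e2 : ∀ k : ℕ, ∑ i ∈ Finset.range (2 * k), rlN X i * rlN Y i = ∑ i ∈ Finset.range k, (xt X i * (starRingEnd ℂ) (xt Y i)).re := by
    intro k
    induction k with
    | zero => simp
    | succ k ih =>
      rw [mul_add, Finset.sum_range_succ, Finset.sum_range_succ, ih, Finset.sum_range_succ, add_assoc]
      congr 1
      have h1 : (2 * k) / 2 = k := by omega
      have h2 : (2 * k + 1) / 2 = k := by omega
      have h3 : (2 * k + 1) % 2 = 1 := by omega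
      simp [rlN, h1, h2, h3]
  have e3 : 2 * S + 1 + 1 = 2 * (S + 1) := by ring
  rw [e3, e2, Finset.sum_range]
  unfold Bc
  simp only [xt_val]

lemma Bc_cont : Continuous (fun p : (Fin (R + 1) → ℂ) × (Fin (S + 1) → ℂ) => Bc p.1 p.2) := by
  unfold Bc
  refine continuous_finsetSum _ fun k _ => ?_
  refine Complex.continuous_re.comp (Continuous.mul ?_ (Complex.continuous_conj.comp ?_))
  · exact (xt_cont _).comp continuous_fst
  · exact (continuous_apply k).comp continuous_snd

lemma xt_add (X Y : Fin (m + 1) → ℂ) (i : ℕ) : xt (X + Y) i = xt X i + xt Y i := by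
  unfold xt; split_ifs <;> simp

lemma Bc_add_left (X X' : Fin (R + 1) → ℂ) (Y : Fin (S + 1) → ℂ) : Bc (X + X') Y = Bc X Y + Bc X' Y := by
  simp [Bc, xt_add, add_mul, Finset.sum_add_distrib]

lemma Bc_smul (c d : ℝ) (X : Fin (R + 1) → ℂ) (Y : Fin (S + 1) → ℂ) : Bc (c • X) (d • Y) = c * d * Bc X Y := by
  simp only [Bc, xt_smul, Finset.mul_sum, Pi.smul_apply, Complex.real_smul, map_mul, Complex.conj_ofReal]
  refine Finset.sum_congr rfl fun k _ => ?_
  have : (c : ℂ) * xt X k * ((d : ℂ) * (starRingEnd ℂ) (Y k)) = ((c * d : ℝ) : ℂ) * (xt X k * (starRingEnd ℂ) (Y k)) := by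
    push_cast; ring
  rw [this, Complex.re_ofReal_mul]

lemma Bc_smul_left (c : ℝ) (X : Fin (R + 1) → ℂ) (Y : Fin (S + 1) → ℂ) : Bc (c • X) Y = c * Bc X Y := by
  have := Bc_smul c 1 X Y
  simpa using this

lemma xt_single (a : Fin (m + 1)) (w : ℂ) (i : ℕ) : xt (Pi.single a w) i = if i = a.val then w else 0 := by
  unfold xt
  split_ifs with h1 h2 h3
  · have : (⟨i, h1⟩ : Fin (m + 1)) = a := Fin.ext h2
    rw [this]; simp
  · have : (⟨i, h1⟩ : Fin (m + 1)) ≠ a := fun e => h2 (by rw [← e])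
    simp [this]
  · omega
  · rfl

lemma Bc_single_left (h : S ≤ R) (b : Fin (S + 1)) (w : ℂ) (Y : Fin (S + 1) → ℂ) :
    Bc (Pi.single (Fin.castLE (by omega) b) w : Fin (R + 1) → ℂ) Y = (w * (starRingEnd ℂ) (Y b)).re := by
  unfold Bc
  rw [Finset.sum_eq_single b]
  · simp [xt_single]
  · intro k _ hk
    have : k.val ≠ b.val := fun e => hk (Fin.ext e)
    simp [xt_single, this]
  · simp

lemma Bc_single_right (b : Fin (S + 1)) (w : ℂ) (X : Fin (R + 1) → ℂ) :
    Bc X (Pi.single b w) = (xt X b.val * (starRingEnd ℂ) w).re := by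
  unfold Bc
  rw [Finset.sum_eq_single b]
  · simp
  · intro k _ hk
    simp [hk]
  · simp

abbrev MM (R S : ℕ) := Mil ℝ (2 * R + 1) (2 * S + 1)

noncomputable def Xv (u : Fin n → MM R S) (i : Fin n) : Fin (R + 1) → ℂ := cx (u i).1.1.rep
noncomputable def Yv (u : Fin n → MM R S) (i : Fin n) : Fin (S + 1) → ℂ := cx (u i).1.2.rep

lemma lifts (u0 : Fin n → MM R S) : ∃ (Lx : (Fin n → MM R S) → Fin n → Fin (R + 1) → ℂ)
    (Ly : (Fin n → MM R S) → Fin n → Fin (S + 1) → ℂ), ContinuousAt Lx u0 ∧ ContinuousAt Ly u0 ∧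
    ∀ᶠ u in 𝓝 u0, ∃ c d : Fin n → ℝ, (∀ i, c i ≠ 0) ∧ (∀ i, d i ≠ 0) ∧ (Lx u = fun i => c i • Xv u i) ∧ (Ly u = fun i => d i • Yv u i) := by
  choose L hL hL' using fun i => rep_lift (𝕜 := ℝ) (u0 i).1.1
  choose M hM hM' using fun i => rep_lift (𝕜 := ℝ) (u0 i).1.2
  refine ⟨fun u i => cx (L i (u i).1.1), fun u i => cx (M i (u i).1.2), ?_, ?_, ?_⟩
  · rw [continuousAt_pi]
    intro i
    refine cx_cont.continuousAt.comp (ContinuousAt.comp (f := fun u : Fin n → MM R S => (u i).1.1) (hL i) ?_)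
    exact (continuous_fst.comp (continuous_subtype_val.comp (continuous_apply i))).continuousAt
  · rw [continuousAt_pi]
    intro i
    refine cx_cont.continuousAt.comp (ContinuousAt.comp (f := fun u : Fin n → MM R S => (u i).1.2) (hM i) ?_)
    exact (continuous_snd.comp (continuous_subtype_val.comp (continuous_apply i))).continuousAt
  · have h1 : ∀ᶠ u in 𝓝 u0, ∀ i, ∃ c : ℝ, c ≠ 0 ∧ L i (u i).1.1 = c • (u i).1.1.rep := by
      rw [eventually_all]
      intro i
      have : ContinuousAt (fun u : Fin n → MM R S => (u i).1.1) u0 :=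
        (continuous_fst.comp (continuous_subtype_val.comp (continuous_apply i))).continuousAt
      exact this.eventually (hL' i)
    have h2 : ∀ᶠ u in 𝓝 u0, ∀ i, ∃ c : ℝ, c ≠ 0 ∧ M i (u i).1.2 = c • (u i).1.2.rep := by
      rw [eventually_all]
      intro i
      have : ContinuousAt (fun u : Fin n → MM R S => (u i).1.2) u0 :=
        (continuous_snd.comp (continuous_subtype_val.comp (continuous_apply i))).continuousAt
      exact this.eventually (hM' i)
    filter_upwards [h1, h2] with u g1 g2
    choose c hc hc' using g1
    choose d hd hd' using g2
    exact ⟨c, d, hc, hd, funext fun i => by rw [hc', cx_smul]; rfl, funext fun i => by rw [hd', cx_smul]; rfl⟩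

lemma open_g (g : (Fin n → Fin (R + 1) → ℂ) → (Fin n → Fin (S + 1) → ℂ) → ℝ)
    (hg : Continuous (fun p : (Fin n → Fin (R + 1) → ℂ) × (Fin n → Fin (S + 1) → ℂ) => g p.1 p.2))
    (hom : ∀ (c d : Fin n → ℝ), (∀ i, c i ≠ 0) → (∀ i, d i ≠ 0) → ∀ X Y, ∃ k : ℝ, k ≠ 0 ∧
      g (fun i => c i • X i) (fun i => d i • Y i) = k * g X Y) :
    IsOpen {u : Fin n → MM R S | g (Xv u) (Yv u) ≠ 0} := by
  rw [isOpen_iff_mem_nhds]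
  intro u0 h0
  obtain ⟨Lx, Ly, hx, hy, he⟩ := lifts u0
  have hc : ContinuousAt (fun u => g (Lx u) (Ly u)) u0 :=
    ContinuousAt.comp (f := fun u => (Lx u, Ly u)) hg.continuousAt (hx.prodMk hy)
  have h1 : g (Lx u0) (Ly u0) ≠ 0 := by
    obtain ⟨c, d, hc, hd, e1, e2⟩ := he.self_of_nhds
    rw [e1, e2]
    obtain ⟨k, hk, e⟩ := hom c d hc hd (Xv u0) (Yv u0)
    rw [e]; exact mul_ne_zero hk h0
  filter_upwards [hc.eventually_ne h1, he] with u hu ⟨c, d, hc, hd, e1, e2⟩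
  rw [e1, e2] at hu
  obtain ⟨k, hk, e⟩ := hom c d hc hd (Xv u) (Yv u)
  rw [e] at hu
  exact right_ne_zero_of_mul hu

lemma LC_F (U : Set (Fin n → MM R S)) (F : ℝ → (Fin n → Fin (R + 1) → ℂ) → (Fin n → Fin (S + 1) → ℂ) → Fin (m + 1) → ℂ)
    (hF : Continuous (fun p : ℝ × (Fin n → Fin (R + 1) → ℂ) × (Fin n → Fin (S + 1) → ℂ) => F p.1 p.2.1 p.2.2))
    (hom : ∀ (c d : Fin n → ℝ), (∀ i, c i ≠ 0) → (∀ i, d i ≠ 0) → ∀ t X Y, ∃ k : ℝ, k ≠ 0 ∧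
      F t (fun i => c i • X i) (fun i => d i • Y i) = k • F t X Y) :
    LC (𝕜 := ℝ) (fun z : I × U => rl (F z.1 (Xv z.2.1) (Yv z.2.1))) := by
  rintro ⟨t0, u0⟩
  obtain ⟨Lx, Ly, hx, hy, he⟩ := lifts u0.1
  have hv : ContinuousAt (fun z : I × U => z.2.1) (t0, u0) := (continuous_subtype_val.comp continuous_snd).continuousAt
  refine ⟨fun z => rl (F z.1 (Lx z.2.1) (Ly z.2.1)), ?_, ?_⟩
  · refine rl_cont.continuousAt.comp ?_
    refine ContinuousAt.comp (f := fun z : I × U => ((z.1 : ℝ), Lx z.2.1, Ly z.2.1)) hF.continuousAt ?_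
    refine ContinuousAt.prodMk ?_ (ContinuousAt.prodMk ?_ ?_)
    · exact (continuous_subtype_val.comp continuous_fst).continuousAt
    · exact ContinuousAt.comp (f := fun z : I × U => z.2.1) hx hv
    · exact ContinuousAt.comp (f := fun z : I × U => z.2.1) hy hv
  · filter_upwards [hv.eventually he] with z ⟨c, d, hc, hd, e1, e2⟩
    obtain ⟨k, hk, e⟩ := hom c d hc hd z.1 (Xv z.2.1) (Yv z.2.1)
    refine ⟨k, hk, ?_⟩
    rw [e1, e2, e, rl_smul]

/-- A stage of the homotopy. -/
lemma stage (h : S ≤ R) (U : Set (Fin n → MM R S))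
    (F : ℝ → (Fin n → Fin (R + 1) → ℂ) → (Fin n → Fin (S + 1) → ℂ) → Fin (R + 1) → ℂ)
    (hF : Continuous (fun p : ℝ × (Fin n → Fin (R + 1) → ℂ) × (Fin n → Fin (S + 1) → ℂ) => F p.1 p.2.1 p.2.2))
    (homF : ∀ (c d : Fin n → ℝ), (∀ i, c i ≠ 0) → (∀ i, d i ≠ 0) → ∀ t X Y, ∃ k : ℝ, k ≠ 0 ∧
      F t (fun i => c i • X i) (fun i => d i • Y i) = k • F t X Y)
    (G : ℝ → (Fin n → Fin (R + 1) → ℂ) → (Fin n → Fin (S + 1) → ℂ) → Fin (S + 1) → ℂ)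
    (hG : Continuous (fun p : ℝ × (Fin n → Fin (R + 1) → ℂ) × (Fin n → Fin (S + 1) → ℂ) => G p.1 p.2.1 p.2.2))
    (homG : ∀ (c d : Fin n → ℝ), (∀ i, c i ≠ 0) → (∀ i, d i ≠ 0) → ∀ t X Y, ∃ k : ℝ, k ≠ 0 ∧
      G t (fun i => c i • X i) (fun i => d i • Y i) = k • G t X Y)
    (hF0 : ∀ u ∈ U, ∀ t, F t (Xv u) (Yv u) ≠ 0) (hG0 : ∀ u ∈ U, ∀ t, G t (Xv u) (Yv u) ≠ 0)
    (hB : ∀ u ∈ U, ∀ t, Bc (F t (Xv u) (Yv u)) (G t (Xv u) (Yv u)) = 0) :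
    ∃ f0 f1 : C(U, MM R S), ContinuousMap.Homotopic f0 f1 ∧
      (∀ u, (f0 u).1 = (pj (rl (F 0 (Xv u.1) (Yv u.1))), pj (rl (G 0 (Xv u.1) (Yv u.1))))) ∧
      (∀ u, (f1 u).1 = (pj (rl (F 1 (Xv u.1) (Yv u.1))), pj (rl (G 1 (Xv u.1) (Yv u.1))))) := by
  let H : C(I × U, MM R S) := mkM (𝕜 := ℝ) _ _ (LC_F U F hF homF) (LC_F U G hG homG) (fun z => rl_ne _ (hF0 _ z.2.2 _))
    (fun z => rl_ne _ (hG0 _ z.2.2 _)) (fun z => by rw [Bf_rl h]; exact hB _ z.2.2 _)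
  refine ⟨⟨fun u => H (0, u), by fun_prop⟩, ⟨fun u => H (1, u), by fun_prop⟩, ⟨⟨H, fun u => rfl, fun u => rfl⟩⟩, fun u => rfl, fun u => rfl⟩

end Cplx

end MilnorTC

namespace MilnorTC

set_option linter.all false

open Topology Filter
open scoped unitInterval

section Comb

def eC (R a b : ℕ) : ℕ := 2 * (R - a + b) - (if a < b then 1 else 0)

open Classical in
noncomputable def cC {n : ℕ} (l : Fin n × Bool → ℂ) : ℕ := (Finset.univ.image l).card

open Classical in
lemma comb {n : ℕ} (R : ℕ) (a b a' b' : Fin n → ℕ) (l0 l : Fin n × Bool → ℂ)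
    (ha : ∀ i, a' i ≤ a i) (hb : ∀ i, b i ≤ b' i) (haR : ∀ i, a i ≤ R)
    (h0 : ∀ i, a i = b i → l0 (i, false) = l0 (i, true))
    (hg : ∀ k k' : Fin n × Bool, (if k.2 then b' k.1 = b k.1 else a' k.1 = a k.1) →
      (if k'.2 then b' k'.1 = b k'.1 else a' k'.1 = a k'.1) → l k = l k' → l0 k = l0 k')
    (hD : ∑ i, eC R (a' i) (b' i) + cC l = ∑ i, eC R (a i) (b i) + cC l0) :
    (∀ i, a' i = a i ∧ b' i = b i) ∧ ∀ k k', l k = l k' ↔ l0 k = l0 k' := by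
  set G : Finset (Fin n × Bool) := Finset.univ.filter fun k => (if k.2 then b' k.1 = b k.1 else a' k.1 = a k.1) with hG
  have hgG : ∀ k ∈ G, ∀ k' ∈ G, l k = l k' → l0 k = l0 k' := by
    intro k hk k' hk'
    exact hg k k' (Finset.mem_filter.1 hk).2 (Finset.mem_filter.1 hk').2
  -- general : card image l0 G ≤ card image l G
  have hcard : (G.image l0).card ≤ (G.image l).card := by
    have : G.image l0 ⊆ (G.image l).image (fun z => if h : ∃ k ∈ G, l k = z then l0 h.choose else 0) := by
      intro z hz
      obtain ⟨k, hk, rfl⟩ := Finset.mem_image.1 hz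
      refine Finset.mem_image.2 ⟨l k, Finset.mem_image_of_mem _ hk, ?_⟩
      have hex : ∃ k' ∈ G, l k' = l k := ⟨k, hk, rfl⟩
      rw [dif_pos hex]
      exact hgG _ hex.choose_spec.1 _ hk hex.choose_spec.2
    exact (Finset.card_le_card this).trans Finset.card_image_le
  have hcl : (G.image l0).card ≤ cC l := hcard.trans (Finset.card_le_card (Finset.image_subset_image (Finset.subset_univ _)))
  let p : Fin n × Bool → ℕ := fun k => if l0 k ∈ G.image l0 then 0 else 1
  have hc0 : cC l0 ≤ (G.image l0).card + ∑ i, (p (i, false) + p (i, true)) := by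
    have e1 : Finset.univ.image l0 ⊆ G.image l0 ∪ (Finset.univ.filter fun k => l0 k ∉ G.image l0).image l0 := by
      intro z hz
      obtain ⟨k, hk, rfl⟩ := Finset.mem_image.1 hz
      by_cases h : l0 k ∈ G.image l0
      · exact Finset.mem_union_left _ h
      · exact Finset.mem_union_right _ (Finset.mem_image_of_mem _ (by simpa using h))
    have e2 : ((Finset.univ.filter fun k => l0 k ∉ G.image l0).image l0).card ≤ ∑ k, p k := by
      refine Finset.card_image_le.trans ?_
      rw [Finset.card_filter]
      refine Finset.sum_le_sum fun k _ => ?_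
      simp only [p]
      split_ifs <;> simp
    have e3 : ∑ k, p k = ∑ i, (p (i, false) + p (i, true)) := by
      rw [Fintype.sum_prod_type]
      refine Finset.sum_congr rfl fun i _ => ?_
      rw [Fintype.sum_bool, add_comm]
    rw [← e3]
    exact (Finset.card_le_card e1).trans ((Finset.card_union_le _ _).trans (by omega))
  have hkey : ∀ i, eC R (a i) (b i) + (p (i, false) + p (i, true)) ≤ eC R (a' i) (b' i) ∧
      (eC R (a i) (b i) + (p (i, false) + p (i, true)) = eC R (a' i) (b' i) → a' i = a i ∧ b' i = b i) := by
    intro i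
    have g1 : p (i, false) ≠ 0 → a' i ≠ a i := by
      intro h e
      apply h
      simp only [p]
      rw [if_pos]
      exact Finset.mem_image_of_mem _ (by simp [hG, e])
    have g2 : p (i, true) ≠ 0 → b' i ≠ b i := by
      intro h e
      apply h
      simp only [p]
      rw [if_pos]
      exact Finset.mem_image_of_mem _ (by simp [hG, e])
    have g3 : a i = b i → p (i, false) = p (i, true) := by
      intro e
      simp only [p, h0 i e]
    have g4 : p (i, false) ≤ 1 := by simp only [p]; split_ifs <;> simp
    have g5 : p (i, true) ≤ 1 := by simp only [p]; split_ifs <;> simp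
    have h1 := ha i
    have h2 := hb i
    have h3 := haR i
    unfold eC
    generalize p (i, false) = x at *
    generalize p (i, true) = y at *
    split_ifs <;> constructor <;> omega
  have hs : ∑ i, (eC R (a i) (b i) + (p (i, false) + p (i, true))) = ∑ i, eC R (a' i) (b' i) := by
    apply le_antisymm
    · exact Finset.sum_le_sum fun i _ => (hkey i).1
    · rw [Finset.sum_add_distrib]; omega
  have hall : ∀ i, a' i = a i ∧ b' i = b i := by
    have := (Finset.sum_eq_sum_iff_of_le (fun i _ => (hkey i).1)).1 hs
    exact fun i => (hkey i).2 (this i (Finset.mem_univ i))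
  refine ⟨hall, ?_⟩
  have hgood : ∀ k k', l k = l k' → l0 k = l0 k' := by
    intro k k'
    apply hg
    · split_ifs <;> simp [hall]
    · split_ifs <;> simp [hall]
  have hcc : cC l = cC l0 := by
    have : ∑ i, eC R (a' i) (b' i) = ∑ i, eC R (a i) (b i) := Finset.sum_congr rfl fun i _ => by rw [(hall i).1, (hall i).2]
    omega
  intro k k'
  refine ⟨hgood k k', ?_⟩
  let g : ℂ → ℂ := fun z => if h : ∃ k, l k = z then l0 h.choose else 0
  have hgl : ∀ k, g (l k) = l0 k := by
    intro k
    have hex : ∃ k', l k' = l k := ⟨k, rfl⟩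
    simp only [g]
    rw [dif_pos hex]
    exact hgood _ _ hex.choose_spec
  have him : (Finset.univ.image l).image g = Finset.univ.image l0 := by
    rw [Finset.image_image]
    congr 1
    funext k
    exact hgl k
  have hinj : Set.InjOn g (Finset.univ.image l : Finset ℂ) := by
    apply Finset.card_image_iff.1
    rw [him]
    exact hcc.symm
  intro e
  apply hinj
  · simp
  · simp
  · rw [hgl, hgl, e]

open Classical in
lemma comb_lt {n : ℕ} (R S : ℕ) (hn : 0 < n) (a b : Fin n → ℕ) (l0 : Fin n × Bool → ℂ)
    (haR : ∀ i, a i ≤ R) (hbS : ∀ i, b i ≤ S)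
    (h0 : ∀ i, a i = b i → l0 (i, false) = l0 (i, true)) :
    1 ≤ cC l0 ∧ ∑ i, eC R (a i) (b i) + cC l0 ≤ n * (2 * R + 2 * S + 1) := by
  constructor
  · exact Finset.card_pos.2 ⟨l0 (⟨0, hn⟩, false), by simp⟩
  · have h1 : Finset.univ.image l0 ⊆ Finset.univ.biUnion fun i : Fin n => ({l0 (i, false), l0 (i, true)} : Finset ℂ) := by
      intro z hz
      obtain ⟨⟨i, c⟩, hk, rfl⟩ := Finset.mem_image.1 hz
      refine Finset.mem_biUnion.2 ⟨i, Finset.mem_univ _, ?_⟩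
      cases c <;> simp
    have h2 : cC l0 ≤ ∑ i : Fin n, ({l0 (i, false), l0 (i, true)} : Finset ℂ).card :=
      (Finset.card_le_card h1).trans Finset.card_biUnion_le
    have h3 : ∀ i : Fin n, eC R (a i) (b i) + ({l0 (i, false), l0 (i, true)} : Finset ℂ).card ≤ 2 * R + 2 * S + 1 := by
      intro i
      have := haR i
      have := hbS i
      by_cases e : a i = b i
      · rw [h0 i e]
        simp [eC]
        omega
      · have : ({l0 (i, false), l0 (i, true)} : Finset ℂ).card ≤ 2 := Finset.card_le_two
        unfold eC
        split_ifs <;> omega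
    have h4 := Finset.sum_le_sum (s := Finset.univ) fun i _ => h3 i
    rw [Finset.sum_add_distrib] at h4
    simp only [Finset.sum_const, Finset.card_univ, Fintype.card_fin, smul_eq_mul] at h4
    omega

end Comb

end MilnorTC

namespace MilnorTC

set_option linter.all false

open Topology Filter
open scoped unitInterval

section Odd

variable {m R S n : ℕ}

noncomputable def ww (a : Fin n → Fin (R + 1)) (b : Fin n → Fin (S + 1)) (X : Fin n → Fin (R + 1) → ℂ)
    (Y : Fin n → Fin (S + 1) → ℂ) (k : Fin n × Bool) : ℂ :=
  if k.2 then Complex.I * Y k.1 (b k.1) else X k.1 (a k.1)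

lemma ww_smul (a : Fin n → Fin (R + 1)) (b : Fin n → Fin (S + 1)) (X : Fin n → Fin (R + 1) → ℂ)
    (Y : Fin n → Fin (S + 1) → ℂ) (c d : Fin n → ℝ) (k : Fin n × Bool) :
    ww a b (fun i => c i • X i) (fun i => d i • Y i) k = ((if k.2 then d k.1 else c k.1 : ℝ) : ℂ) * ww a b X Y k := by
  unfold ww
  split_ifs <;> simp
  ring

lemma ww_cont (a : Fin n → Fin (R + 1)) (b : Fin n → Fin (S + 1)) (k : Fin n × Bool) :
    Continuous (fun p : (Fin n → Fin (R + 1) → ℂ) × (Fin n → Fin (S + 1) → ℂ) => ww a b p.1 p.2 k) := by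
  unfold ww
  split_ifs <;> fun_prop

lemma prod_scale (x y : ℝ) (z w : ℂ) : ((x : ℂ) * z) * (starRingEnd ℂ) ((y : ℂ) * w) = ((x * y : ℝ) : ℂ) * (z * (starRingEnd ℂ) w) := by
  simp only [map_mul, Complex.conj_ofReal]; push_cast; ring

lemma open_im (a : Fin n → Fin (R + 1)) (b : Fin n → Fin (S + 1)) (k l : Fin n × Bool) :
    IsOpen {u : Fin n → MM R S | (ww a b (Xv u) (Yv u) k * (starRingEnd ℂ) (ww a b (Xv u) (Yv u) l)).im ≠ 0} := by
  refine open_g (fun X Y => (ww a b X Y k * (starRingEnd ℂ) (ww a b X Y l)).im) ?_ ?_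
  · exact Complex.continuous_im.comp ((ww_cont a b k).mul (Complex.continuous_conj.comp (ww_cont a b l)))
  · intro c d hc hd X Y
    refine ⟨(if k.2 then d k.1 else c k.1) * (if l.2 then d l.1 else c l.1), ?_, ?_⟩
    · refine mul_ne_zero ?_ ?_ <;> split_ifs <;> simp [hc, hd]
    · simp only [ww_smul]
      rw [prod_scale, Complex.im_ofReal_mul]

lemma open_re (a : Fin n → Fin (R + 1)) (b : Fin n → Fin (S + 1)) (k l : Fin n × Bool) :
    IsOpen {u : Fin n → MM R S | (ww a b (Xv u) (Yv u) k * (starRingEnd ℂ) (ww a b (Xv u) (Yv u) l)).re ≠ 0} := by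
  refine open_g (fun X Y => (ww a b X Y k * (starRingEnd ℂ) (ww a b X Y l)).re) ?_ ?_
  · exact Complex.continuous_re.comp ((ww_cont a b k).mul (Complex.continuous_conj.comp (ww_cont a b l)))
  · intro c d hc hd X Y
    refine ⟨(if k.2 then d k.1 else c k.1) * (if l.2 then d l.1 else c l.1), ?_, ?_⟩
    · refine mul_ne_zero ?_ ?_ <;> split_ifs <;> simp [hc, hd]
    · simp only [ww_smul]
      rw [prod_scale, Complex.re_ofReal_mul]

lemma re_self (w : ℂ) : (w * (starRingEnd ℂ) w).re ≠ 0 ↔ w ≠ 0 := by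
  rw [Complex.mul_conj, Complex.ofReal_re, ne_eq, Complex.normSq_eq_zero]

/-- the open pieces -/
def Up (i0 : Fin n) (p : (Fin n → Fin (R + 1)) × (Fin n → Fin (S + 1)) × (Fin n × Bool → Prop)) : Set (Fin n → MM R S) :=
  {u | (∀ k, ww p.1 p.2.1 (Xv u) (Yv u) k ≠ 0) ∧
    (∀ i, (p.1 i).val = (p.2.1 i).val →
      (ww p.1 p.2.1 (Xv u) (Yv u) (i, false) * (starRingEnd ℂ) (ww p.1 p.2.1 (Xv u) (Yv u) (i, true))).re ≠ 0) ∧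
    (∀ k, p.2.2 k → (ww p.1 p.2.1 (Xv u) (Yv u) k * (starRingEnd ℂ) (ww p.1 p.2.1 (Xv u) (Yv u) (i0, false))).re ≠ 0) ∧
    (∀ k, ¬ p.2.2 k → (ww p.1 p.2.1 (Xv u) (Yv u) k * (starRingEnd ℂ) (ww p.1 p.2.1 (Xv u) (Yv u) (i0, false))).im ≠ 0)}

lemma Up_open (i0 : Fin n) (p : (Fin n → Fin (R + 1)) × (Fin n → Fin (S + 1)) × (Fin n × Bool → Prop)) :
    IsOpen (Up i0 p) := by
  unfold Up
  simp only [← re_self, Set.setOf_and]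
  refine IsOpen.inter ?_ (IsOpen.inter ?_ (IsOpen.inter ?_ ?_))
  · simp only [Set.setOf_forall]
    exact isOpen_iInter_of_finite fun k => open_re _ _ _ _
  · simp only [Set.setOf_forall]
    exact isOpen_iInter_of_finite fun k => isOpen_iInter_of_finite fun _ => open_re _ _ _ _
  · simp only [Set.setOf_forall]
    exact isOpen_iInter_of_finite fun k => isOpen_iInter_of_finite fun _ => open_re _ _ _ _
  · simp only [Set.setOf_forall]
    exact isOpen_iInter_of_finite fun k => isOpen_iInter_of_finite fun _ => open_im _ _ _ _

lemma pj_rl_smul (c : ℝ) (hc : c ≠ 0) (X : Fin (m + 1) → ℂ) : pj (𝕜 := ℝ) (rl (c • X)) = pj (rl X) := by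
  rw [rl_smul, pj_smul c hc]

/-! stage 1 -/
noncomputable def At (a : Fin (m + 1)) (t : ℝ) (x : Fin (m + 1) → ℂ) : Fin (m + 1) → ℂ :=
  (1 - t) • x + t • (Pi.single a (x a) : Fin (m + 1) → ℂ)

lemma At_smul (a : Fin (m + 1)) (t c : ℝ) (x : Fin (m + 1) → ℂ) : At a t (c • x) = c • At a t x := by
  funext j
  by_cases h : j = a
  · subst h; simp [At]; ring
  · simp [At, h]; ring

lemma At_apply (a : Fin (m + 1)) (t : ℝ) (x : Fin (m + 1) → ℂ) : At a t x a = x a := by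
  simp [At]; ring

lemma At_cont (a : Fin (m + 1)) : Continuous (fun p : ℝ × (Fin (m + 1) → ℂ) => At a p.1 p.2) := by
  refine continuous_pi fun j => ?_
  by_cases h : j = a
  · subst h; simp only [At_apply]; fun_prop
  · simp only [At, Pi.add_apply, Pi.smul_apply, Pi.single_eq_of_ne h]; fun_prop

noncomputable def Fs (a : Fin (R + 1)) (b' : Fin (R + 1)) (b : Fin (S + 1)) (t : ℝ) (x : Fin (R + 1) → ℂ) (y : Fin (S + 1) → ℂ) :
    Fin (R + 1) → ℂ :=
  Complex.normSq (y b) • At a t x + (- Bc (At a t x) (At b t y)) • (Pi.single b' (y b) : Fin (R + 1) → ℂ)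

lemma Fs_smul (a b' : Fin (R + 1)) (b : Fin (S + 1)) (t : ℝ) (x : Fin (R + 1) → ℂ) (y : Fin (S + 1) → ℂ) (c d : ℝ) :
    Fs a b' b t (c • x) (d • y) = (c * d ^ 2) • Fs a b' b t x y := by
  unfold Fs
  rw [At_smul, At_smul, Bc_smul]
  funext j
  by_cases h : j = b'
  · subst h; simp; ring
  · simp [h]; ring

lemma Fs_cont (a b' : Fin (R + 1)) (b : Fin (S + 1)) :
    Continuous (fun p : ℝ × (Fin (R + 1) → ℂ) × (Fin (S + 1) → ℂ) => Fs a b' b p.1 p.2.1 p.2.2) := by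
  unfold Fs
  have h1 : Continuous (fun p : ℝ × (Fin (R + 1) → ℂ) × (Fin (S + 1) → ℂ) => At a p.1 p.2.1) :=
    (At_cont a).comp (continuous_fst.prodMk (continuous_fst.comp continuous_snd))
  have h2 : Continuous (fun p : ℝ × (Fin (R + 1) → ℂ) × (Fin (S + 1) → ℂ) => At b p.1 p.2.2) :=
    (At_cont b).comp (continuous_fst.prodMk (continuous_snd.comp continuous_snd))
  have h3 := Bc_cont.comp (h1.prodMk h2)
  have h4 : Continuous (fun p : ℝ × (Fin (R + 1) → ℂ) × (Fin (S + 1) → ℂ) => Complex.normSq (p.2.2 b)) :=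
    Complex.continuous_normSq.comp (by fun_prop)
  refine (h4.smul h1).add (h3.neg.smul ?_)
  refine continuous_pi fun j => ?_
  by_cases h : j = b'
  · subst h; simp only [Pi.single_eq_same]; fun_prop
  · simp only [Pi.single_eq_of_ne h]; fun_prop

lemma Fs_B (h : S ≤ R) (a : Fin (R + 1)) (b : Fin (S + 1)) (t : ℝ) (x : Fin (R + 1) → ℂ) (y : Fin (S + 1) → ℂ) :
    Bc (Fs a (Fin.castLE (by omega) b) b t x y) (At b t y) = 0 := by
  unfold Fs
  rw [Bc_add_left, Bc_smul_left, Bc_smul_left, Bc_single_left h, At_apply, Complex.mul_conj, Complex.ofReal_re]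
  ring

lemma Fs_ne (a b' : Fin (R + 1)) (b : Fin (S + 1)) (t : ℝ) (x : Fin (R + 1) → ℂ) (y : Fin (S + 1) → ℂ)
    (hx : x a ≠ 0) (hy : y b ≠ 0) (hab : a = b' → (x a * (starRingEnd ℂ) (y b)).im ≠ 0) : Fs a b' b t x y ≠ 0 := by
  intro e
  have e1 := congrFun e a
  by_cases h : a = b'
  · apply hab h
    subst h
    simp only [Fs, Pi.add_apply, Pi.smul_apply, At_apply, Pi.single_eq_same, Pi.zero_apply, Complex.real_smul] at e1
    have e2 := congrArg (fun z => (z * (starRingEnd ℂ) (y b)).im) e1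
    simp only [add_mul, mul_assoc, Complex.add_im, Complex.im_ofReal_mul, Complex.mul_conj, Complex.ofReal_im, mul_zero, add_zero, zero_mul, Complex.zero_im] at e2
    have h3 : Complex.normSq (y b) ≠ 0 := fun h => hy (Complex.normSq_eq_zero.1 h)
    rcases mul_eq_zero.1 e2 with h | h
    · exact absurd h h3
    · exact h
  · simp only [Fs, Pi.add_apply, Pi.smul_apply, At_apply, Pi.single_eq_of_ne h, Pi.zero_apply, smul_zero, add_zero, Complex.real_smul] at e1
    simp [hx, hy] at e1

lemma At_ne (b : Fin (m + 1)) (t : ℝ) (y : Fin (m + 1) → ℂ) (hy : y b ≠ 0) : At b t y ≠ 0 := by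
  intro e
  have := congrFun e b
  rw [At_apply] at this
  exact hy this

lemma Fs_zero (a b' : Fin (R + 1)) (b : Fin (S + 1)) (x : Fin (R + 1) → ℂ) (y : Fin (S + 1) → ℂ) (hB : Bc x y = 0) :
    Fs a b' b 0 x y = Complex.normSq (y b) • x := by
  have e1 : At a 0 x = x := by simp [At]
  have e2 : At b 0 y = y := by simp [At]
  simp [Fs, e1, e2, hB]

lemma At_one (a : Fin (m + 1)) (x : Fin (m + 1) → ℂ) : At a 1 x = Pi.single a (x a) := by simp [At]

lemma Fs_one_ne (a b' : Fin (R + 1)) (b : Fin (S + 1)) (x : Fin (R + 1) → ℂ) (y : Fin (S + 1) → ℂ) (hab : a.val ≠ b.val) :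
    Fs a b' b 1 x y = Complex.normSq (y b) • (Pi.single a (x a) : Fin (R + 1) → ℂ) := by
  simp [Fs, At_one, Bc_single_right, xt_single, Ne.symm hab]

lemma Fs_one_eq (a : Fin (R + 1)) (b : Fin (S + 1)) (x : Fin (R + 1) → ℂ) (y : Fin (S + 1) → ℂ) (hab : a.val = b.val) :
    Fs a a b 1 x y = (x a * (starRingEnd ℂ) (y b)).im • (Pi.single a (Complex.I * y b) : Fin (R + 1) → ℂ) := by
  funext j
  by_cases h : j = a
  · subst h
    simp only [Fs, At_one, Bc_single_right, xt_single, hab, if_true, Pi.add_apply, Pi.smul_apply, Pi.single_eq_same]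
    apply Complex.ext <;> simp [Complex.normSq_apply] <;> ring
  · simp [Fs, At_one, h]

/-! stage 2 -/
open Classical in
noncomputable def pw (β : Prop) (t : ℝ) (z w : ℂ) : ℂ :=
  (((1 - t) * Complex.normSq z : ℝ) : ℂ) * w +
    ((t * (if β then (w * (starRingEnd ℂ) z).re else (w * (starRingEnd ℂ) z).im) : ℝ) : ℂ) * z

lemma pw_smul (β : Prop) (t c d : ℝ) (z w : ℂ) : pw β t (c * z) (d * w) = ((c ^ 2 * d : ℝ) : ℂ) * pw β t z w := by
  unfold pw
  rw [prod_scale, Complex.re_ofReal_mul, Complex.im_ofReal_mul, Complex.normSq_mul, Complex.normSq_ofReal]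
  split_ifs <;> push_cast <;> ring

lemma pw_cont (β : Prop) : Continuous (fun p : ℝ × ℂ × ℂ => pw β p.1 p.2.1 p.2.2) := by
  unfold pw
  have h1 : Continuous (fun p : ℝ × ℂ × ℂ => p.2.2 * (starRingEnd ℂ) p.2.1) :=
    (continuous_snd.comp continuous_snd).mul (Complex.continuous_conj.comp (continuous_fst.comp continuous_snd))
  have h2 : Continuous (fun p : ℝ × ℂ × ℂ => Complex.normSq p.2.1) := Complex.continuous_normSq.comp (by fun_prop)
  split_ifs
  · have h3 := Complex.continuous_re.comp h1
    refine ((Complex.continuous_ofReal.comp ((continuous_const.sub continuous_fst).mul h2)).mul (by fun_prop)).add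
      ((Complex.continuous_ofReal.comp (continuous_fst.mul h3)).mul (by fun_prop))
  · have h3 := Complex.continuous_im.comp h1
    refine ((Complex.continuous_ofReal.comp ((continuous_const.sub continuous_fst).mul h2)).mul (by fun_prop)).add
      ((Complex.continuous_ofReal.comp (continuous_fst.mul h3)).mul (by fun_prop))

lemma pw_ne (β : Prop) (t : ℝ) (z w : ℂ) (hz : z ≠ 0) (h1 : β → (w * (starRingEnd ℂ) z).re ≠ 0)
    (h2 : ¬ β → (w * (starRingEnd ℂ) z).im ≠ 0) : pw β t z w ≠ 0 := by
  intro e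
  have hN : Complex.normSq z ≠ 0 := fun h => hz (Complex.normSq_eq_zero.1 h)
  have e1 : pw β t z w * (starRingEnd ℂ) z = 0 := by rw [e, zero_mul]
  unfold pw at e1
  rw [add_mul, mul_assoc, mul_assoc, Complex.mul_conj] at e1
  generalize w * (starRingEnd ℂ) z = v at *
  have er := congrArg Complex.re e1
  have ei := congrArg Complex.im e1
  rw [Complex.add_re, Complex.re_ofReal_mul, Complex.re_ofReal_mul, Complex.ofReal_re, Complex.zero_re] at er
  rw [Complex.add_im, Complex.im_ofReal_mul, Complex.im_ofReal_mul, Complex.ofReal_im, Complex.zero_im] at ei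
  by_cases hβ : β
  · apply h1 hβ
    rw [if_pos hβ] at er
    have : Complex.normSq z * v.re = 0 := by linarith
    exact (mul_eq_zero.1 this).resolve_left hN
  · have h3 := h2 hβ
    rw [if_neg hβ] at er
    have : (1 - t) = 0 := by
      by_contra h
      exact (mul_ne_zero (mul_ne_zero h hN) h3) (by linarith)
    rw [this] at er
    have ht : t = 1 := by linarith
    rw [ht] at er
    exact mul_ne_zero h3 hN (by linarith)

lemma pw_zero (β : Prop) (z w : ℂ) : pw β 0 z w = (Complex.normSq z : ℂ) * w := by simp [pw]

lemma pw_one (β : Prop) (z w : ℂ) (h1 : β → (w * (starRingEnd ℂ) z).re ≠ 0)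
    (h2 : ¬ β → (w * (starRingEnd ℂ) z).im ≠ 0) : ∃ c : ℝ, c ≠ 0 ∧ pw β 1 z w = (c : ℂ) * z := by
  unfold pw
  split_ifs with h
  · exact ⟨_, h1 h, by simp⟩
  · exact ⟨_, h2 h, by simp⟩

/-! stage 3 -/
noncomputable def sgm (a : Fin (m + 1)) (t : ℝ) (z : ℂ) : Fin (m + 1) → ℂ := (1 - t) • (Pi.single a z : Fin (m + 1) → ℂ) + t • (Pi.single 0 z : Fin (m + 1) → ℂ)

lemma sgm_ne (a : Fin (m + 1)) (t : ℝ) (z : ℂ) (hz : z ≠ 0) : sgm a t z ≠ 0 := by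
  intro e
  by_cases h : a = 0
  · subst h
    have := congrFun e 0
    simp [sgm] at this
    apply hz
    linear_combination this
  · have h1 := congrFun e a
    have h2 := congrFun e 0
    simp [sgm, h, hz] at h1
    simp [sgm, Ne.symm h, hz] at h2
    rw [h2] at h1; simp at h1

lemma sgm_xt (a : Fin (m + 1)) (t : ℝ) (z : ℂ) (k : ℕ) : ∃ c : ℝ, xt (sgm a t z) k = (c : ℂ) * z := by
  unfold sgm
  rw [xt_add, xt_smul, xt_smul, xt_single, xt_single]
  refine ⟨(1 - t) * (if k = a.val then 1 else 0) + t * (if k = (0 : Fin (m + 1)).val then 1 else 0), ?_⟩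
  split_ifs <;> push_cast <;> ring

lemma sgm_B (a : Fin (R + 1)) (b : Fin (S + 1)) (t : ℝ) (z : ℂ) : Bc (sgm a t z) (sgm b t (-Complex.I * z)) = 0 := by
  unfold Bc
  refine Finset.sum_eq_zero fun k _ => ?_
  obtain ⟨c, hc⟩ := sgm_xt a t z k.val
  obtain ⟨d, hd⟩ := sgm_xt b t (-Complex.I * z) k.val
  rw [xt_val] at hd
  rw [hc, hd, prod_scale, Complex.re_ofReal_mul]
  simp
  right; ring

lemma single_cont {T : Type*} [TopologicalSpace T] (a : Fin (m + 1)) (f : T → ℂ) (hf : Continuous f) :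
    Continuous (fun p => (Pi.single a (f p) : Fin (m + 1) → ℂ)) := by
  refine continuous_pi fun j => ?_
  by_cases h : j = a
  · subst h; simp only [Pi.single_eq_same]; exact hf
  · simp only [Pi.single_eq_of_ne h]; exact continuous_const

lemma single_mul (a : Fin (m + 1)) (c : ℝ) (z : ℂ) : (Pi.single a ((c : ℂ) * z) : Fin (m + 1) → ℂ) = c • (Pi.single a z : Fin (m + 1) → ℂ) := by
  funext j
  by_cases h : j = a
  · subst h; simp
  · simp [h]

lemma sgm_smul (a : Fin (m + 1)) (t c : ℝ) (z : ℂ) : sgm a t ((c : ℂ) * z) = c • sgm a t z := by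
  unfold sgm
  rw [single_mul, single_mul, smul_add, smul_comm c, smul_comm c]

lemma single_ne (a : Fin (m + 1)) (z : ℂ) (hz : z ≠ 0) : (Pi.single a z : Fin (m + 1) → ℂ) ≠ 0 := by
  intro e
  have := congrFun e a
  simp [hz] at this

end Odd

end MilnorTC

namespace MilnorTC

set_option linter.all false

open Topology Filter
open scoped unitInterval

section Odd2

variable {m R S n : ℕ}

lemma Bc_XY (h : S ≤ R) (u : Fin n → MM R S) (i : Fin n) : Bc (Xv u i) (Yv u i) = 0 := by
  rw [← Bf_rl h, Xv, Yv, rl_cx, rl_cx]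
  exact (u i).2

lemma rl_Xv (u : Fin n → MM R S) (i : Fin n) : pj (𝕜 := ℝ) (rl (Xv u i)) = (u i).1.1 := by
  rw [Xv, rl_cx, pj_rep]

lemma rl_Yv (u : Fin n → MM R S) (i : Fin n) : pj (𝕜 := ℝ) (rl (Yv u i)) = (u i).1.2 := by
  rw [Yv, rl_cx, pj_rep]

lemma Up_sec (h : S ≤ R) (hn : 2 ≤ n) (i0 : Fin n)
    (p : (Fin n → Fin (R + 1)) × (Fin n → Fin (S + 1)) × (Fin n × Bool → Prop)) : HasSec (Up i0 p) := by
  classical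
  obtain ⟨a, b, β⟩ := p
  set U := Up (R := R) (S := S) i0 (a, b, β) with hU
  have u1 : ∀ u ∈ U, ∀ k, ww a b (Xv u) (Yv u) k ≠ 0 := fun u hu => hu.1
  have u2 : ∀ u ∈ U, ∀ i, (a i).val = (b i).val →
      (ww a b (Xv u) (Yv u) (i, false) * (starRingEnd ℂ) (ww a b (Xv u) (Yv u) (i, true))).re ≠ 0 := fun u hu => hu.2.1
  have u3 : ∀ u ∈ U, ∀ k, β k → (ww a b (Xv u) (Yv u) k * (starRingEnd ℂ) (ww a b (Xv u) (Yv u) (i0, false))).re ≠ 0 :=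
    fun u hu => hu.2.2.1
  have u4 : ∀ u ∈ U, ∀ k, ¬ β k → (ww a b (Xv u) (Yv u) k * (starRingEnd ℂ) (ww a b (Xv u) (Yv u) (i0, false))).im ≠ 0 :=
    fun u hu => hu.2.2.2
  have ux : ∀ u ∈ U, ∀ i, Xv u i (a i) ≠ 0 := by
    intro u hu i; simpa [ww] using u1 u hu (i, false)
  have uy : ∀ u ∈ U, ∀ i, Yv u i (b i) ≠ 0 := by
    intro u hu i; simpa [ww] using u1 u hu (i, true)
  have uxy : ∀ u ∈ U, ∀ i, (a i).val = (b i).val → (Xv u i (a i) * (starRingEnd ℂ) (Yv u i (b i))).im ≠ 0 := by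
    intro u hu i hi e
    apply u2 u hu i hi
    simp [ww] at e ⊢
    linarith
  have uz : ∀ u ∈ U, Xv u i0 (a i0) ≠ 0 := fun u hu => ux u hu i0
  have hz : ∀ u, ww a b (Xv u) (Yv u) (i0, false) = Xv u i0 (a i0) := by intro u; simp [ww]
  simp only [hz] at u3 u4
  -- stage 1
  have s1 := fun i => stage h U (fun t X Y => Fs (a i) (Fin.castLE (by omega) (b i)) (b i) t (X i) (Y i))
    ((Fs_cont (a i) (Fin.castLE (by omega) (b i)) (b i)).comp (f := fun p : ℝ × (Fin n → Fin (R + 1) → ℂ) × (Fin n → Fin (S + 1) → ℂ) => (p.1, p.2.1 i, p.2.2 i)) (by fun_prop))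
    (fun c d hc hd t X Y => ⟨c i * d i ^ 2, mul_ne_zero (hc i) (pow_ne_zero 2 (hd i)), Fs_smul _ _ _ _ _ _ _ _⟩)
    (fun t X Y => At (b i) t (Y i))
    ((At_cont (b i)).comp (f := fun p : ℝ × (Fin n → Fin (R + 1) → ℂ) × (Fin n → Fin (S + 1) → ℂ) => (p.1, p.2.2 i)) (by fun_prop))
    (fun c d hc hd t X Y => ⟨d i, hd i, At_smul _ _ _ _⟩)
    (fun u hu t => Fs_ne _ _ _ _ _ _ (ux u hu i) (uy u hu i) (fun e => uxy u hu i (by rw [e]; rfl)))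
    (fun u hu t => At_ne _ _ _ (uy u hu i))
    (fun u hu t => Fs_B h _ _ _ _ _)
  choose f0 f1 hf f0v f1v using s1
  -- stage 2
  have hwz : Continuous (fun p : ℝ × (Fin n → Fin (R + 1) → ℂ) × (Fin n → Fin (S + 1) → ℂ) => p.2.1 i0 (a i0)) := by fun_prop
  have hpc : ∀ k, Continuous (fun p : ℝ × (Fin n → Fin (R + 1) → ℂ) × (Fin n → Fin (S + 1) → ℂ) =>
      pw (β k) p.1 (p.2.1 i0 (a i0)) (ww a b p.2.1 p.2.2 k)) := fun k =>
    (pw_cont (β k)).comp (continuous_fst.prodMk (hwz.prodMk ((ww_cont a b k).comp continuous_snd)))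
  have hps : ∀ k, ∀ (c d : Fin n → ℝ), (∀ i, c i ≠ 0) → (∀ i, d i ≠ 0) → ∀ (t : ℝ) (X : Fin n → Fin (R + 1) → ℂ) (Y : Fin n → Fin (S + 1) → ℂ),
      ∃ q : ℝ, q ≠ 0 ∧ pw (β k) t (c i0 • X i0 (a i0)) (ww a b (fun i => c i • X i) (fun i => d i • Y i) k) =
        (q : ℂ) * pw (β k) t (X i0 (a i0)) (ww a b X Y k) := by
    intro k c d hc hd t X Y
    rw [ww_smul, Complex.real_smul, pw_smul]
    refine ⟨_, ?_, rfl⟩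
    refine mul_ne_zero (pow_ne_zero 2 (hc i0)) ?_
    split_ifs <;> simp [hc, hd]
  have hpn : ∀ k, ∀ u ∈ U, ∀ t, pw (β k) t (Xv u i0 (a i0)) (ww a b (Xv u) (Yv u) k) ≠ 0 := fun k u hu t =>
    pw_ne _ _ _ _ (uz u hu) (u3 u hu k) (u4 u hu k)
  let κ : Fin n → Fin n × Bool := fun i => (i, decide ((a i).val = (b i).val))
  have s2 := fun i => stage h U (fun t X Y => Pi.single (a i) (pw (β (κ i)) t (X i0 (a i0)) (ww a b X Y (κ i))))
    (single_cont _ _ (hpc (κ i)))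
    (fun c d hc hd t X Y => by
      obtain ⟨q, hq, e⟩ := hps (κ i) c d hc hd t X Y
      refine ⟨q, hq, ?_⟩
      rw [← single_mul, ← e]
      rfl)
    (fun t X Y => Pi.single (b i) (-Complex.I * pw (β (i, true)) t (X i0 (a i0)) (ww a b X Y (i, true))))
    (single_cont _ _ (continuous_const.mul (hpc (i, true))))
    (fun c d hc hd t X Y => by
      obtain ⟨q, hq, e⟩ := hps (i, true) c d hc hd t X Y
      refine ⟨q, hq, ?_⟩
      rw [← single_mul, mul_left_comm, ← e]
      rfl)
    (fun u hu t => single_ne _ _ (hpn _ u hu t))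
    (fun u hu t => single_ne _ _ (mul_ne_zero (by simp) (hpn _ u hu t)))
    (fun u hu t => by
      rw [Bc_single_right, xt_single]
      by_cases e : (b i).val = (a i).val
      · have ek : κ i = (i, true) := by simp [κ, e]
        rw [if_pos e, ek]
        generalize pw (β (i, true)) t (Xv u i0 (a i0)) (ww a b (Xv u) (Yv u) (i, true)) = v
        simp
        ring
      · rw [if_neg e]; simp)
  choose g0 g1 hg g0v g1v using s2
  -- stage 3
  have s3 := fun i => stage h U (fun t X Y => sgm (a i) t (X i0 (a i0)))
    (by
      unfold sgm
      exact ((continuous_const.sub continuous_fst).smul (single_cont _ _ hwz)).add (continuous_fst.smul (single_cont _ _ hwz)))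
    (fun c d hc hd t X Y => ⟨c i0, hc i0, by rw [← sgm_smul]; rfl⟩)
    (fun t X Y => sgm (b i) t (-Complex.I * X i0 (a i0)))
    (by
      unfold sgm
      exact ((continuous_const.sub continuous_fst).smul (single_cont _ _ (continuous_const.mul hwz))).add
        (continuous_fst.smul (single_cont _ _ (continuous_const.mul hwz))))
    (fun c d hc hd t X Y => ⟨c i0, hc i0, by rw [← sgm_smul, mul_left_comm]; rfl⟩)
    (fun u hu t => sgm_ne _ _ _ (uz u hu))
    (fun u hu t => sgm_ne _ _ _ (mul_ne_zero (by simp) (uz u hu)))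
    (fun u hu t => sgm_B _ _ _ _)
  choose k0 k1 hk k0v k1v using s3
  refine hasSec_of_homotopic hn _ (k1 i0) ?_
  intro i
  have e1 : (⟨fun u => u.1 i, (continuous_apply i).comp continuous_subtype_val⟩ : C(U, MM R S)) = f0 i := by
    apply ContinuousMap.ext
    intro u
    apply Subtype.ext
    rw [f0v]
    have hN : Complex.normSq (Yv u.1 i (b i)) ≠ 0 := fun h => uy u.1 u.2 i (Complex.normSq_eq_zero.1 h)
    rw [Fs_zero _ _ _ _ _ (Bc_XY h _ _), pj_rl_smul _ hN, rl_Xv]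
    have : At (b i) 0 (Yv u.1 i) = Yv u.1 i := by simp [At]
    rw [this, rl_Yv]
    rfl
  have e2 : f1 i = g0 i := by
    apply ContinuousMap.ext
    intro u
    apply Subtype.ext
    rw [f1v, g0v]
    have hNy : Complex.normSq (Yv u.1 i (b i)) ≠ 0 := fun h => uy u.1 u.2 i (Complex.normSq_eq_zero.1 h)
    have hNz : Complex.normSq (Xv u.1 i0 (a i0)) ≠ 0 := fun h => uz u.1 u.2 (Complex.normSq_eq_zero.1 h)
    rw [pw_zero, pw_zero, single_mul, mul_left_comm, single_mul, pj_rl_smul _ hNz, pj_rl_smul _ hNz, At_one]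
    have ey : -Complex.I * ww a b (Xv u.1) (Yv u.1) (i, true) = Yv u.1 i (b i) := by
      simp only [ww, if_true]
      rw [← mul_assoc]; simp
    rw [ey]
    by_cases e : (a i).val = (b i).val
    · have ek : κ i = (i, true) := by simp [κ, e]
      have ec : Fin.castLE (by omega) (b i) = a i := Fin.ext e.symm
      rw [ek, ec, Fs_one_eq _ _ _ _ e, pj_rl_smul _ (uxy u.1 u.2 i e)]
      rfl
    · have ek : κ i = (i, false) := by simp [κ, e]
      rw [ek, Fs_one_ne _ _ _ _ _ e, pj_rl_smul _ hNy]
      rfl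
  have e3 : g1 i = k0 i := by
    apply ContinuousMap.ext
    intro u
    apply Subtype.ext
    rw [g1v, k0v]
    obtain ⟨q, hq, eq⟩ := pw_one _ _ _ (u3 u.1 u.2 (κ i)) (u4 u.1 u.2 (κ i))
    obtain ⟨q', hq', eq'⟩ := pw_one _ _ _ (u3 u.1 u.2 (i, true)) (u4 u.1 u.2 (i, true))
    rw [eq, eq', mul_left_comm, single_mul, single_mul, pj_rl_smul _ hq, pj_rl_smul _ hq']
    simp [sgm]
  have e4 : k1 i = k1 i0 := by
    apply ContinuousMap.ext
    intro u
    apply Subtype.ext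
    rw [k1v, k1v]
    simp [sgm]
  rw [e1]
  have t1 := hf i
  rw [e2] at t1
  have t2 := hg i
  rw [e3] at t2
  have t3 := hk i
  rw [e4] at t3
  exact (t1.trans t2).trans t3

end Odd2

end MilnorTC

namespace MilnorTC

set_option linter.all false

open Topology Filter
open scoped unitInterval

section Odd3

variable {m R S n : ℕ}

lemma nz_nonempty (X : Fin (m + 1) → ℂ) (h : X ≠ 0) : (Finset.univ.filter fun i => X i ≠ 0).Nonempty := by
  by_contra h'
  apply h
  funext i
  by_contra hi
  exact h' ⟨i, by simpa using hi⟩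

noncomputable def lov (X : Fin (m + 1) → ℂ) : Fin (m + 1) :=
  open Classical in if h : X ≠ 0 then (Finset.univ.filter fun i => X i ≠ 0).min' (nz_nonempty X h) else 0

noncomputable def hiv (X : Fin (m + 1) → ℂ) : Fin (m + 1) :=
  open Classical in if h : X ≠ 0 then (Finset.univ.filter fun i => X i ≠ 0).max' (nz_nonempty X h) else 0

lemma lov_ne (X : Fin (m + 1) → ℂ) (h : X ≠ 0) : X (lov X) ≠ 0 := by
  rw [lov, dif_pos h]
  exact (Finset.mem_filter.1 (Finset.min'_mem (Finset.univ.filter fun i => X i ≠ 0) (nz_nonempty X h))).2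

lemma hiv_ne (X : Fin (m + 1) → ℂ) (h : X ≠ 0) : X (hiv X) ≠ 0 := by
  rw [hiv, dif_pos h]
  exact (Finset.mem_filter.1 (Finset.max'_mem (Finset.univ.filter fun i => X i ≠ 0) (nz_nonempty X h))).2

lemma lov_le (X : Fin (m + 1) → ℂ) (i) (h : X i ≠ 0) : lov X ≤ i := by
  have h0 : X ≠ 0 := fun e => h (by rw [e]; rfl)
  rw [lov, dif_pos h0]
  exact Finset.min'_le _ _ (by simpa using h)

lemma le_hiv (X : Fin (m + 1) → ℂ) (i) (h : X i ≠ 0) : i ≤ hiv X := by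
  have h0 : X ≠ 0 := fun e => h (by rw [e]; rfl)
  rw [hiv, dif_pos h0]
  exact Finset.le_max' _ _ (by simpa using h)

lemma rl_zero : rl (0 : Fin (m + 1) → ℂ) = 0 := by
  have := rl_smul (m := m) 0 0
  simpa using this

lemma Xv_ne (u : Fin n → MM R S) (i : Fin n) : Xv u i ≠ 0 := by
  intro e
  have h1 : rl (Xv u i) = (u i).1.1.rep := by rw [Xv, rl_cx]
  rw [e, rl_zero] at h1
  exact (u i).1.1.rep_nonzero h1.symm

lemma Yv_ne (u : Fin n → MM R S) (i : Fin n) : Yv u i ≠ 0 := by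
  intro e
  have h1 : rl (Yv u i) = (u i).1.2.rep := by rw [Yv, rl_cx]
  rw [e, rl_zero] at h1
  exact (u i).1.2.rep_nonzero h1.symm

noncomputable def aM (u : Fin n → MM R S) (i : Fin n) : Fin (R + 1) := lov (Xv u i)
noncomputable def bM (u : Fin n → MM R S) (i : Fin n) : Fin (S + 1) := hiv (Yv u i)
noncomputable def wM (u : Fin n → MM R S) (k : Fin n × Bool) : ℂ := ww (aM u) (bM u) (Xv u) (Yv u) k
noncomputable def lM (u : Fin n → MM R S) (k : Fin n × Bool) : ℂ := wM u k / (starRingEnd ℂ) (wM u k)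

lemma wM_ne (u : Fin n → MM R S) (k : Fin n × Bool) : wM u k ≠ 0 := by
  unfold wM ww
  split_ifs
  · exact mul_ne_zero Complex.I_ne_zero (hiv_ne _ (Yv_ne u _))
  · exact lov_ne _ (Xv_ne u _)

lemma line_eq (w v : ℂ) (hw : w ≠ 0) (hv : v ≠ 0) :
    w / (starRingEnd ℂ) w = v / (starRingEnd ℂ) v ↔ (w * (starRingEnd ℂ) v).im = 0 := by
  rw [div_eq_div_iff (by simpa using hw) (by simpa using hv), ← Complex.conj_eq_iff_im]
  simp only [map_mul, Complex.conj_conj]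
  rw [mul_comm v, eq_comm]

lemma lM_eq (u : Fin n → MM R S) (k k' : Fin n × Bool) :
    lM u k = lM u k' ↔ (wM u k * (starRingEnd ℂ) (wM u k')).im = 0 :=
  line_eq _ _ (wM_ne _ _) (wM_ne _ _)

lemma re_zero (h : S ≤ R) (u : Fin n → MM R S) (i : Fin n) (e : (aM u i).val = (bM u i).val) :
    (Xv u i (aM u i) * (starRingEnd ℂ) (Yv u i (bM u i))).re = 0 := by
  have hB := Bc_XY h u i
  unfold Bc at hB
  rw [Finset.sum_eq_single (bM u i)] at hB
  · rw [← e, xt_val] at hB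
    exact hB
  · intro k _ hk
    by_cases hy : Yv u i k = 0
    · simp [hy]
    · have h1 : k ≤ bM u i := le_hiv _ _ hy
      have h2 : k.val < (aM u i).val := by
        have : k.val ≤ (bM u i).val := h1
        have : k.val ≠ (bM u i).val := fun e => hk (Fin.ext e)
        omega
      have h3 : xt (Xv u i) k.val = 0 := by
        have hk : k.val < R + 1 := by omega
        rw [xt, dif_pos hk]
        by_contra hx
        have : (aM u i).val ≤ k.val := lov_le _ _ hx
        omega
      simp [h3]
  · simp

lemma lM_ab (h : S ≤ R) (u : Fin n → MM R S) (i : Fin n) (e : (aM u i).val = (bM u i).val) :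
    lM u (i, false) = lM u (i, true) := by
  rw [lM_eq]
  have := re_zero h u i e
  simp [wM, ww] at this ⊢
  linarith

theorem odd_mem (h : S ≤ R) (hn : 2 ≤ n) : n * (2 * R + 2 * S + 1) ∈ TCset (MM R S) n := by
  classical
  let i0 : Fin n := ⟨0, by omega⟩
  have hlt := fun u : Fin n → MM R S => comb_lt R S (by omega : 0 < n) (fun i => (aM u i).val) (fun i => (bM u i).val) (lM u)
    (fun i => by omega) (fun i => by omega) (fun i e => lM_ab h u i e)
  refine stratify (n * (2 * R + 2 * S + 1)) (by positivity)
    (fun u => ∑ i, eC R (aM u i).val (bM u i).val + cC (lM u) - 1) ?_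
    (fun u => (aM u, bM u, fun k => lM u k = lM u (i0, false))) ?_ (fun p => Up i0 p) ?_ ?_ ?_
  · intro u
    have := hlt u
    omega
  · intro u0
    have E1 : ∀ᶠ u in 𝓝 u0, ∀ k, ww (aM u0) (bM u0) (Xv u) (Yv u) k ≠ 0 := by
      rw [eventually_all]
      intro k
      simp only [← re_self]
      exact (open_re (aM u0) (bM u0) k k).mem_nhds ((re_self _).2 (wM_ne u0 k))
    have E2 : ∀ᶠ u in 𝓝 u0, ∀ k k', lM u0 k ≠ lM u0 k' →
        (ww (aM u0) (bM u0) (Xv u) (Yv u) k * (starRingEnd ℂ) (ww (aM u0) (bM u0) (Xv u) (Yv u) k')).im ≠ 0 := by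
      rw [eventually_all]
      intro k
      rw [eventually_all]
      intro k'
      rw [eventually_imp_distrib_left]
      intro hne
      rw [ne_eq, lM_eq] at hne
      exact (open_im (aM u0) (bM u0) k k').mem_nhds hne
    filter_upwards [E1, E2] with u h1 h2 hD
    have hx : ∀ i, aM u i ≤ aM u0 i := fun i => lov_le _ _ (by simpa [ww] using h1 (i, false))
    have hy : ∀ i, bM u0 i ≤ bM u i := fun i => le_hiv _ _ (by simpa [ww] using h1 (i, true))
    have hw : ∀ k : Fin n × Bool, (if k.2 then (bM u k.1).val = (bM u0 k.1).val else (aM u k.1).val = (aM u0 k.1).val) →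
        wM u k = ww (aM u0) (bM u0) (Xv u) (Yv u) k := by
      intro k hk
      unfold wM ww
      split_ifs at hk ⊢ with e
      · rw [Fin.ext hk]
      · rw [Fin.ext hk]
    have hc := comb R (fun i => (aM u0 i).val) (fun i => (bM u0 i).val) (fun i => (aM u i).val) (fun i => (bM u i).val)
      (lM u0) (lM u) hx hy (fun i => by omega) (fun i e => lM_ab h u0 i e) (by
        intro k k' g g' e
        by_contra hne
        apply h2 k k' hne
        rw [← hw k g, ← hw k' g']
        exact (lM_eq _ _ _).1 e) (by
        have a1 := (hlt u).1
        have a2 := (hlt u0).1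
        omega)
    obtain ⟨c1, c2⟩ := hc
    have ea : aM u = aM u0 := funext fun i => Fin.ext (c1 i).1
    have eb : bM u = bM u0 := funext fun i => Fin.ext (c1 i).2
    simp only [ea, eb, c2]
  · intro u
    exact Up_open _ _
  · intro u
    refine ⟨fun k => wM_ne u k, ?_, ?_, ?_⟩
    · intro i e
      have e1 := (lM_eq _ _ _).1 (lM_ab h u i e)
      intro e2
      exact mul_ne_zero (wM_ne u (i, false)) ((map_ne_zero _).2 (wM_ne u (i, true))) (Complex.ext e2 e1)
    · intro k hk e2
      have e1 := (lM_eq _ _ _).1 hk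
      exact mul_ne_zero (wM_ne u k) ((map_ne_zero _).2 (wM_ne u (i0, false))) (Complex.ext e2 e1)
    · intro k hk e1
      exact hk ((lM_eq _ _ _).2 e1)
  · intro u
    exact Up_sec h hn i0 _

end Odd3

end MilnorTC

namespace MilnorTC

set_option linter.all false

lemma mil_empty {𝕜 : Type} [RCLike 𝕜] : IsEmpty (Mil 𝕜 0 0) :=
  ⟨fun p => lo_ne_hi le_rfl p (by omega)⟩

lemma zero_case {𝕜 : Type} [RCLike 𝕜] (n : ℕ) (hn : 2 ≤ n) : 1 ∈ TCset (Mil 𝕜 0 0) n := by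
  have : IsEmpty (Mil 𝕜 0 0) := mil_empty
  have he : IsEmpty (Fin n → Mil 𝕜 0 0) := ⟨fun y => this.false (y ⟨0, by omega⟩)⟩
  exact stratify 1 one_pos (fun _ => 0) (fun y => he.elim y) (fun _ => ()) (fun y => he.elim y) (fun _ => Set.univ)
    (fun y => he.elim y) (fun y => he.elim y) (fun y => he.elim y)

lemma bounds {𝕜 : Type} [RCLike 𝕜] (r s n : ℕ) (hsr : s ≤ r) (hn : 2 ≤ n)
    (hlow : ∀ q k : ℕ, 0 < r → 0 < q → 0 < r + s - 1 → k ∈ TCset (Mil 𝕜 r s) (q + 1) → q * (r + s - 1) + 1 ≤ k) :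
    (n - 1) * (r + s - 1) + 1 ≤ higherTC (↥(Mil 𝕜 r s)) n ∧
      higherTC (↥(Mil 𝕜 r s)) n ≤ n * (r + s - 1) + 1 := by
  have hup : n * (r + s - 1) + 1 ∈ TCset (Mil 𝕜 r s) n := by
    rcases Nat.eq_zero_or_pos r with h0 | hr
    · subst h0
      obtain rfl : s = 0 := by omega
      exact zero_case n hn
    · exact upper_mem hsr hr hn
  have hmem : higherTC (↥(Mil 𝕜 r s)) n ∈ TCset (Mil 𝕜 r s) n := Nat.sInf_mem ⟨_, hup⟩
  refine ⟨?_, higherTC_le hup⟩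
  rcases Nat.eq_zero_or_pos (r + s - 1) with h0 | hpos
  · rw [h0, mul_zero]
    exact hmem.1
  · obtain ⟨q, rfl⟩ : ∃ q, n = q + 1 := ⟨n - 1, by omega⟩
    exact hlow q _ (by omega) (by omega) hpos hmem

end MilnorTC

/-- For integers `0 ≤ s ≤ r`, `F ∈ {ℝ, ℂ}` and `n ≥ 2`,
`(n-1)(r+s-1) + 1 ≤ TC_n(FH_{r,s}) ≤ n(r+s-1) + 1`; moreover if both `r` and `s` are odd
then `TC_n(ℝH_{r,s}) ≤ n(r+s-1)`. -/
theorem higherTC_milnor_bounds (r s n : ℕ) (hsr : s ≤ r) (hn : 2 ≤ n) :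
    ((n - 1) * (r + s - 1) + 1 ≤ higherTC (↥(RealMilnor r s)) n ∧
      higherTC (↥(RealMilnor r s)) n ≤ n * (r + s - 1) + 1) ∧
    ((n - 1) * (r + s - 1) + 1 ≤ higherTC (↥(ComplexMilnor r s)) n ∧
      higherTC (↥(ComplexMilnor r s)) n ≤ n * (r + s - 1) + 1) ∧
    (Odd r → Odd s → higherTC (↥(RealMilnor r s)) n ≤ n * (r + s - 1)) := by
  rw [MilnorTC.realMilnor_eq, MilnorTC.complexMilnor_eq]
  refine ⟨MilnorTC.bounds r s n hsr hn ?_, MilnorTC.bounds r s n hsr hn ?_, ?_⟩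
  · intro q k hr hq hd hk
    exact MilnorTC.lower_real hsr hr q k hq hd hk
  · intro q k hr hq hd hk
    exact MilnorTC.lower_complex hsr hr q k hq hd hk
  · rintro ⟨R, rfl⟩ ⟨S, rfl⟩
    have h := MilnorTC.odd_mem (R := R) (S := S) (n := n) (by omega) hn
    have e : 2 * R + 1 + (2 * S + 1) - 1 = 2 * R + 2 * S + 1 := by omega
    rw [e]
    exact MilnorTC.higherTC_le h
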